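/- arXiv:2008.00014 — 2 statements merged into one kernel-verified Lean document; each statement's English description precedes it below -/
import Mathlib

section
/- A matroid M is representable over every field if and only if M is representable over 𝔽₂ and representable over at least one field whose characteristic is different from 2. -/
universe u v w

open Matroid Set

namespace Paper

/-- The deletion of the set `D` from the matroid `M`. -/
def delete {α : Type u} (M : Matroid α) (D : Set α) : Matroid α := M ↾ (M.E \ D)

/-- The contraction of the set `C` in the matroid `M`. -/
def contract {α : Type u} (M : Matroid α) (C : Set α) : Matroid α := (delete M✶ C)✶

/-- `N` is a minor of `M`: it is obtained from `M` by a sequence of deletions and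
contractions, equivalently by a single contraction followed by a single deletion. -/
def IsMinor {α : Type u} (N M : Matroid α) : Prop :=
  ∃ C D : Set α, N = delete (contract M C) D

/-- `M` is a copy of the uniform matroid `U(r,n)`: its ground set has `n` elements and its
independent sets are exactly the subsets of the ground set with at most `r` elements. -/
def IsUniform {α : Type u} (M : Matroid α) (r n : ℕ) : Prop :=
  M.E.Finite ∧ M.E.ncard = n ∧ ∀ I ⊆ M.E, (M.Indep I ↔ I.ncard ≤ r)

/-- `M` has a minor isomorphic to the uniform matroid `U(r,n)`. -/
def HasUniformMinor {α : Type u} (M : Matroid α) (r n : ℕ) : Prop :=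
  ∃ N : Matroid α, IsMinor N M ∧ IsUniform N r n

/-- `M` is without large uniform minors: no minor of `M` is isomorphic to `U(2,5)` or
`U(3,5)`. -/
def NoLargeUniformMinors {α : Type u} (M : Matroid α) : Prop :=
  ¬ HasUniformMinor M 2 5 ∧ ¬ HasUniformMinor M 3 5

/-- `M` is isomorphic to the Fano matroid `F₇`, the matroid on the seven nonzero vectors of
`(𝔽₂)³` whose independent sets are the `𝔽₂`-linearly independent subsets. -/
def IsFano {α : Type u} (M : Matroid α) : Prop :=
  ∃ f : α → (Fin 3 → ZMod 2),
    Set.BijOn f M.E {x | x ≠ 0} ∧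
    ∀ I ⊆ M.E, (M.Indep I ↔ Set.InjOn f I ∧
      LinearIndependent (ZMod 2) (fun x : (f '' I) => (x : Fin 3 → ZMod 2)))

/-- `M` has a minor isomorphic to the Fano matroid `F₇`. -/
def HasFanoMinor {α : Type u} (M : Matroid α) : Prop :=
  ∃ N : Matroid α, IsMinor N M ∧ IsFano N

/-- `M` has a minor isomorphic to the dual Fano matroid `F₇*`. -/
def HasFanoDualMinor {α : Type u} (M : Matroid α) : Prop :=
  ∃ N : Matroid α, IsMinor N M ∧ IsFano N✶

/-- `M` is representable over the field `K`: there are a `K`-vector space `V` and a map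
`φ` from the ground type to `V` such that a set `I ⊆ M.E` is independent in `M` if and only
if the family `φ` restricted to `I` is linearly independent over `K` (equivalently, `φ` is
injective on `I` and the image `φ '' I` is linearly independent). -/
def Representable {α : Type u} (M : Matroid α) (K : Type v) [Field K] : Prop :=
  ∃ (V : Type (max u v)) (_ : AddCommGroup V) (_ : Module K V) (φ : α → V),
    ∀ I ⊆ M.E, (M.Indep I ↔ LinearIndependent K (fun x : I => φ x))

theorem det_eq_mul_det_schur {R : Type*} [CommRing R] {k : ℕ}
    (D : Matrix (Fin (k + 1)) (Fin (k + 1)) R) (h : D 0 0 * D 0 0 = 1) :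
    D.det = D 0 0 *
      (Matrix.of fun i j : Fin k => D i.succ j.succ - D i.succ 0 * D 0 0 * D 0 j.succ).det := by
  let c : Fin (k + 1) → R := Fin.cons 0 fun i => D i.succ 0 * D 0 0
  let D' : Matrix (Fin (k + 1)) (Fin (k + 1)) R := Matrix.of fun i j => D i j - c i * D 0 j
  have h0 : ∀ j, D' 0 j = D 0 j := fun j => by simp [D', c]
  have hdet : D.det = D'.det := by
    refine Matrix.det_eq_of_forall_row_eq_smul_add_const c 0 (by simp [c]) fun i j => ?_
    simp [h0, D']
  have hcol : ∀ i : Fin k, D' i.succ 0 = 0 := fun i => by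
    simp only [D', c, Matrix.of_apply, Fin.cons_succ]
    linear_combination (-D i.succ 0) * h
  rw [hdet, Matrix.det_succ_column_zero, Fin.sum_univ_succ]
  simp only [hcol, h0]
  simp
  rfl

/-- Pivoting on a unit entry turns minors of the Schur complement into minors of `D`. -/
theorem det_submatrix_cons {R : Type*} [CommRing R] {k l : ℕ}
    (D : Matrix (Fin (k + 1)) (Fin (k + 1)) R) (h : D 0 0 * D 0 0 = 1) (r c : Fin l → Fin k) :
    (D.submatrix (Fin.cons 0 (Fin.succ ∘ r) : Fin (l + 1) → _)
        (Fin.cons 0 (Fin.succ ∘ c) : Fin (l + 1) → _)).det = D 0 0 *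
      ((Matrix.of fun i j : Fin k =>
        D i.succ j.succ - D i.succ 0 * D 0 0 * D 0 j.succ).submatrix r c).det := by
  rw [det_eq_mul_det_schur _ (by simpa using h)]
  rfl

/-- A matrix with entries in `{0, 1, -1}` whose minors vanish over `K` exactly when they vanish
modulo `2` has determinant in `{0, 1, -1}`. -/
theorem det_mem_of_minors_compatible {K : Type*} [Field K] (hK : ringChar K ≠ 2) {k : ℕ}
    (D : Matrix (Fin k) (Fin k) ℤ) (hD : ∀ i j, D i j = 0 ∨ D i j = 1 ∨ D i j = -1)
    (hc : ∀ (l : ℕ) (r c : Fin l → Fin k),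
      ((D.submatrix r c).det : K) = 0 ↔ ((D.submatrix r c).det : ZMod 2) = 0) :
    D.det = 0 ∨ D.det = 1 ∨ D.det = -1 := by
  have h2 : (2 : K) ≠ 0 := Ring.two_ne_zero hK
  induction k with
  | zero => simp
  | succ k ih =>
    by_cases hz : ∀ i j, D i j = 0
    · left
      rw [show D = 0 from Matrix.ext hz, Matrix.det_zero]
    push Not at hz
    obtain ⟨i₀, j₀, hij⟩ := hz
    have key : ∀ D : Matrix (Fin (k + 1)) (Fin (k + 1)) ℤ,
        (∀ i j, D i j = 0 ∨ D i j = 1 ∨ D i j = -1) →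
        (∀ (l : ℕ) (r c : Fin l → Fin (k + 1)),
          ((D.submatrix r c).det : K) = 0 ↔ ((D.submatrix r c).det : ZMod 2) = 0) →
        D 0 0 ≠ 0 → D.det = 0 ∨ D.det = 1 ∨ D.det = -1 := by
      intro D hD hc h0
      have hε : D 0 0 * D 0 0 = 1 := by
        rcases hD 0 0 with h | h | h <;> simp_all
      have hε' : D 0 0 = 1 ∨ D 0 0 = -1 := by
        rcases hD 0 0 with h | h | h <;> simp_all
      have hS := ih (Matrix.of fun i j : Fin k =>
        D i.succ j.succ - D i.succ 0 * D 0 0 * D 0 j.succ) ?_ ?_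
      · rw [det_eq_mul_det_schur D hε]
        rcases hS with h | h | h <;> rcases hε' with h' | h' <;> rw [h, h'] <;> simp
      · intro i j
        have h1 := hc 2 ![0, i.succ] ![0, j.succ]
        rw [Matrix.det_fin_two] at h1
        simp only [Matrix.submatrix_apply, Matrix.cons_val_zero, Matrix.cons_val_one] at h1
        simp only [Matrix.of_apply]
        have hz2 : (2 : ZMod 2) = 0 := rfl
        rcases hε' with h | h <;> rcases hD i.succ 0 with h' | h' | h' <;>
          rcases hD 0 j.succ with h'' | h'' | h'' <;>
          rcases hD i.succ j.succ with h''' | h''' | h''' <;>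
          simp [h, h', h'', h''', h2, hz2] at h1 ⊢
      · intro l r c
        have h1 := hc (l + 1) (Fin.cons 0 (Fin.succ ∘ r)) (Fin.cons 0 (Fin.succ ∘ c))
        rw [det_submatrix_cons D hε] at h1
        rcases hε' with h | h <;> simpa [h] using h1
    have hk := key (D.submatrix (Equiv.swap 0 i₀) (Equiv.swap 0 j₀)) (fun i j => hD _ _)
      (fun l r c => by rw [Matrix.submatrix_submatrix]; exact hc _ _ _) (by simpa using hij)
    have hr := Matrix.det_permute (Equiv.swap 0 i₀) D
    have hrc := Matrix.det_permute' (Equiv.swap 0 j₀) (D.submatrix (Equiv.swap 0 i₀) id)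
    rw [Matrix.submatrix_submatrix, hr] at hrc
    change (D.submatrix (Equiv.swap 0 i₀) (Equiv.swap 0 j₀)).det = _ at hrc
    rw [hrc] at hk
    rcases Int.units_eq_one_or (Equiv.Perm.sign (Equiv.swap 0 j₀)) with h | h <;>
      rcases Int.units_eq_one_or (Equiv.Perm.sign (Equiv.swap 0 i₀)) with h' | h' <;>
      simp [h, h'] at hk <;> omega

theorem sum_eq_add_of_cyclic_support {R : Type*} [AddCommMonoid R] {n : ℕ} (f : Fin (n + 2) → R)
    (i : Fin (n + 2)) (hf : ∀ j, j ≠ i → j ≠ i + 1 → f j = 0) : ∑ j, f j = f i + f (i + 1) := by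
  rw [← Finset.sum_pair (show i ≠ i + 1 from fun h => by simp at h)]
  refine (Finset.sum_subset (Finset.subset_univ _) fun j _ hj => ?_).symm
  simp only [Finset.mem_insert, Finset.mem_singleton, not_or] at hj
  exact hf j hj.1 hj.2

theorem sq_prod_eq_sq_prod_of_cyclic_support {K : Type*} [Field K] {n : ℕ}
    (B : Matrix (Fin (n + 2)) (Fin (n + 2)) K) (C : Matrix (Fin (n + 2)) (Fin (n + 2)) (ZMod 2))
    (hBC : ∀ i j, B i j = 0 ↔ C i j = 0) (hdet : C.det = 0 → B.det = 0)
    (hB : ∀ i j, B i j ≠ 0 ↔ j = i ∨ j = i + 1) :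
    (∏ i, B i i) ^ 2 = (∏ i, B i (i + 1)) ^ 2 := by
  have hzero : ∀ i j, j ≠ i → j ≠ i + 1 → B i j = 0 := fun i j h h' => by
    by_contra hc
    rcases (hB i j).1 hc with h'' | h'' <;> contradiction
  have hC : C.det = 0 := by
    refine Matrix.exists_mulVec_eq_zero_iff.1 ⟨1, one_ne_zero, funext fun i => ?_⟩
    have hone : ∀ x : ZMod 2, x ≠ 0 → x = 1 := by decide
    change ∑ j, C i j * 1 = 0
    rw [sum_eq_add_of_cyclic_support (fun j => C i j * 1) i fun j h h' => by
      simp [(hBC i j).1 (hzero i j h h')], hone _ (mt (hBC i i).2 ((hB i i).2 (Or.inl rfl))),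
      hone _ (mt (hBC i (i + 1)).2 ((hB i (i + 1)).2 (Or.inr rfl)))]
    rfl
  obtain ⟨v, hv, hBv⟩ := Matrix.exists_mulVec_eq_zero_iff.2 (hdet hC)
  have hrow : ∀ i, B i i * v i = -(B i (i + 1) * v (i + 1)) := fun i => by
    have : ∑ j, B i j * v j = 0 := congrFun hBv i
    rw [sum_eq_add_of_cyclic_support (fun j => B i j * v j) i fun j h h' => by
      simp [hzero i j h h']] at this
    exact eq_neg_of_add_eq_zero_left this
  have hv0 : ∀ i, v i ≠ 0 := by
    have hstep : ∀ i, v i = 0 ↔ v (i + 1) = 0 := fun i => by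
      have h1 := (hB i i).2 (Or.inl rfl)
      have h2 := (hB i (i + 1)).2 (Or.inr rfl)
      constructor <;> intro h <;> simpa [h, h1, h2] using hrow i
    have hall : ∀ i, v i = 0 ↔ v 0 = 0 := by
      intro i
      induction i using Fin.induction with
      | zero => rfl
      | succ i ih => rw [← ih, hstep i.castSucc, Fin.coeSucc_eq_succ]
    intro i hi
    exact hv (funext fun j => (hall j).2 ((hall i).1 hi))
  have hprod : (∏ i, B i i) * ∏ i, v i = (-1) ^ (n + 2) * ((∏ i, B i (i + 1)) * ∏ i, v i) := by
    have hshift : ∏ i, v (i + 1) = ∏ i, v i := Equiv.prod_comp (Equiv.addRight 1) v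
    rw [← Finset.prod_mul_distrib, ← hshift, ← Finset.prod_mul_distrib, Finset.prod_congr rfl
      fun i _ => hrow i, Finset.prod_neg]
    simp
  have hV : ∏ i, v i ≠ 0 := Finset.prod_ne_zero_iff.2 fun i _ => hv0 i
  rw [← mul_assoc] at hprod
  rw [mul_right_cancel₀ hV hprod, mul_pow, ← pow_mul, mul_comm (n + 2), pow_mul]
  simp

section Walk

variable {V K : Type*} [Field K] {G : SimpleGraph V}

/-- The product of the weights of the darts of a walk. -/
def walkProd (w : V → V → K) : ∀ {u v : V}, G.Walk u v → K
  | _, _, .nil => 1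
  | u, _, .cons (v := v) _ p => w u v * walkProd w p

theorem walkProd_append (w : V → V → K) {a b c : V} (p : G.Walk a b) (q : G.Walk b c) :
    walkProd w (p.append q) = walkProd w p * walkProd w q := by
  induction p with
  | nil => simp [walkProd]
  | cons h p ih => simp [walkProd, ih, mul_assoc]

theorem walkProd_reverse (w : V → V → K) (hw : ∀ x y, w y x = (w x y)⁻¹) {a b : V}
    (p : G.Walk a b) : walkProd w p.reverse = (walkProd w p)⁻¹ := by
  induction p with
  | nil => simp [walkProd]
  | @cons x y _ h p ih => simp [walkProd, walkProd_append, ih, hw x y, mul_comm]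

theorem walkProd_ne_zero (w : V → V → K) (hw : ∀ x y, G.Adj x y → w x y ≠ 0) {a b : V}
    (p : G.Walk a b) : walkProd w p ≠ 0 := by
  induction p with
  | nil => simp [walkProd]
  | cons h p ih => exact mul_ne_zero (hw _ _ h) ih

theorem walkProd_eq_prod_range (w : V → V → K) {a b : V} (p : G.Walk a b) :
    walkProd w p = ∏ k ∈ Finset.range p.length, w (p.getVert k) (p.getVert (k + 1)) := by
  induction p with
  | nil => simp [walkProd]
  | cons h p ih => simp [walkProd, ih, Finset.prod_range_succ', mul_comm]

theorem take_append_drop {a b : V} (p : G.Walk a b) (s : ℕ) (hs : s ≤ p.length) :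
    (p.take s).append (p.drop s) = p := by
  apply SimpleGraph.Walk.ext_support
  rw [SimpleGraph.Walk.support_append, SimpleGraph.Walk.support_take,
    SimpleGraph.Walk.drop_support_eq_support_drop_min, min_eq_left hs, List.tail_drop,
    List.take_append_drop]

theorem exists_append_of_getVert {a b x : V} (p : G.Walk a b) (s : ℕ) (hs : s ≤ p.length)
    (hx : p.getVert s = x) : ∃ (p₁ : G.Walk a x) (p₂ : G.Walk x b), p = p₁.append p₂ ∧
      p₁.length = s ∧ p₂.length = p.length - s := by
  subst hx
  exact ⟨p.take s, p.drop s, (take_append_drop p s hs).symm, by simpa, by simp⟩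

theorem exists_append_append {a b : V} (p : G.Walk a b) (s t : ℕ) (hst : s ≤ t)
    (ht : t ≤ p.length) :
    ∃ (p₁ : G.Walk a (p.getVert s)) (p₂ : G.Walk (p.getVert s) (p.getVert t))
      (p₃ : G.Walk (p.getVert t) b), p = p₁.append (p₂.append p₃) ∧
      p₁.length = s ∧ p₂.length = t - s ∧ p₃.length = p.length - t := by
  obtain ⟨p₂, p₃, h, h₂, h₃⟩ := exists_append_of_getVert (p.drop s) (t - s)
    (by simp; omega) (x := p.getVert t) (by
      rw [SimpleGraph.Walk.drop_getVert, Nat.add_sub_cancel' hst])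
  refine ⟨p.take s, p₂, p₃, ?_, ?_, h₂, ?_⟩
  · rw [← h, take_append_drop p s (hst.trans ht)]
  · simp; omega
  · rw [h₃, SimpleGraph.Walk.drop_length]; omega

/-- If all chordless closed walks have trivial squared weight, then so do all closed walks. -/
theorem sq_walkProd_closed (w : V → V → K) (hw : ∀ x y, w y x = (w x y)⁻¹)
    (hG : ∀ x y, G.Adj x y → w x y ≠ 0)
    (hcyc : ∀ (u : V) (c : G.Walk u u),
      (∀ s t, s + 2 ≤ t → t ≤ c.length → t - s + 1 < c.length →
        ¬ G.Adj (c.getVert s) (c.getVert t)) → walkProd w c ^ 2 = 1)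
    {u : V} (c : G.Walk u u) : walkProd w c ^ 2 = 1 := by
  induction hn : c.length using Nat.strong_induction_on generalizing u with
  | _ n ih =>
    by_cases hch : ∀ s t, s + 2 ≤ t → t ≤ c.length → t - s + 1 < c.length →
        ¬ G.Adj (c.getVert s) (c.getVert t)
    · exact hcyc u c hch
    push Not at hch
    obtain ⟨s, t, hst, ht, hlt, hadj⟩ := hch
    obtain ⟨p₁, p₂, p₃, hp, h₁, h₂, h₃⟩ := exists_append_append c s t (by omega) ht
    have e₁ := ih (p₁.append (.cons hadj p₃)).length (by simp; omega) _ rfl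
    have e₂ := ih (SimpleGraph.Walk.cons hadj.symm p₂).length (by simp; omega) _ rfl
    rw [hp]
    simp only [walkProd_append, walkProd] at e₁ e₂ ⊢
    have hne := hG _ _ hadj
    rw [hw] at e₂
    calc _ = (walkProd w p₁ * (w (c.getVert s) (c.getVert t) * walkProd w p₃)) ^ 2 *
          ((w (c.getVert s) (c.getVert t))⁻¹ * walkProd w p₂) ^ 2 := by field_simp
      _ = 1 := by rw [e₁, e₂, one_mul]

theorem exists_potential (w : V → V → K) (hw : ∀ x y, w y x = (w x y)⁻¹)
    (hG : ∀ x y, G.Adj x y → w x y ≠ 0)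
    (hclosed : ∀ (u : V) (c : G.Walk u u), walkProd w c ^ 2 = 1) :
    ∃ p : V → K, (∀ v, p v ≠ 0) ∧ ∀ x y, G.Adj x y → (p x * w x y * (p y)⁻¹) ^ 2 = 1 := by
  let root : V → V := fun v => (G.connectedComponentMk v).out
  have hr : ∀ v, G.Reachable (root v) v := fun v =>
    SimpleGraph.ConnectedComponent.exact (Quot.out_eq _)
  refine ⟨fun v => walkProd w (hr v).some, fun v => walkProd_ne_zero w hG _, fun x y hxy => ?_⟩
  have hxy' : root y = root x := by
    simp only [root]
    rw [SimpleGraph.ConnectedComponent.sound hxy.reachable]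
  have := hclosed _ (((hr x).some.append (.cons hxy .nil)).append
    ((hr y).some.copy hxy' rfl).reverse)
  rw [walkProd_append, walkProd_append, walkProd_reverse w hw] at this
  have hcopy : ∀ {a a' b : V} (q : G.Walk a b) (h : a = a'),
      walkProd w (q.copy h rfl) = walkProd w q := by
    rintro a _ b q rfl; rfl
  rw [hcopy] at this
  simpa [walkProd] using this

end Walk

section Bipartite

variable {m n K : Type*} [Field K]

/-- Corresponding square submatrices of `A` and `C` are singular simultaneously. -/
def DetCompat {L : Type*} [Field L] (A : Matrix m n K) (C : Matrix m n L) : Prop :=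
  ∀ (k : ℕ) (r : Fin k → m) (c : Fin k → n),
    (A.submatrix r c).det = 0 ↔ (C.submatrix r c).det = 0

theorem DetCompat.apply {L : Type*} [Field L] {A : Matrix m n K} {C : Matrix m n L}
    (h : DetCompat A C) (i : m) (j : n) : A i j = 0 ↔ C i j = 0 := by
  simpa using h 1 (fun _ => i) (fun _ => j)

/-- The entries of a matrix as weights on the darts of its bipartite graph. -/
def bipWeight (A : Matrix m n K) : m ⊕ n → m ⊕ n → K
  | .inl i, .inr j => A i j
  | .inr j, .inl i => (A i j)⁻¹
  | _, _ => 0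

theorem bipWeight_swap (A : Matrix m n K) (x y : m ⊕ n) :
    bipWeight A y x = (bipWeight A x y)⁻¹ := by
  rcases x with x | x <;> rcases y with y | y <;> simp [bipWeight]

/-- The bipartite graph of the nonzero entries of a matrix. -/
def bipGraph (A : Matrix m n K) : SimpleGraph (m ⊕ n) where
  Adj x y := bipWeight A x y ≠ 0
  symm := ⟨fun x y h => by rw [bipWeight_swap]; exact inv_ne_zero h⟩
  loopless := ⟨fun x h => by rcases x with x | x <;> simp [bipWeight] at h⟩

theorem isLeft_of_adj {A : Matrix m n K} {x y : m ⊕ n} (h : (bipGraph A).Adj x y) :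
    y.isLeft = !x.isLeft := by
  change bipWeight A x y ≠ 0 at h
  rcases x with x | x <;> rcases y with y | y <;> simp [bipWeight] at h ⊢

theorem prod_range_two_mul {M : Type*} [CommMonoid M] (f : ℕ → M) (k : ℕ) :
    ∏ i ∈ Finset.range (2 * k), f i = ∏ i ∈ Finset.range k, f (2 * i) * f (2 * i + 1) := by
  induction k with
  | zero => simp
  | succ k ih =>
    rw [show 2 * (k + 1) = 2 * k + 1 + 1 by ring, Finset.prod_range_succ, Finset.prod_range_succ,
      ih, Finset.prod_range_succ, mul_assoc]

theorem sq_walkProd_chordless {A : Matrix m n K} {C : Matrix m n (ZMod 2)} (hAC : DetCompat A C)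
    {u : m ⊕ n} (c : (bipGraph A).Walk u u)
    (hc : ∀ s t, s + 2 ≤ t → t ≤ c.length → t - s + 1 < c.length →
        ¬ (bipGraph A).Adj (c.getVert s) (c.getVert t)) :
    walkProd (bipWeight A) c ^ 2 = 1 := by
  have hpar : ∀ k ≤ c.length, (c.getVert k).isLeft = (u.isLeft ^^ decide (k % 2 = 1)) := by
    intro k hk
    induction k with
    | zero => simp
    | succ k ih =>
      rw [isLeft_of_adj (c.adj_getVert_succ hk), ih (by omega)]
      rcases Nat.mod_two_eq_zero_or_one k with h | h
      · simp [h, show (k + 1) % 2 = 1 by omega]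
      · simp [h, show (k + 1) % 2 = 0 by omega]
  obtain ⟨N, hN⟩ : ∃ N, c.length = 2 * N := by
    have := hpar c.length le_rfl
    rw [c.getVert_length] at this
    exact ⟨c.length / 2, by cases h : u.isLeft <;> simp [h] at this <;> omega⟩
  rw [walkProd_eq_prod_range, hN, prod_range_two_mul]
  match N with
  | 0 => simp
  | 1 =>
    have h2 : c.getVert (0 + 1 + 1) = c.getVert 0 := by
      rw [c.getVert_of_length_le (by omega), c.getVert_zero]
    have hne : bipWeight A (c.getVert 0) (c.getVert (0 + 1)) ≠ 0 :=
      c.adj_getVert_succ (i := 0) (by omega)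
    rw [Finset.prod_range_one, mul_zero, h2, bipWeight_swap A (c.getVert 0), mul_inv_cancel₀ hne,
      one_pow]
  | N + 2 =>
    let e : Fin (N + 2) → m ⊕ n := fun k => c.getVert (2 * k)
    let o : Fin (N + 2) → m ⊕ n := fun k => c.getVert (2 * k + 1)
    have hval : ∀ k : Fin (N + 2), ((k + 1 : Fin (N + 2)) : ℕ) =
        if (k : ℕ) = N + 1 then 0 else (k : ℕ) + 1 := by
      intro k
      rw [Fin.val_add_one]
      simp [Fin.ext_iff]
    have he : ∀ k : Fin (N + 2), c.getVert (2 * k + 1 + 1) = e (k + 1) := by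
      intro k
      simp only [e, hval]
      split_ifs with h
      · rw [c.getVert_of_length_le (by omega), mul_zero, c.getVert_zero]
      · congr 1
    have hsupp : ∀ k l, bipWeight A (e l) (o k) ≠ 0 ↔ l = k ∨ l = k + 1 := by
      intro k l
      constructor
      · intro h
        by_contra! hkl
        have h1 : (l : ℕ) ≠ k := fun h => hkl.1 (Fin.ext h)
        have h2 : (l : ℕ) ≠ if (k : ℕ) = N + 1 then 0 else (k : ℕ) + 1 :=
          fun h => hkl.2 (Fin.ext (h.trans (hval k).symm))
        rcases lt_or_gt_of_ne h1 with hlt | hlt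
        · exact hc (2 * l) (2 * k + 1) (by omega) (by omega) (by split_ifs at h2 <;> omega) h
        · refine hc (2 * k + 1) (2 * l) ?_ (by omega) (by omega) (SimpleGraph.Adj.symm h)
          split_ifs at h2 <;> omega
      · rintro (rfl | rfl)
        · exact c.adj_getVert_succ (by omega)
        · rw [← he]
          exact (c.adj_getVert_succ (i := 2 * k + 1) (by omega)).symm
    have hprod : ∏ i ∈ Finset.range (N + 2),
          bipWeight A (c.getVert (2 * i)) (c.getVert (2 * i + 1)) *
            bipWeight A (c.getVert (2 * i + 1)) (c.getVert (2 * i + 1 + 1)) =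
        (∏ k, bipWeight A (e k) (o k)) * (∏ k, bipWeight A (e (k + 1)) (o k))⁻¹ := by
      rw [Finset.prod_range, Finset.prod_mul_distrib, ← Finset.prod_inv_distrib]
      congr 1
      refine Finset.prod_congr rfl fun k _ => ?_
      rw [he, bipWeight_swap]
    rw [hprod, mul_pow, inv_pow]
    have hne : (∏ k, bipWeight A (e (k + 1)) (o k)) ^ 2 ≠ 0 :=
      pow_ne_zero _ (Finset.prod_ne_zero_iff.2 fun k _ => (hsupp k (k + 1)).2 (Or.inr rfl))
    suffices h : (∏ k, bipWeight A (e k) (o k)) ^ 2 =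
        (∏ k, bipWeight A (e (k + 1)) (o k)) ^ 2 by
      rw [h, mul_inv_cancel₀ hne]
    have hel : ∀ k, (e k).isLeft = u.isLeft := fun k => by
      rw [hpar _ (by omega)]
      simp
    have hol : ∀ k, (o k).isLeft = !u.isLeft := fun k => by
      rw [hpar _ (by omega)]
      simp [show (2 * (k : ℕ) + 1) % 2 = 1 by omega]
    cases hu : u.isLeft
    · have h1 : ∀ k, ∃ j, e k = .inr j := fun k =>
        Sum.isRight_iff.1 (by simp [← Sum.not_isLeft, hel, hu])
      have h2 : ∀ k, ∃ i, o k = .inl i := fun k => Sum.isLeft_iff.1 (by rw [hol, hu]; rfl)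
      choose s hs using h1
      choose r hr using h2
      simp only [hs, hr, bipWeight, Finset.prod_inv_distrib, ne_eq, inv_eq_zero] at hsupp ⊢
      rw [inv_pow, inv_pow, inv_inj]
      exact sq_prod_eq_sq_prod_of_cyclic_support (A.submatrix r s) (C.submatrix r s)
        (fun i j => hAC.apply _ _) (hAC _ r s).2 hsupp
    · have h1 : ∀ k, ∃ i, e k = .inl i := fun k => Sum.isLeft_iff.1 (by rw [hel, hu])
      have h2 : ∀ k, ∃ j, o k = .inr j := fun k =>
        Sum.isRight_iff.1 (by simp [← Sum.not_isLeft, hol, hu])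
      choose r hr using h1
      choose s hs using h2
      simp only [hs, hr, bipWeight] at hsupp ⊢
      refine sq_prod_eq_sq_prod_of_cyclic_support (A.submatrix r s).transpose
        (C.submatrix r s).transpose (fun i j => hAC.apply _ _) ?_ hsupp
      rw [Matrix.det_transpose, Matrix.det_transpose]
      exact (hAC _ r s).2

/-- A matrix whose minors vanish as those of a binary matrix can be scaled to have entries in
`{0, 1, -1}`. -/
theorem exists_scaling {A : Matrix m n K} {C : Matrix m n (ZMod 2)} (hAC : DetCompat A C) :
    ∃ (p : m → K) (q : n → K), (∀ i, p i ≠ 0) ∧ (∀ j, q j ≠ 0) ∧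
      ∀ i j, p i * A i j * q j = 0 ∨ p i * A i j * q j = 1 ∨ p i * A i j * q j = -1 := by
  obtain ⟨p, hp, h⟩ := exists_potential (G := bipGraph A) (bipWeight A) (bipWeight_swap A)
    (fun _ _ h => h) fun u c => sq_walkProd_closed (bipWeight A) (bipWeight_swap A)
      (fun _ _ h => h) (fun u c hc => sq_walkProd_chordless hAC c hc) c
  refine ⟨fun i => p (.inl i), fun j => (p (.inr j))⁻¹, fun i => hp _,
    fun j => inv_ne_zero (hp _), fun i j => ?_⟩
  by_cases h0 : A i j = 0
  · simp [h0]
  · exact Or.inr (mul_self_eq_one_iff.1 (by rw [← sq]; exact h (.inl i) (.inr j) h0))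

/-- A binary matrix with compatible minors over a field of characteristic different from `2` lifts
to an integer matrix whose minors vanish over every field exactly when the binary ones do. -/
theorem exists_unimodular {A : Matrix m n K} {C : Matrix m n (ZMod 2)}
    (hAC : DetCompat A C) (hK : ringChar K ≠ 2) :
    ∃ Z : Matrix m n ℤ, ∀ (L : Type*) [Field L],
      DetCompat (Z.map (Int.cast : ℤ → L)) C := by
  obtain ⟨p, q, hp, hq, h⟩ := exists_scaling hAC
  have hZ : ∀ i j, ∃ z : ℤ, (z = 0 ∨ z = 1 ∨ z = -1) ∧ (z : K) = p i * A i j * q j := by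
    intro i j
    rcases h i j with h | h | h
    · exact ⟨0, by simp, by simp [h]⟩
    · exact ⟨1, by simp, by simp [h]⟩
    · exact ⟨-1, by simp, by simp [h]⟩
  choose Z hZ hZK using hZ
  have hdet : ∀ {k} (r : Fin k → m) (c : Fin k → n),
      (((Matrix.of Z).submatrix r c).det : K) = 0 ↔ (A.submatrix r c).det = 0 := by
    intro k r c
    have : ((Matrix.of Z).submatrix r c).map (Int.cast : ℤ → K) =
          Matrix.of fun i j =>
            q (c j) * (Matrix.of fun i j => p (r i) * A.submatrix r c i j) i j := by
      ext i j
      simp [hZK, mul_comm]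
    rw [Int.cast_det, this, Matrix.det_mul_row, Matrix.det_mul_column]
    simp [Finset.prod_eq_zero_iff, hp, hq]
  have hbin : (Matrix.of Z).map (Int.cast : ℤ → ZMod 2) = C := by
    ext i j
    have h1 : Z i j = 0 ↔ C i j = 0 := by
      rw [← hAC.apply]
      have := hZK i j
      constructor
      · intro h0
        simpa [h0, hp, hq] using this.symm
      · intro h0
        rcases hZ i j with h | h | h <;> simp_all
    rcases hZ i j with h | h | h
    · simp [h, h1.1 h]
    all_goals
      have h2 : C i j ≠ 0 := fun h0 => by simp [h1.2 h0] at h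
      simp only [Matrix.map_apply, Matrix.of_apply, h]
      revert h2
      generalize C i j = x
      revert x
      decide
  have hbdet : ∀ {k} (r : Fin k → m) (c : Fin k → n),
      (((Matrix.of Z).submatrix r c).det : ZMod 2) = (C.submatrix r c).det := by
    intro k r c
    rw [Int.cast_det, ← hbin]
    rfl
  refine ⟨Matrix.of Z, fun L _ k r c => ?_⟩
  have key := det_mem_of_minors_compatible hK ((Matrix.of Z).submatrix r c)
    (fun i j => hZ _ _) fun l r' c' => by
      rw [Matrix.submatrix_submatrix, hdet, hbdet]
      exact hAC _ _ _
  have hL : ((Matrix.of Z).map (Int.cast : ℤ → L)).submatrix r c =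
      ((Matrix.of Z).submatrix r c).map Int.cast := rfl
  rw [hL, ← Int.cast_det, ← hbdet]
  rcases key with h | h | h <;> simp [h]

end Bipartite

section Representations

variable {m n K L : Type*} [Field K] [Field L]

theorem linearIndependent_comp_iff_det_ne_zero {k : ℕ} {W : Type*} [AddCommGroup W] [Module K W]
    (ρ : W →ₗ[K] Fin k → K) (v : Fin k → W) :
    LinearIndependent K (ρ ∘ v) ↔ (Matrix.of fun i j => ρ (v j) i).det ≠ 0 := by
  rw [← isUnit_iff_ne_zero, ← Matrix.isUnit_iff_isUnit_det,
    ← Matrix.linearIndependent_cols_iff_isUnit]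
  rfl

theorem linearIndependent_col_iff_exists_det_ne_zero (A : Matrix m n K) {k : ℕ}
    (c : Fin k → n) :
    LinearIndependent K (A.col ∘ c) ↔ ∃ r : Fin k → m, (A.submatrix r c).det ≠ 0 := by
  constructor
  · intro h
    have hspan : Submodule.span K (range fun b (j : Fin k) => A b (c j)) = ⊤ := by
      by_contra hne
      obtain ⟨f, hf, hle⟩ := Submodule.exists_le_ker_of_lt_top _ (lt_top_iff_ne_top.2 hne)
      refine hf (LinearMap.pi_ext' fun j => LinearMap.ext_ring ?_)
      refine Fintype.linearIndependent_iff.1 h (fun j => f (Pi.single j 1)) (funext fun b => ?_) j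
      have := hle (Submodule.subset_span (mem_range_self b))
      rw [LinearMap.mem_ker, LinearMap.pi_apply_eq_sum_univ] at this
      have hs : ∀ i : Fin k, (fun j => if i = j then (1 : K) else 0) = Pi.single i 1 := fun i => by
        ext j
        simp [Pi.single_apply, eq_comm]
      simpa [hs, mul_comm] using this
    obtain ⟨κ, a, -, ha, hli⟩ :=
      exists_linearIndependent' K fun b (j : Fin k) => A b (c j)
    rw [hspan] at ha
    let bas := Module.Basis.mk hli ha.ge
    let e : Fin k ≃ κ := (Pi.basisFun K (Fin k)).indexEquiv bas
    refine ⟨a ∘ e, ?_⟩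
    rw [← isUnit_iff_ne_zero, ← Matrix.isUnit_iff_isUnit_det,
      ← Matrix.linearIndependent_rows_iff_isUnit]
    exact hli.comp e e.injective
  · rintro ⟨r, hr⟩
    exact ((linearIndependent_comp_iff_det_ne_zero (LinearMap.funLeft K K r)
      (A.col ∘ c)).2 hr).of_comp _

theorem DetCompat.linearIndepOn_iff {A : Matrix m n K} {C : Matrix m n L} (h : DetCompat A C)
    (S : Set n) : LinearIndepOn K A.col S ↔ LinearIndepOn L C.col S := by
  rw [linearIndepOn_iff_linearIndepOn_finset, linearIndepOn_iff_linearIndepOn_finset]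
  refine forall₂_congr fun t _ => ?_
  let e : Fin t.card ≃ t := t.equivFin.symm
  rw [LinearIndepOn, LinearIndepOn, ← linearIndependent_equiv e, ← linearIndependent_equiv e]
  change LinearIndependent K (A.col ∘ fun i => (e i : n)) ↔
    LinearIndependent L (C.col ∘ fun i => (e i : n))
  simp only [linearIndependent_col_iff_exists_det_ne_zero, ne_eq, h _ _ _]

theorem linearIndependent_singles_sum_iff {ι : Type*} {k : ℕ} (r : Fin k → ι)
    (v : Fin k → ι →₀ K) :
    LinearIndependent K
        (Sum.elim (fun b : ((range r)ᶜ : Set ι) => Finsupp.single (b : ι) (1 : K)) v) ↔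
      (Matrix.of fun i j => v j (r i)).det ≠ 0 := by
  let ρ : (ι →₀ K) →ₗ[K] Fin k → K := LinearMap.funLeft K K r ∘ₗ Finsupp.lcoeFun
  have hker : Submodule.span K
      (range fun b : ((range r)ᶜ : Set ι) => Finsupp.single (b : ι) (1 : K)) = LinearMap.ker ρ := by
    have := Finsupp.supported_eq_span_single K ((range r)ᶜ : Set ι)
    rw [image_eq_range] at this
    rw [← this]
    ext x
    simp only [Finsupp.mem_supported', LinearMap.mem_ker, funext_iff]
    simp [ρ, LinearMap.funLeft_apply]
  have hdet := linearIndependent_comp_iff_det_ne_zero ρ v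
  change _ ↔ (Matrix.of fun i j => v j (r i)).det ≠ 0 at hdet
  rw [← hdet, linearIndependent_sum]
  simp only [Sum.elim_comp_inl, Sum.elim_comp_inr, hker]
  constructor
  · rintro ⟨-, h, hdisj⟩
    exact (ρ.linearIndependent_iff_of_disjoint hdisj.symm).2 h
  · intro h
    exact ⟨(Finsupp.linearIndependent_single_one K ι).comp _ Subtype.val_injective, h.of_comp _,
      (Submodule.range_ker_disjoint h).symm⟩

/-- The family `φ` on the ground set represents `M`. -/
def Represents {α : Type*} (M : Matroid α) (K : Type*) [Field K] {W : Type*} [AddCommGroup W]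
    [Module K W] (φ : M.E → W) : Prop :=
  ∀ S : Set M.E, M.Indep (Subtype.val '' S) ↔ LinearIndepOn K φ S

theorem Represents.linearIndependent_comp_iff {α : Type*} {M : Matroid α} {W : Type*}
    [AddCommGroup W] [Module K W] {φ : M.E → W} (h : Represents M K φ) {ι : Type*} (c : ι → M.E) :
    LinearIndependent K (φ ∘ c) ↔
      Function.Injective c ∧ M.Indep (range fun i => (c i : α)) := by
  rw [show range (fun i => (c i : α)) = Subtype.val '' range c from range_comp _ _, h]
  constructor
  · intro hc
    have := hc.injective.of_comp
    exact ⟨this, (linearIndepOn_range_iff this φ).2 hc⟩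
  · rintro ⟨hc, hli⟩
    exact (linearIndepOn_range_iff hc φ).1 hli

/-- A representation can be replaced by its coordinates with respect to a base. -/
theorem Represents.exists_finsupp {α : Type*} {M : Matroid α} {W : Type*}
    [AddCommGroup W] [Module K W] {φ : M.E → W} (h : Represents M K φ) {B : Set M.E}
    (hB : M.IsBase (Subtype.val '' B)) :
    ∃ x : M.E → B →₀ K, Represents M K x ∧ ∀ b : B, x b = Finsupp.single b 1 := by
  have hBi : LinearIndepOn K φ B := (h B).1 hB.indep
  let T := Finsupp.linearCombination K fun b : B => φ b
  have hT : LinearMap.ker T = ⊥ := linearIndependent_iff_ker.1 hBi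
  obtain ⟨g, hg⟩ := T.exists_leftInverse_of_injective hT
  have hgT : ∀ y, g (T y) = y := fun y => LinearMap.congr_fun hg y
  have hφ : ∀ e, T (g (φ e)) = φ e := by
    intro e
    have he : φ e ∈ LinearMap.range T := by
      rw [Finsupp.range_linearCombination, ← image_eq_range]
      by_contra he
      have hins := (h _).2 (hBi.insert he)
      have := hB.eq_of_subset_indep hins (image_mono (subset_insert _ _))
      rw [Subtype.val_injective.image_injective.eq_iff] at this
      exact he (Submodule.subset_span (mem_image_of_mem _ (this ▸ mem_insert e B)))
    obtain ⟨y, hy⟩ := he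
    rw [← hy, hgT]
  refine ⟨fun e => g (φ e), fun S => ?_, fun b => ?_⟩
  · rw [h, LinearIndepOn, LinearIndepOn, ← T.linearIndependent_iff hT,
      show (T ∘ fun i : S => g (φ i)) = fun i : S => φ i from funext fun e => hφ e]
  · change g (φ b) = _
    rw [show φ b = T (Finsupp.single b 1) by simp [T], hgT]

/-- Nonvanishing of a minor of a coordinate matrix depends only on the matroid. -/
theorem Represents.det_ne_zero_iff {α : Type*} {M : Matroid α} {B : Set M.E}
    {x : M.E → B →₀ K} (h : Represents M K x) (hx : ∀ b : B, x b = Finsupp.single b 1) {k : ℕ}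
    (r : Fin k → B) (c : Fin k → M.E) :
    (Matrix.of fun i j => x (c j) (r i)).det ≠ 0 ↔
      let g : ((range r)ᶜ : Set B) ⊕ Fin k → M.E := Sum.elim (fun b => (b : B)) c
      Function.Injective g ∧ M.Indep (range fun i => (g i : α)) := by
  rw [← h.linearIndependent_comp_iff, Sum.comp_elim,
    ← linearIndependent_singles_sum_iff r fun j => x (c j)]
  simp only [Function.comp_def, hx]

theorem Represents.detCompat {α : Type*} {M : Matroid α} {B : Set M.E}
    {x : M.E → B →₀ K} {y : M.E → B →₀ L} (hx : Represents M K x) (hy : Represents M L y)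
    (hxB : ∀ b : B, x b = Finsupp.single b 1) (hyB : ∀ b : B, y b = Finsupp.single b 1) :
    DetCompat (Matrix.of fun b e => x e b) (Matrix.of fun b e => y e b) := fun _ r c =>
  not_iff_not.1 ((hx.det_ne_zero_iff hxB r c).trans (hy.det_ne_zero_iff hyB r c).symm)

theorem Represents.col {α : Type*} {M : Matroid α} {B : Set M.E}
    {x : M.E → B →₀ K} (hx : Represents M K x) :
    Represents M K (Matrix.of fun b e => x e b).col := fun S =>
  (hx S).trans (LinearMap.linearIndependent_iff (Finsupp.lcoeFun (R := K) (M := K) (α := B))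
    (LinearMap.ker_eq_bot.2 DFunLike.coe_injective)).symm

theorem DetCompat.represents {α : Type*} {M : Matroid α} {A : Matrix m M.E K}
    {C : Matrix m M.E L} (h : DetCompat A C) (hC : Represents M L C.col) : Represents M K A.col :=
  fun S => (hC S).trans (h.linearIndepOn_iff S).symm

end Representations

theorem Representable.exists_represents {α : Type u} {M : Matroid α} {K : Type v} [Field K]
    (h : Representable M K) {B : Set M.E} (hB : M.IsBase (Subtype.val '' B)) :
    ∃ x : M.E → B →₀ K, Represents M K x ∧ ∀ b : B, x b = Finsupp.single b 1 := by
  obtain ⟨V, _, _, φ, hφ⟩ := h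
  refine Represents.exists_finsupp (φ := fun e => φ e) (fun S => ?_) hB
  rw [hφ _ (Subtype.coe_image_subset _ _),
    ← linearIndependent_equiv (Equiv.Set.image _ S Subtype.val_injective)]
  rfl

theorem Represents.representable {α : Type u} {M : Matroid α} {K : Type v} [Field K]
    {W : Type (max u v)} [AddCommGroup W] [Module K W] {φ : M.E → W} (h : Represents M K φ) :
    Representable M K := by
  classical
  let ψ : α → W := fun e => if he : e ∈ M.E then φ ⟨e, he⟩ else 0
  have hψ : ∀ e : M.E, ψ e = φ e := fun e => dif_pos e.2
  refine ⟨W, inferInstance, inferInstance, ψ, fun I hI => ?_⟩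
  obtain ⟨S, rfl⟩ := subset_range_iff_exists_image_eq.1 (hI.trans_eq Subtype.range_coe.symm)
  rw [h, ← linearIndependent_equiv (Equiv.Set.image _ S Subtype.val_injective), LinearIndepOn]
  simp only [← hψ]
  rfl

theorem exists_isBase_image {α : Type u} (M : Matroid α) :
    ∃ B : Set M.E, M.IsBase (Subtype.val '' B) := by
  obtain ⟨B, hB⟩ := M.exists_isBase
  obtain ⟨S, rfl⟩ :=
    subset_range_iff_exists_image_eq.1 (hB.subset_ground.trans_eq Subtype.range_coe.symm)
  exact ⟨S, hB⟩

theorem Representable.map {α : Type u} {M : Matroid α} {K : Type v} {L : Type w} [Field K]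
    [Field L] (f : K →+* L) (h : Representable M K) : Representable M L := by
  obtain ⟨B, hB⟩ := exists_isBase_image M
  obtain ⟨x, hx, -⟩ := h.exists_represents hB
  have hcompat : DetCompat ((Matrix.of fun b e => x e b).map f) (Matrix.of fun b e => x e b) := by
    intro k r c
    rw [← map_eq_zero f, f.map_det]
    rfl
  exact (hcompat.represents hx.col).representable

theorem Representable.of_binary_of_ringChar_ne_two {α : Type u} {M : Matroid α} {K : Type w}
    [Field K] (hK : ringChar K ≠ 2) (h2 : Representable M (ZMod 2)) (h : Representable M K)
    (L : Type v) [Field L] : Representable M L := by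
  obtain ⟨B, hB⟩ := exists_isBase_image M
  obtain ⟨x, hx, hxB⟩ := h.exists_represents hB
  obtain ⟨y, hy, hyB⟩ := h2.exists_represents hB
  obtain ⟨Z, hZ⟩ := exists_unimodular (hx.detCompat hy hxB hyB) hK
  exact ((hZ L).represents hy.col).representable

end Paper

/-- A matroid `M` is representable over every field if and only if `M` is
representable over `𝔽₂` and representable over at least one field whose characteristic is
different from `2`. -/
theorem representable_over_every_field_iff_binary_and_char_ne_two
    {α : Type u} (M : Matroid α) :
    (∀ (K : Type v) [Field K], Paper.Representable M K) ↔
      (Paper.Representable M (ZMod 2) ∧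
        ∃ (K : Type w) (_ : Field K), ringChar K ≠ 2 ∧ Paper.Representable M K) := by
  refine ⟨fun h => ⟨(h (ULift (ZMod 2))).map ULift.ringEquiv.toRingHom, ULift ℚ, inferInstance, ?_,
    (h (ULift ℚ)).map (ULift.ringEquiv.symm.toRingHom.comp ULift.ringEquiv.toRingHom)⟩, ?_⟩
  · intro h2
    have h0 : ((2 : ℕ) : ULift ℚ) = 0 := (ringChar.spec _ 2).2 h2.dvd
    exact two_ne_zero (α := ℚ) (congrArg ULift.down h0)
  · rintro ⟨h2, K, _, hK, h⟩ L _
    exact Paper.Representable.of_binary_of_ringChar_ne_two hK h2 h L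
end

section
/- A matroid M is representable over both 𝔽₃ and 𝔽₈ if and only if M is representable over every field with at least three elements. -/
universe u v w

open Matroid Set

namespace Paper

section

section Coordinates

variable {α : Type*} {k V : Type*} [Field k] [AddCommGroup V] [Module k V]

/-- The vectors `φ x`, for `x ∈ B`, form a basis of the whole space. -/
structure IsFrame (k : Type*) {V : Type*} [Field k] [AddCommGroup V] [Module k V]
    (φ : α → V) (B : Set α) : Prop where
  indep : LinearIndepOn k φ B
  span : ⊤ ≤ Submodule.span k (φ '' B)

/-- The basis given by a frame. -/
noncomputable def IsFrame.basis {φ : α → V} {B : Set α} (h : IsFrame k φ B) :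
    Module.Basis B k V :=
  Module.Basis.mk h.indep (by
    have := h.span
    rwa [image_eq_range] at this)

theorem IsFrame.basis_apply {φ : α → V} {B : Set α} (h : IsFrame k φ B) (x : B) :
    h.basis x = φ x :=
  Module.Basis.mk_apply h.indep _ x

open Classical in
/-- The coordinate of `φ y` at the basis vector `φ x` of the frame `B`. -/
noncomputable def coord (k : Type*) {V : Type*} [Field k] [AddCommGroup V] [Module k V]
    (φ : α → V) (B : Set α) (x y : α) : k :=
  if h : IsFrame k φ B ∧ x ∈ B then h.1.basis.coord ⟨x, h.2⟩ (φ y) else 0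

variable {φ : α → V} {B : Set α}

theorem coord_of_notMem {x : α} (hx : x ∉ B) (y : α) : coord k φ B x y = 0 := by
  simp [coord, hx]

theorem mem_of_coord_ne {x y : α} (h : coord k φ B x y ≠ 0) : x ∈ B := by
  by_contra hx
  exact h (coord_of_notMem hx y)

theorem IsFrame.exists_row (h : IsFrame k φ B) (x : α) :
    ∃ r : V →ₗ[k] k, ∀ y, r (φ y) = coord k φ B x y := by
  by_cases hx : x ∈ B
  · exact ⟨h.basis.coord ⟨x, hx⟩, fun y => by simp [coord, h, hx]⟩
  · exact ⟨0, fun y => by simp [coord_of_notMem hx]⟩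

theorem IsFrame.coord_self (h : IsFrame k φ B) {x : α} (hx : x ∈ B) :
    coord k φ B x x = 1 := by
  have := h.basis_apply ⟨x, hx⟩
  simp [coord, h, hx, ← this]

theorem IsFrame.coord_ne (h : IsFrame k φ B) {x y : α} (hy : y ∈ B) (hxy : x ≠ y) :
    coord k φ B x y = 0 := by
  by_cases hx : x ∈ B
  · have := h.basis_apply ⟨y, hy⟩
    simp only [coord, h, hx, and_self, dif_pos]
    rw [← this]
    simp [hxy.symm]
  · exact coord_of_notMem hx y

theorem IsFrame.ext (h : IsFrame k φ B) {r r' : V →ₗ[k] k}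
    (hr : ∀ x ∈ B, r (φ x) = r' (φ x)) : r = r' := by
  refine LinearMap.ext_on (top_le_iff.1 h.span) ?_
  rintro _ ⟨x, hx, rfl⟩
  exact hr x hx

theorem IsFrame.exists_functional (h : IsFrame k φ B) (g : α → k) :
    ∃ r : V →ₗ[k] k, ∀ x ∈ B, r (φ x) = g x := by
  refine ⟨h.basis.constr k (fun x => g x), fun x hx => ?_⟩
  rw [← h.basis_apply ⟨x, hx⟩, Module.Basis.constr_basis]

theorem IsFrame.eval_congr {V' : Type*} [AddCommGroup V'] [Module k V']
    (h : IsFrame k φ B) {r r' : V →ₗ[k] V'} {q : α}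
    (hr : ∀ x ∈ B, coord k φ B x q ≠ 0 → r (φ x) = r' (φ x)) : r (φ q) = r' (φ q) := by
  have hs := h.basis.linearCombination_repr (φ q)
  rw [← hs, Finsupp.linearCombination_apply, Finsupp.sum, map_sum, map_sum]
  refine Finset.sum_congr rfl fun x hx => ?_
  have hx' : coord k φ B x q ≠ 0 := by
    simpa [coord, h] using hx
  rw [map_smul, map_smul, h.basis_apply, hr x x.2 hx']

/-- A row is determined by any frame all but one of whose members it kills. -/
theorem IsFrame.row_eq {B' : Set α} (h : IsFrame k φ B) (h' : IsFrame k φ B') {a d : α}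
    (h0 : ∀ x ∈ B, x ≠ d → coord k φ B' a x = 0) (y : α) :
    coord k φ B' a y = coord k φ B' a d * coord k φ B d y := by
  obtain ⟨r, hr⟩ := h.exists_row d
  obtain ⟨r', hr'⟩ := h'.exists_row a
  by_cases hd : d ∈ B
  · have : r' = coord k φ B' a d • r := by
      refine h.ext fun x hx => ?_
      rw [hr', LinearMap.smul_apply, hr, smul_eq_mul]
      by_cases hxd : x = d
      · subst hxd; rw [h.coord_self hx, mul_one]
      · rw [h0 x hx hxd, h.coord_ne hx (Ne.symm hxd), mul_zero]
    rw [← hr', ← hr, this, LinearMap.smul_apply, smul_eq_mul]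
  · have : r' = 0 := h.ext fun x hx => by
      rw [hr', h0 x hx (fun e => hd (e ▸ hx)), LinearMap.zero_apply]
    rw [← hr', ← hr', this]; simp

theorem IsFrame.exists_coord_ne (h : IsFrame k φ B) {X : Set α} (hX : IsFrame k φ X) {g : α}
    (hg : g ∈ B) : ∃ a ∈ X, coord k φ B g a ≠ 0 := by
  by_contra! hc
  obtain ⟨r, hr⟩ := h.exists_row g
  have : r = 0 := hX.ext fun x hx => by rw [hr, hc x hx, LinearMap.zero_apply]
  have h1 := h.coord_self hg
  rw [← hr, this] at h1
  simp at h1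

theorem IsFrame.eq_of_subset (h : IsFrame k φ B) {X : Set α} (hX : IsFrame k φ X)
    (hBX : B ⊆ X) : B = X := by
  refine hBX.antisymm fun x hx => ?_
  obtain ⟨a, ha, hax⟩ := hX.exists_coord_ne h hx
  by_contra hxB
  exact hax (hX.coord_ne (hBX ha) fun e => hxB (e ▸ ha))

theorem IsFrame.exists_biorthogonal_iff {B : Set α} {φ : α → V} :
    IsFrame k φ B ↔ (⊤ ≤ Submodule.span k (φ '' B)) ∧
      ∀ x ∈ B, ∃ r : V →ₗ[k] k, r (φ x) ≠ 0 ∧ ∀ y ∈ B, y ≠ x → r (φ y) = 0 := by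
  constructor
  · intro h
    refine ⟨h.span, fun x hx => ?_⟩
    obtain ⟨r, hr⟩ := h.exists_row x
    refine ⟨r, by rw [hr, h.coord_self hx]; exact one_ne_zero, fun y hy hyx => ?_⟩
    rw [hr, h.coord_ne hy hyx.symm]
  · rintro ⟨hs, hr⟩
    refine ⟨?_, hs⟩
    rw [linearIndepOn_iff_notMem_span]
    intro x hx hmem
    obtain ⟨r, hrx, hry⟩ := hr x hx
    refine hrx ?_
    have : Submodule.span k (φ '' (B \ {x})) ≤ LinearMap.ker r := by
      rw [Submodule.span_le]
      rintro _ ⟨y, hy, rfl⟩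
      exact hry y hy.1 hy.2
    exact this hmem

/-- Exchanging `p` for `q` in the frame `B`. -/
def exch (B : Set α) (p q : α) : Set α := insert q (B \ {p})

theorem IsFrame.exch (h : IsFrame k φ B) {p q : α} (hpq : coord k φ B p q ≠ 0) :
    IsFrame k φ (exch B p q) := by
  have hp : p ∈ B := mem_of_coord_ne hpq
  obtain ⟨rp, hrp⟩ := h.exists_row p
  rw [IsFrame.exists_biorthogonal_iff]
  constructor
  · rw [top_le_iff]
    by_contra hne
    obtain ⟨v, hv⟩ : ∃ v, v ∉ Submodule.span k (φ '' Paper.exch B p q) := by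
      by_contra! hc
      exact hne (Submodule.eq_top_iff'.2 hc)
    obtain ⟨r, hrv, hr⟩ := Submodule.exists_le_ker_of_notMem hv
    have hr0 : ∀ x ∈ Paper.exch B p q, r (φ x) = 0 := fun x hx =>
      hr (Submodule.subset_span (mem_image_of_mem _ hx))
    have h1 : r = r (φ p) • rp := by
      refine h.ext fun x hx => ?_
      rw [LinearMap.smul_apply, hrp, smul_eq_mul]
      by_cases hxp : x = p
      · subst hxp; rw [h.coord_self hx, mul_one]
      · rw [hr0 x (Or.inr ⟨hx, hxp⟩), h.coord_ne hx (Ne.symm hxp), mul_zero]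
    have h2 := hr0 q (Or.inl rfl)
    rw [h1, LinearMap.smul_apply, hrp, smul_eq_mul] at h2
    have h3 : r (φ p) = 0 := by simpa [hpq] using h2
    rw [h3, zero_smul] at h1
    exact hrv (by rw [h1]; simp)
  · rintro x (rfl | ⟨hx, hxp⟩)
    · refine ⟨rp, by rwa [hrp], ?_⟩
      rintro y (rfl | ⟨hy, hyp⟩) hyx
      · exact absurd rfl hyx
      · rw [hrp, h.coord_ne hy (Ne.symm hyp)]
    · by_cases hxq : x = q
      · subst hxq
        exact absurd (h.coord_ne hx (Ne.symm hxp)) hpq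
      obtain ⟨rx, hrx⟩ := h.exists_row x
      refine ⟨rx - (coord k φ B x q / coord k φ B p q) • rp, ?_, ?_⟩
      · simp only [LinearMap.sub_apply, LinearMap.smul_apply, hrx, hrp, h.coord_self hx,
          h.coord_ne hx (Ne.symm hxp)]
        simp
      · rintro y (rfl | ⟨hy, hyp⟩) hyx
        · simp only [LinearMap.sub_apply, LinearMap.smul_apply, hrx, hrp, smul_eq_mul]
          field_simp
          ring
        · simp only [LinearMap.sub_apply, LinearMap.smul_apply, hrx, hrp,
            h.coord_ne hy (Ne.symm hyp), h.coord_ne hy (Ne.symm hyx)]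
          simp

theorem IsFrame.coord_exch_self (h : IsFrame k φ B) {p q : α} (hpq : coord k φ B p q ≠ 0)
    (y : α) : coord k φ (Paper.exch B p q) q y = coord k φ B p y / coord k φ B p q := by
  have h' := h.exch hpq
  have := h'.row_eq h (a := p) (d := q) (fun x hx hxq => by
    rcases hx with rfl | ⟨hx, hxp⟩
    · exact absurd rfl hxq
    · exact h.coord_ne hx (Ne.symm hxp)) y
  rw [this]
  field_simp

theorem IsFrame.coord_exch (h : IsFrame k φ B) {p q : α} (hpq : coord k φ B p q ≠ 0)
    {x : α} (hxq : x ≠ q) (y : α) : coord k φ (Paper.exch B p q) x y =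
      coord k φ B x y - coord k φ B x q * coord k φ B p y / coord k φ B p q := by
  have h' := h.exch hpq
  obtain ⟨rp, hrp⟩ := h.exists_row p
  obtain ⟨rx, hrx⟩ := h.exists_row x
  obtain ⟨r', hr'⟩ := h'.exists_row x
  have : r' = rx - (coord k φ B x q / coord k φ B p q) • rp := by
    refine h'.ext fun z hz => ?_
    simp only [LinearMap.sub_apply, LinearMap.smul_apply, hrx, hrp, hr', smul_eq_mul]
    by_cases hzx : z = x
    · subst hzx
      rw [h'.coord_self hz]
      rcases hz with rfl | ⟨hz, hzp⟩
      · exact absurd rfl hxq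
      · rw [h.coord_self hz, h.coord_ne hz (Ne.symm hzp)]; simp
    · rw [h'.coord_ne hz (Ne.symm hzx)]
      rcases hz with rfl | ⟨hz, hzp⟩
      · field_simp; ring
      · rw [h.coord_ne hz (Ne.symm hzx), h.coord_ne hz (Ne.symm hzp)]; simp
  rw [← hr', this]
  simp only [LinearMap.sub_apply, LinearMap.smul_apply, hrx, hrp, smul_eq_mul]
  ring

theorem IsFrame.coord_ne_zero_of_exch (h : IsFrame k φ B) {p q : α} (hp : p ∈ B)
    (h' : IsFrame k φ (Paper.exch B p q)) : coord k φ B p q ≠ 0 := by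
  intro h0
  obtain ⟨rp, hrp⟩ := h.exists_row p
  have : rp = 0 := h'.ext fun z hz => by
    rw [hrp, LinearMap.zero_apply]
    rcases hz with rfl | ⟨hz, hzp⟩
    · exact h0
    · exact h.coord_ne hz (Ne.symm hzp)
  have h1 := h.coord_self hp
  rw [← hrp, this] at h1
  simp at h1

theorem IsFrame.congr {φ' : α → V} (he : EqOn φ φ' B) (h : IsFrame k φ B) :
    IsFrame k φ' B :=
  ⟨h.indep.congr he, by have := h.span; rwa [he.image_eq] at this⟩

theorem coord_congr {φ' : α → V} (he : EqOn φ φ' B) {y : α} (hy : φ y = φ' y) (x : α) :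
    coord k φ B x y = coord k φ' B x y := by
  by_cases h : IsFrame k φ B
  · have h' := h.congr he
    obtain ⟨r, hr⟩ := h.exists_row x
    obtain ⟨r', hr'⟩ := h'.exists_row x
    have : r = r' := h.ext fun z hz => by
      rw [hr, he hz, hr']
      by_cases hzx : x = z
      · subst hzx; rw [h.coord_self hz, h'.coord_self hz]
      · rw [h.coord_ne hz hzx, h'.coord_ne hz hzx]
    rw [← hr, ← hr', this, hy]
  · have h' : ¬ IsFrame k φ' B := fun h' => h (h'.congr he.symm)
    simp [coord, h, h']

end Coordinates

end

section

section Lift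

/-- Two field elements are consistent when they vanish together and are `1` together. -/
def Cons {F G : Type*} [Field F] [Field G] (s : F) (p : G) : Prop :=
  (s = 0 ↔ p = 0) ∧ (s = 1 ↔ p = 1)

/-- A map lifting the cross ratios of `G` to `K`, multiplicative on pairs which are
consistent with elements of `F`. -/
structure IsLift (F : Type*) {G K : Type*} [Field F] [Field G] [Field K] (f : G → K) :
    Prop where
  map_zero : f 0 = 0
  eq_zero : ∀ p, f p = 0 → p = 0
  one_sub : ∀ p, f (1 - p) = 1 - f p
  map_inv : ∀ p, f p⁻¹ = (f p)⁻¹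
  map_mul : ∀ (s s' : F) (p p' : G), Cons s p → Cons s' p' → Cons (s * s') (p * p') →
    p ≠ 0 → p' ≠ 0 → f (p * p') = f p * f p'
  eq_zero_of_neg : ∀ (s : F) (p : G), Cons s p → Cons (-s) (-p) → p = 0

theorem isLift_of_functional {F G K : Type*} [Field F] [Field G] [Field K] {f : G → K}
    (hF : ∀ s : F, s = 0 ∨ s = 1 ∨ s = -1) (hF2 : (1 : F) ≠ -1) (hG : (1 : G) = -1)
    (h0 : f 0 = 0) (h1 : f 1 = 1) (he : ∀ p, f p = 0 → p = 0)
    (hs : ∀ p, f (1 - p) = 1 - f p) (hi : ∀ p, f p⁻¹ = (f p)⁻¹) : IsLift F f where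
  map_zero := h0
  eq_zero := he
  one_sub := hs
  map_inv := hi
  map_mul := by
    intro s s' p p' hc hc' hcc hp hp'
    rcases hF s with rfl | rfl | rfl
    · exact absurd (hc.1.1 rfl) hp
    · rw [hc.2.1 rfl, one_mul, h1, one_mul]
    · rcases hF s' with rfl | rfl | rfl
      · exact absurd (hc'.1.1 rfl) hp'
      · rw [hc'.2.1 rfl, mul_one, h1, mul_one]
      · have : p * p' = 1 := hcc.2.1 (by ring)
        have hpp : p' = p⁻¹ := by field_simp; linear_combination this
        have : f p ≠ 0 := fun h => hp (he p h)
        rw [‹p * p' = 1›, h1, hpp, hi, mul_inv_cancel₀ this]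
  eq_zero_of_neg := by
    intro s p hc hc'
    rcases hF s with rfl | rfl | rfl
    · exact hc.1.1 rfl
    · have := hc.2.1 rfl
      subst this
      exact absurd (hc'.2.2 hG.symm).symm hF2
    · have := hc'.2.1 (neg_neg _)
      have hp : p = 1 := by rw [hG, ← this, neg_neg]
      exact absurd (hc.2.2 hp).symm hF2

theorem exists_cubic_root {G : Type*} [Field G] (h2 : (2 : G) = 0) (hcard : Nat.card G = 8) :
    ∃ w : G, w ^ 3 = w + 1 := by
  have : Finite G := Nat.finite_of_card_ne_zero (by omega)
  have : Fintype G := Fintype.ofFinite G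
  rw [Nat.card_eq_fintype_card] at hcard
  classical
  obtain ⟨p, hp⟩ : ∃ p : G, p ∉ ({0, 1} : Finset G) := by
    by_contra! hc
    have h1 : (Finset.univ : Finset G) ⊆ {0, 1} := fun p _ => hc p
    have h3 := Finset.card_le_card h1
    have h4 : ({0, 1} : Finset G).card ≤ 2 := Finset.card_le_two
    rw [Finset.card_univ, hcard] at h3
    omega
  have h8 := FiniteField.pow_card p
  rw [hcard] at h8
  have hp0 : p ≠ 0 := by rintro rfl; simp at hp
  have hp1 : p - 1 ≠ 0 := by intro h; simp [sub_eq_zero.1 h] at hp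
  have : p * ((p - 1) * ((p ^ 3 + p + 1) * (p ^ 3 + p ^ 2 + 1))) = 0 := by
    linear_combination h8 + (p ^ 4 - p ^ 5 + (p - 1) * p ^ 4) * h2 - (p ^ 4 - p ^ 5) * h2 
  simp only [mul_eq_zero, hp0, hp1, false_or] at this
  rcases this with h | h
  · exact ⟨p, by linear_combination h - (p + 1) * h2⟩
  · refine ⟨p⁻¹, ?_⟩
    field_simp
    linear_combination -h + h2

/-- An element outside the prime field of a field with eight elements can be sent to any
element of `K` other than `0` and `1`. -/
theorem exists_isLift {F G K : Type*} [Field F] [Field G] [Field K]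
    (hF : ∀ s : F, s = 0 ∨ s = 1 ∨ s = -1) (hF2 : (1 : F) ≠ -1) (h2 : (2 : G) = 0)
    (hcard : Nat.card G = 8) {a : K} (ha0 : a ≠ 0) (ha1 : a ≠ 1) :
    ∃ f : G → K, IsLift F f := by
  obtain ⟨w, hw⟩ := exists_cubic_root h2 hcard
  have : Finite G := Nat.finite_of_card_ne_zero (by omega)
  have : Fintype G := Fintype.ofFinite G
  rw [Nat.card_eq_fintype_card] at hcard
  classical
  have ha1' : 1 - a ≠ 0 := fun h => ha1 (by linear_combination -h)
  have ha1'' : a - 1 ≠ 0 := fun h => ha1 (by linear_combination h)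
  have w0 : w ≠ 0 := by rintro rfl; simp at hw
  have w1 : w + 1 ≠ 0 := by
    intro h; rw [← hw] at h; exact w0 (by simpa using h)
  have i1 : w * (w ^ 2 + 1) = 1 := by linear_combination hw + w * h2
  have i2 : (w + 1) * (w ^ 2 + w) = 1 := by linear_combination hw + (w ^ 2 + w) * h2
  have i3 : w ^ 2 * (w ^ 2 + w + 1) = 1 := by
    linear_combination (w + 1) * hw + (w + w ^ 2) * h2
  have w2 : w ^ 2 + 1 ≠ 0 := right_ne_zero_of_mul (i1 ▸ one_ne_zero)
  have w3 : w ^ 2 + w ≠ 0 := right_ne_zero_of_mul (i2 ▸ one_ne_zero)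
  have w4 : w ^ 2 + w + 1 ≠ 0 := right_ne_zero_of_mul (i3 ▸ one_ne_zero)
  have ww : w ^ 2 ≠ 0 := pow_ne_zero 2 w0
  have neg : ∀ x : G, -x = x := fun x => by linear_combination -x * h2
  have dist : ∀ x y : G, x + y ≠ 0 → x ≠ y := by
    rintro x y h rfl; exact h (by linear_combination x * h2)
  have hall : ∀ p : G, p = 0 ∨ p = 1 ∨ p = w ∨ p = w + 1 ∨ p = w ^ 2 ∨ p = w ^ 2 + 1 ∨
      p = w ^ 2 + w ∨ p = w ^ 2 + w + 1 := by
    intro p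
    have h8 := FiniteField.pow_card p
    rw [hcard] at h8
    have e1 : (p - w) * (p - (w + 1)) = p ^ 2 + p + w ^ 2 + w := by
      linear_combination (-p * w - p) * h2
    have e2 : (p - w ^ 2) * (p - (w ^ 2 + 1)) = p ^ 2 + p + w := by
      linear_combination w * hw + (-p * w ^ 2 - p + w ^ 2) * h2
    have e3 : (p - (w ^ 2 + w)) * (p - (w ^ 2 + w + 1)) = p ^ 2 + p + w ^ 2 := by
      linear_combination (w + 2) * hw + (-p * w ^ 2 - p * w - p + w ^ 2 + 2 * w + 1) * h2
    have e4 : p * (p - 1) = p ^ 2 + p := by linear_combination -p * h2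
    have e5 : (p ^ 2 + p) * (p ^ 2 + p + w) = (p ^ 2 + p) ^ 2 + w * (p ^ 2 + p) := by ring
    have e6 : (p ^ 2 + p + w ^ 2) * (p ^ 2 + p + w ^ 2 + w) =
        (p ^ 2 + p) ^ 2 + w * (p ^ 2 + p) + w ^ 2 + 1 := by
      linear_combination (w + 1) * hw + ((p ^ 2 + p) * w ^ 2 + w) * h2
    have e7 : (p ^ 2 + p) * (p ^ 2 + p + w) *
        ((p ^ 2 + p + w ^ 2) * (p ^ 2 + p + w ^ 2 + w)) = 0 := by
      rw [e5, e6]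
      generalize hu : p ^ 2 + p = u
      have hu2 : u ^ 2 = p ^ 4 + p ^ 2 := by rw [← hu]; linear_combination p ^ 3 * h2
      have hu4 : u ^ 4 = p ^ 8 + p ^ 4 := by
        rw [show u ^ 4 = (u ^ 2) ^ 2 by ring, hu2]; linear_combination p ^ 6 * h2
      have : u ^ 4 + u ^ 2 + u = 0 := by
        rw [hu4, hu2, ← hu, h8]; linear_combination (p ^ 4 + p ^ 2 + p) * h2
      linear_combination this + u * hw + (u ^ 3 * w + u ^ 2 * w ^ 2 + u * w) * h2
    have : p * (p - 1) * ((p - w) * (p - (w + 1))) * ((p - w ^ 2) * (p - (w ^ 2 + 1))) *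
        ((p - (w ^ 2 + w)) * (p - (w ^ 2 + w + 1))) = 0 := by
      rw [e1, e2, e3, e4]; linear_combination e7
    simpa only [mul_eq_zero, sub_eq_zero, or_assoc] using this
  have n1 : w ≠ 1 := dist _ _ w1
  have n2 : w ^ 2 ≠ 1 := dist _ _ w2
  have n3 : w ^ 2 ≠ w := dist _ _ w3
  have n4 : w ^ 2 ≠ w + 1 := dist _ _ (by rwa [← add_assoc])
  have n5 : w ^ 2 + w ≠ 1 := dist _ _ w4
  obtain ⟨f, f0, f1, f2, f3, f4, f5, f6, f7⟩ : ∃ f : G → K, f 0 = 0 ∧ f 1 = 1 ∧ f w = a ∧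
      f (w + 1) = 1 - a ∧ f (w ^ 2) = (a - 1) / a ∧ f (w ^ 2 + 1) = a⁻¹ ∧
      f (w ^ 2 + w) = (1 - a)⁻¹ ∧ f (w ^ 2 + w + 1) = a / (a - 1) := by
    refine ⟨fun p => if p = 0 then 0 else if p = 1 then 1 else if p = w then a else
      if p = w + 1 then 1 - a else if p = w ^ 2 then (a - 1) / a else
      if p = w ^ 2 + 1 then a⁻¹ else if p = w ^ 2 + w then (1 - a)⁻¹ else a / (a - 1),
      ?_, ?_, ?_, ?_, ?_, ?_, ?_, ?_⟩
    · simp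
    · simp
    · simp [w0, n1]
    · simp [w1, w0]
    · simp only [ww, n2, n3, n4, if_false, if_true]
    · have : w ^ 2 + 1 ≠ w := dist _ _ (by convert w4 using 1; ring)
      simp [w2, ww, this, n3]
    · have : w ^ 2 + w ≠ w + 1 := dist _ _ (by
        convert w2 using 1; linear_combination w * h2)
      have h3 : w ^ 2 + w ≠ w ^ 2 + 1 := fun h => n1 (by linear_combination h)
      simp [w3, n5, ww, this, w0, h3]
    · have h3 : w ^ 2 + w + 1 ≠ w := dist _ _ (by
        convert w2 using 1; linear_combination w * h2)
      have h4 : w ^ 2 + w + 1 ≠ w ^ 2 := dist _ _ (by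
        convert w1 using 1; linear_combination w ^ 2 * h2)
      have h5 : w ^ 2 + w + 1 ≠ w + 1 := fun h => ww (by linear_combination h)
      have h6 : w ^ 2 + w + 1 ≠ w ^ 2 + 1 := fun h => w0 (by linear_combination h)
      have h7 : w ^ 2 + w + 1 ≠ w ^ 2 + w := fun h => one_ne_zero (α := G) (by
        linear_combination h)
      have h8 : w ^ 2 + w + 1 ≠ 1 := fun h => w3 (by linear_combination h)
      simp only [w4, h3, h4, h5, h6, h7, h8, if_false]
  refine ⟨f, isLift_of_functional hF hF2 (neg 1).symm f0 f1 ?_ ?_ ?_⟩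
  · intro p
    rcases hall p with h | h | h | h | h | h | h | h <;>
      simp [h, f1, f2, f3, f4, f5, f6, f7, ha0, ha1', ha1'']
  · have hp : ∀ p : G, f p + f (p + 1) = 1 → f (1 - p) = 1 - f p ∧
        f (1 - (p + 1)) = 1 - f (p + 1) := by
      intro p h
      rw [show 1 - p = p + 1 by linear_combination -p * h2,
        show 1 - (p + 1) = p by linear_combination -p * h2]
      exact ⟨by linear_combination h, by linear_combination h⟩
    have q1 := hp 0 (by simp [f0, f1])
    have q2 := hp w (by simp [f2, f3])
    have q3 := hp (w ^ 2) (by rw [f4, f5]; field_simp; ring)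
    have q4 := hp (w ^ 2 + w) (by rw [f6, f7]; field_simp; ring)
    intro p
    rcases hall p with h | h | h | h | h | h | h | h <;> rw [h]
    · exact q1.1
    · simpa using q1.2
    · exact q2.1
    · exact q2.2
    · exact q3.1
    · exact q3.2
    · exact q4.1
    · exact q4.2
  · have hp : ∀ p q : G, p * q = 1 → f q = (f p)⁻¹ → f p⁻¹ = (f p)⁻¹ ∧
        f q⁻¹ = (f q)⁻¹ := by
      intro p q h h'
      rw [inv_eq_of_mul_eq_one_right h, inv_eq_of_mul_eq_one_left h, h', inv_inv]
      exact ⟨rfl, rfl⟩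
    have q1 := hp _ _ i1 (by rw [f2, f5])
    have q2 := hp _ _ i2 (by rw [f3, f6])
    have q3 := hp _ _ i3 (by rw [f4, f7, inv_div])
    intro p
    rcases hall p with h | h | h | h | h | h | h | h <;> rw [h]
    · simp [f0]
    · simp [f1]
    · exact q1.1
    · exact q2.1
    · exact q3.1
    · exact q1.2
    · exact q2.2
    · exact q3.2

end Lift

end

section

section Triples

variable {F G K : Type*} [Field F] [Field G] [Field K]

/-- All three components are nonzero. -/
def Nz (t : F × G × K) : Prop := t.1 ≠ 0 ∧ t.2.1 ≠ 0 ∧ t.2.2 ≠ 0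

/-- A triple is consistent when its first two components are. -/
def TCons (t : F × G × K) : Prop := Cons t.1 t.2.1

/-- A consistent triple whose last component is the lift of the second. -/
def Lam (f : G → K) (t : F × G × K) : Prop := TCons t ∧ t.2.2 = f t.2.1

theorem not_nz_zero : ¬ Nz (0 : F × G × K) := fun h => h.1 rfl

theorem Nz.ne {t : F × G × K} (h : Nz t) : t ≠ 0 := by rintro rfl; exact not_nz_zero h

theorem nz_one : Nz (1 : F × G × K) := ⟨one_ne_zero, one_ne_zero, one_ne_zero⟩

theorem Nz.mul {s t : F × G × K} (hs : Nz s) (ht : Nz t) : Nz (s * t) :=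
  ⟨mul_ne_zero hs.1 ht.1, mul_ne_zero hs.2.1 ht.2.1, mul_ne_zero hs.2.2 ht.2.2⟩

theorem Nz.inv {t : F × G × K} (ht : Nz t) : Nz t⁻¹ :=
  ⟨inv_ne_zero ht.1, inv_ne_zero ht.2.1, inv_ne_zero ht.2.2⟩

theorem Nz.div {s t : F × G × K} (hs : Nz s) (ht : Nz t) : Nz (s / t) :=
  ⟨div_ne_zero hs.1 ht.1, div_ne_zero hs.2.1 ht.2.1, div_ne_zero hs.2.2 ht.2.2⟩

theorem Nz.neg {t : F × G × K} (ht : Nz t) : Nz (-t) :=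
  ⟨neg_ne_zero.2 ht.1, neg_ne_zero.2 ht.2.1, neg_ne_zero.2 ht.2.2⟩

theorem Nz.of_mul_left {s t : F × G × K} (h : Nz (s * t)) : Nz s :=
  ⟨left_ne_zero_of_mul h.1, left_ne_zero_of_mul h.2.1, left_ne_zero_of_mul h.2.2⟩

theorem Nz.of_mul_right {s t : F × G × K} (h : Nz (s * t)) : Nz t :=
  ⟨right_ne_zero_of_mul h.1, right_ne_zero_of_mul h.2.1, right_ne_zero_of_mul h.2.2⟩

/-- To prove an identity of triples, prove it in fields. -/
theorem tri_ext {F G K : Type*} {s t : F × G × K} (h1 : s.1 = t.1) (h2 : s.2.1 = t.2.1)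
    (h3 : s.2.2 = t.2.2) : s = t := Prod.ext h1 (Prod.ext h2 h3)

variable {f : G → K}

theorem lam_zero (hf : IsLift F f) : Lam f (0 : F × G × K) := by
  simp [Lam, TCons, Cons, hf.map_zero]

theorem lam_one (hf : IsLift F f) : Lam f (1 : F × G × K) := by
  have h := hf.one_sub 0
  rw [sub_zero, hf.map_zero, sub_zero] at h
  simp [Lam, TCons, Cons, h]

theorem TCons.inv {t : F × G × K} (h : TCons t) : TCons t⁻¹ := by
  simpa [TCons, Cons, inv_eq_one] using h

theorem TCons.one_sub {t : F × G × K} (h : TCons t) : TCons (1 - t) := by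
  simp only [TCons, Cons, Prod.fst_sub, Prod.snd_sub, Prod.fst_one, Prod.snd_one] at h ⊢
  constructor
  · rw [sub_eq_zero, sub_eq_zero, eq_comm, h.2, eq_comm]
  · rw [sub_eq_self, sub_eq_self, h.1]

theorem Lam.inv (hf : IsLift F f) {t : F × G × K} (h : Lam f t) : Lam f t⁻¹ :=
  ⟨h.1.inv, by simp [hf.map_inv, h.2]⟩

theorem Lam.one_sub (hf : IsLift F f) {t : F × G × K} (h : Lam f t) : Lam f (1 - t) :=
  ⟨h.1.one_sub, by simp [hf.one_sub, h.2]⟩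

theorem Lam.mul (hf : IsLift F f) {s t : F × G × K} (hs : Lam f s) (ht : Lam f t)
    (h : TCons (s * t)) (hs0 : Nz s) (ht0 : Nz t) : Lam f (s * t) :=
  ⟨h, by simp [hs.2, ht.2, hf.map_mul _ _ _ _ hs.1 ht.1 h hs0.2.1 ht0.2.1]⟩

theorem Lam.zero_or_nz (hf : IsLift F f) {t : F × G × K} (h : Lam f t) : t = 0 ∨ Nz t := by
  by_cases h0 : t.2.1 = 0
  · left
    refine tri_ext (h.1.1.2 h0) h0 ?_
    rw [h.2, h0, hf.map_zero]; rfl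
  · right
    refine ⟨fun h1 => h0 (h.1.1.1 h1), h0, fun h1 => h0 ?_⟩
    rw [h.2] at h1
    exact hf.eq_zero _ h1

theorem TCons.not_neg (hf : IsLift F f) {t : F × G × K} (h : TCons t) (ht : Nz t)
    (h' : TCons (-t)) : False :=
  ht.2.1 (hf.eq_zero_of_neg _ _ h h')

end Triples

/-- Three vector configurations on the same ground set, the first two of which have the same
frames, together with a lift of cross ratios. -/
structure Sys (F G K α V₁ V₂ V₃ : Type*) [Field F] [Field G] [Field K] [AddCommGroup V₁]
    [Module F V₁] [AddCommGroup V₂] [Module G V₂] [AddCommGroup V₃] [Module K V₃] where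
  φ : α → V₁
  χ : α → V₂
  ψ : α → V₃
  X : Set α
  f : G → K
  hf : IsLift F f
  frame_iff : ∀ B, IsFrame F φ B ↔ IsFrame G χ B
  hX : IsFrame F φ X

namespace Sys

variable {F G K α V₁ V₂ V₃ : Type*} [Field F] [Field G] [Field K] [AddCommGroup V₁]
    [Module F V₁] [AddCommGroup V₂] [Module G V₂] [AddCommGroup V₃] [Module K V₃]
    (S : Sys F G K α V₁ V₂ V₃)

/-- The triple of coordinates of `y` at `x` with respect to `B`. -/
noncomputable def N (B : Set α) (x y : α) : F × G × K :=
  (coord F S.φ B x y, coord G S.χ B x y, coord K S.ψ B x y)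

/-- `B` is a frame for all three configurations. -/
def Fr (B : Set α) : Prop := IsFrame F S.φ B ∧ IsFrame G S.χ B ∧ IsFrame K S.ψ B

/-- The cross ratio of the rows `x`, `x'` and the columns `y`, `y'`. -/
noncomputable def cr (B : Set α) (x x' y y' : α) : F × G × K :=
  S.N B x y * S.N B x' y' / (S.N B x y' * S.N B x' y)

variable {S}

theorem coord_eq_zero_iff {B : Set α} (h : IsFrame F S.φ B) (x y : α) :
    coord F S.φ B x y = 0 ↔ coord G S.χ B x y = 0 := by
  have h' := (S.frame_iff B).1 h
  constructor
  · contrapose!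
    intro h0
    exact h.coord_ne_zero_of_exch (mem_of_coord_ne h0) ((S.frame_iff _).2 (h'.exch h0))
  · contrapose!
    intro h0
    exact h'.coord_ne_zero_of_exch (mem_of_coord_ne h0) ((S.frame_iff _).1 (h.exch h0))

section Fr

variable {B : Set α} (h : S.Fr B)

theorem mem_of_nz {x y : α} (hx : Nz (S.N B x y)) : x ∈ B := mem_of_coord_ne hx.1

include h

theorem Fr.N_self {x : α} (hx : x ∈ B) : S.N B x x = 1 := by
  simp [N, h.1.coord_self hx, h.2.1.coord_self hx, h.2.2.coord_self hx]

theorem Fr.N_ne {x y : α} (hy : y ∈ B) (hxy : x ≠ y) : S.N B x y = 0 := by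
  simp [N, h.1.coord_ne hy hxy, h.2.1.coord_ne hy hxy, h.2.2.coord_ne hy hxy]

/-- A nonzero entry off the diagonal has its column outside the frame. -/
theorem Fr.notMem_of_nz {x y : α} (hxy : x ≠ y) (h0 : Nz (S.N B x y)) : y ∉ B := fun hy =>
  h0.ne (h.N_ne hy hxy)

theorem Fr.exch {p q : α} (h0 : Nz (S.N B p q)) : S.Fr (exch B p q) :=
  ⟨h.1.exch h0.1, h.2.1.exch h0.2.1, h.2.2.exch h0.2.2⟩

theorem Fr.N_exch_self {p q : α} (h0 : Nz (S.N B p q)) (y : α) :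
    S.N (Paper.exch B p q) q y = S.N B p y / S.N B p q := by
  simp [N, h.1.coord_exch_self h0.1, h.2.1.coord_exch_self h0.2.1,
    h.2.2.coord_exch_self h0.2.2]

theorem Fr.N_exch {p q x : α} (h0 : Nz (S.N B p q)) (hx : x ≠ q) (y : α) :
    S.N (Paper.exch B p q) x y =
      S.N B x y - S.N B x q * S.N B p y / S.N B p q := by
  simp [N, h.1.coord_exch h0.1 hx, h.2.1.coord_exch h0.2.1 hx,
    h.2.2.coord_exch h0.2.2 hx]

theorem Fr.row_eq {B' : Set α} (h' : S.Fr B') {a d : α}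
    (h0 : ∀ x ∈ B, x ≠ d → S.N B' a x = 0) (y : α) :
    S.N B' a y = S.N B' a d * S.N B d y := by
  refine tri_ext (h.1.row_eq h'.1 (fun x hx hd => ?_) y)
    (h.2.1.row_eq h'.2.1 (fun x hx hd => ?_) y) (h.2.2.row_eq h'.2.2 (fun x hx hd => ?_) y)
  · exact congrArg (fun t => t.1) (h0 x hx hd)
  · exact congrArg (fun t => t.2.1) (h0 x hx hd)
  · exact congrArg (fun t => t.2.2) (h0 x hx hd)

end Fr

theorem cr_swap_rows (B : Set α) (x x' y y' : α) : S.cr B x' x y y' = (S.cr B x x' y y')⁻¹ := by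
  simp only [cr, inv_div]
  rw [mul_comm (S.N B x' y), mul_comm (S.N B x' y')]

theorem cr_swap_cols (B : Set α) (x x' y y' : α) : S.cr B x x' y' y = (S.cr B x x' y y')⁻¹ := by
  simp only [cr, inv_div]

theorem cr_nz {B : Set α} {x x' y y' : α} (h1 : Nz (S.N B x y)) (h2 : Nz (S.N B x y'))
    (h3 : Nz (S.N B x' y)) (h4 : Nz (S.N B x' y')) : Nz (S.cr B x x' y y') :=
  (h1.mul h4).div (h2.mul h3)

theorem cr_eq_zero {B : Set α} {x x' y y' : α} (h : S.N B x y = 0 ∨ S.N B x y' = 0 ∨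
    S.N B x' y = 0 ∨ S.N B x' y' = 0) : S.cr B x x' y y' = 0 := by
  rcases h with h | h | h | h <;> exact tri_ext (by simp [cr, h]) (by simp [cr, h])
    (by simp [cr, h])

theorem cr_rows_mul {B : Set α} {x x' x'' y y' : α} (h1 : Nz (S.N B x'' y))
    (h2 : Nz (S.N B x'' y')) :
    S.cr B x x' y y' = S.cr B x x'' y y' * S.cr B x'' x' y y' := by
  obtain ⟨a, b, c⟩ := h1
  obtain ⟨a', b', c'⟩ := h2
  refine tri_ext ?_ ?_ ?_ <;>
    simp only [cr, Prod.fst_mul, Prod.snd_mul, Prod.fst_div, Prod.snd_div] <;> field_simp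

theorem cr_cols_mul {B : Set α} {x x' y y' y'' : α} (h1 : Nz (S.N B x y''))
    (h2 : Nz (S.N B x' y'')) :
    S.cr B x x' y y' = S.cr B x x' y y'' * S.cr B x x' y'' y' := by
  obtain ⟨a, b, c⟩ := h1
  obtain ⟨a', b', c'⟩ := h2
  refine tri_ext ?_ ?_ ?_ <;>
    simp only [cr, Prod.fst_mul, Prod.snd_mul, Prod.fst_div, Prod.snd_div] <;> field_simp

theorem coord_cr_eq_one {k V : Type*} [Field k] [AddCommGroup V] [Module k V] {θ : α → V}
    {B : Set α} (h : IsFrame k θ B) {x x' y y' : α} (hxy : x ≠ y)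
    (h2 : coord k θ B x y' ≠ 0) (h3 : coord k θ B x' y ≠ 0) :
    coord k θ B x y * coord k θ B x' y' / (coord k θ B x y' * coord k θ B x' y) = 1 ↔
      coord k θ (exch B x' y) x y' = 0 := by
  rw [h.coord_exch h3 hxy, div_eq_one_iff_eq (mul_ne_zero h2 h3), sub_eq_zero, eq_div_iff h3,
    eq_comm]

theorem tcons_cr {B : Set α} (h : IsFrame F S.φ B) (x x' y y' : α) :
    TCons (S.cr B x x' y y') := by
  have h' := (S.frame_iff B).1 h
  have hz := coord_eq_zero_iff h
  simp only [TCons, Cons, cr, N, Prod.mk_mul_mk, Prod.mk_div_mk]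
  refine ⟨by simp [hz], ?_⟩
  by_cases h2 : coord F S.φ B x y' = 0
  · simp [h2, (hz _ _).1 h2]
  by_cases h3 : coord F S.φ B x' y = 0
  · simp [h3, (hz _ _).1 h3]
  have h2' := mt (hz _ _).2 h2
  have h3' := mt (hz _ _).2 h3
  by_cases hxx : x = x'
  · subst hxx
    rw [mul_comm, div_self (mul_ne_zero h2 h3), mul_comm, div_self (mul_ne_zero h2' h3')]
    simp
  · have hxy : x ≠ y := by
      rintro rfl
      exact h3 (h.coord_ne (mem_of_coord_ne h2) (Ne.symm hxx))
    rw [coord_cr_eq_one h hxy h2 h3, coord_cr_eq_one h' hxy h2' h3']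
    exact coord_eq_zero_iff (h.exch h3) _ _

variable (S)

/-- The frames contained in `V` at finite distance from `X`. -/
def Bs (V : Set α) : Set (Set α) :=
  {B | B ⊆ V ∧ IsFrame F S.φ B ∧ (B \ S.X).Finite ∧ (S.X \ B).Finite}

/-- The third configuration lifts the first two on the columns `C`, at all frames in `V`. -/
structure Good (V C : Set α) : Prop where
  X_subset : S.X ⊆ V
  subset : V ⊆ C
  frame : ∀ B ∈ S.Bs V, IsFrame K S.ψ B
  zero_or_nz : ∀ B ∈ S.Bs V, ∀ x, ∀ y ∈ C, S.N B x y = 0 ∨ Nz (S.N B x y)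
  lam : ∀ B ∈ S.Bs V, ∀ x x', ∀ y ∈ C, ∀ y' ∈ C, Lam S.f (S.cr B x x' y y')

variable {S}

theorem Bs_mono {V V' : Set α} (h : V ⊆ V') : S.Bs V ⊆ S.Bs V' := fun _ hB =>
  ⟨hB.1.trans h, hB.2⟩

theorem exch_mem_Bs {V B : Set α} (hB : B ∈ S.Bs V) {p q : α} (hq : q ∈ V)
    (h0 : coord F S.φ B p q ≠ 0) : exch B p q ∈ S.Bs V := by
  refine ⟨insert_subset hq (sdiff_subset.trans hB.1), hB.2.1.exch h0, ?_, ?_⟩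
  · refine (hB.2.2.1.insert q).subset ?_
    rintro x ⟨rfl | hx, hxX⟩
    · exact Or.inl rfl
    · exact Or.inr ⟨hx.1, hxX⟩
  · refine (hB.2.2.2.insert p).subset ?_
    rintro x ⟨hx, hxB⟩
    by_cases hxp : x = p
    · exact Or.inl hxp
    · exact Or.inr ⟨hx, fun h => hxB (Or.inr ⟨h, hxp⟩)⟩

theorem X_mem_Bs {V : Set α} (h : S.X ⊆ V) : S.X ∈ S.Bs V :=
  ⟨h, S.hX, by simp, by simp⟩

theorem exch_exch {B : Set α} {g a : α} (hg : g ∈ B) (ha : a ∉ B) :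
    exch (exch B g a) a g = B := by
  ext x
  simp only [exch, mem_insert_iff, mem_sdiff, mem_singleton_iff]
  constructor
  · rintro (rfl | ⟨rfl | h, h'⟩)
    · exact hg
    · exact absurd rfl h'
    · exact h.1
  · intro hx
    by_cases h : x = g
    · exact Or.inl h
    · exact Or.inr ⟨Or.inr ⟨hx, h⟩, fun e => ha (e ▸ hx)⟩

/-- Every frame other than `X` is obtained by a pivot from one closer to `X`. -/
theorem exists_pivot_back {V B : Set α} (hB : B ∈ S.Bs V) (hXV : S.X ⊆ V) {g : α}
    (hg : g ∈ B) (hgX : g ∉ S.X) : ∃ a ∈ S.X, a ∉ B ∧ exch B g a ∈ S.Bs V ∧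
      coord F S.φ (exch B g a) a g ≠ 0 ∧ exch (exch B g a) a g = B := by
  obtain ⟨a, ha, hga⟩ := hB.2.1.exists_coord_ne S.hX hg
  have haB : a ∉ B := fun h => hga (hB.2.1.coord_ne h (fun e => hgX (e ▸ ha)))
  have h1 := exch_mem_Bs hB (hXV ha) hga
  refine ⟨a, ha, haB, h1, ?_, exch_exch hg haB⟩
  refine h1.2.1.coord_ne_zero_of_exch (Or.inl rfl) ?_
  rw [exch_exch hg haB]
  exact hB.2.1

theorem Bs_induction {V : Set α} (hXV : S.X ⊆ V) {P : Set α → Prop} (h0 : P S.X)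
    (h1 : ∀ B ∈ S.Bs V, P B → ∀ p q, q ∈ V → coord F S.φ B p q ≠ 0 → P (exch B p q)) :
    ∀ B ∈ S.Bs V, P B := by
  intro B hB
  obtain ⟨n, hn⟩ : ∃ n, (B \ S.X).ncard = n := ⟨_, rfl⟩
  induction n generalizing B with
  | zero =>
    rw [ncard_eq_zero hB.2.2.1, sdiff_eq_empty] at hn
    rwa [hB.2.1.eq_of_subset S.hX hn]
  | succ n ih =>
    obtain ⟨g, hg, hgX⟩ : (B \ S.X).Nonempty := by
      rw [← ncard_pos hB.2.2.1]; omega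
    obtain ⟨a, ha, haB, hB0, hag, he⟩ := exists_pivot_back hB hXV hg hgX
    rw [← he]
    refine h1 _ hB0 (ih _ hB0 ?_) a g (hB.1 hg) hag
    have : exch B g a \ S.X = (B \ S.X) \ {g} := by
      ext x
      simp only [exch, mem_sdiff, mem_insert_iff, mem_singleton_iff]
      constructor
      · rintro ⟨rfl | h, h'⟩
        · exact absurd ha h'
        · exact ⟨⟨h.1, h'⟩, h.2⟩
      · rintro ⟨⟨h, h'⟩, h''⟩
        exact ⟨Or.inr ⟨h, h''⟩, h'⟩
    have hgm : g ∈ B \ S.X := ⟨hg, hgX⟩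
    rw [this, ncard_sdiff_singleton_of_mem hgm, hn]
    rfl

theorem Good.fr {V C : Set α} (h : S.Good V C) {B : Set α} (hB : B ∈ S.Bs V) : S.Fr B :=
  ⟨hB.2.1, (S.frame_iff B).1 hB.2.1, h.frame B hB⟩

theorem Good.exch_mem {V C : Set α} {B : Set α} (_ : S.Good V C) (hB : B ∈ S.Bs V)
    {p q : α} (hq : q ∈ V) (h0 : Nz (S.N B p q)) : exch B p q ∈ S.Bs V :=
  exch_mem_Bs hB hq h0.1

theorem Good.nz_of {V C : Set α} (h : S.Good V C) {B : Set α} (hB : B ∈ S.Bs V) {x y : α}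
    (hy : y ∈ C) (h0 : coord F S.φ B x y ≠ 0) : Nz (S.N B x y) :=
  (h.zero_or_nz B hB x y hy).resolve_left fun h' => h0 (congrArg (fun t => t.1) h')

theorem Good.mono {V C V' C' : Set α} (h : S.Good V C) (hX : S.X ⊆ V') (hV : V' ⊆ V)
    (hC : C' ⊆ C) (hVC : V' ⊆ C') : S.Good V' C' where
  X_subset := hX
  subset := hVC
  frame B hB := h.frame B (Bs_mono hV hB)
  zero_or_nz B hB x y hy := h.zero_or_nz B (Bs_mono hV hB) x y (hC hy)
  lam B hB x x' y hy y' hy' := h.lam B (Bs_mono hV hB) x x' y (hC hy) y' (hC hy')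

theorem Good.tcons {V C : Set α} {B : Set α} (_ : S.Good V C) (hB : B ∈ S.Bs V)
    (x x' y y' : α) : TCons (S.cr B x x' y y') := tcons_cr hB.2.1 x x' y y'

end Sys

end

section

section Algebra

variable {F G K : Type*} [Field F] [Field G] [Field K]

theorem tri_sub_eq_mul {m u w d : F × G × K} (hm : Nz m) (hd : Nz d) :
    m - u * w / d = m * (1 - u * w / (m * d)) := by
  obtain ⟨a, b, c⟩ := hm
  obtain ⟨a', b', c'⟩ := hd
  refine tri_ext ?_ ?_ ?_ <;> simp <;> field_simp

theorem tri_sub_eq_mul' {m u w d : F × G × K} (hu : Nz u) (hw : Nz w) (hd : Nz d) :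
    m - u * w / d = -(u * w / d) * (1 - m * d / (u * w)) := by
  obtain ⟨a, b, c⟩ := hu
  obtain ⟨a', b', c'⟩ := hw
  obtain ⟨a'', b'', c''⟩ := hd
  refine tri_ext ?_ ?_ ?_ <;> simp <;> field_simp <;> ring

theorem Nz.div_self {t : F × G × K} (h : Nz t) : t / t = 1 :=
  tri_ext (_root_.div_self h.1) (_root_.div_self h.2.1) (_root_.div_self h.2.2)

end Algebra

namespace Sys

variable {F G K α V₁ V₂ V₃ : Type*} [Field F] [Field G] [Field K] [AddCommGroup V₁]
    [Module F V₁] [AddCommGroup V₂] [Module G V₂] [AddCommGroup V₃] [Module K V₃]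
    {S : Sys F G K α V₁ V₂ V₃}

section Pivot

variable {V C B : Set α} {a g x x' y y' : α} (hG : S.Good V C) (hB : B ∈ S.Bs V)
  (hg : g ∈ C) (hd : Nz (S.N B a g))

include hG hB hg hd

theorem Good.pivot_zero_or_nz (x : α) (hy : y ∈ C) :
    S.N (exch B a g) x y = 0 ∨ Nz (S.N (exch B a g) x y) := by
  have hF := hG.fr hB
  have hz := hG.zero_or_nz B hB
  by_cases hx : x = g
  · subst hx
    rw [hF.N_exch_self hd]
    rcases hz a y hy with h | h
    · left; rw [h]; exact tri_ext (by simp) (by simp) (by simp)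
    · right; exact h.div hd
  rw [hF.N_exch hd hx]
  rcases hz x g hg with h | hu
  · rw [h]
    have : S.N B x y - 0 * S.N B a y / S.N B a g = S.N B x y :=
      tri_ext (by simp) (by simp) (by simp)
    rw [this]
    exact hz x y hy
  rcases hz a y hy with h | hw
  · rw [h]
    have : S.N B x y - S.N B x g * 0 / S.N B a g = S.N B x y :=
      tri_ext (by simp) (by simp) (by simp)
    rw [this]
    exact hz x y hy
  rw [tri_sub_eq_mul' hu hw hd]
  rcases ((hG.lam B hB x a y hy g hg).one_sub S.hf).zero_or_nz S.hf with h | h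
  · left
    rw [cr] at h
    rw [h, mul_zero]
  · right
    exact ((hu.mul hw).div hd).neg.mul h

theorem Good.pivot_lam_row (hx : x ≠ g) (hy : y ∈ C) (hy' : y' ∈ C)
    (h1 : Nz (S.N (exch B a g) x y)) (h2 : Nz (S.N (exch B a g) x y'))
    (hw : Nz (S.N B a y)) (hw' : Nz (S.N B a y')) :
    Lam S.f (S.cr (exch B a g) x g y y') := by
  have hF := hG.fr hB
  have ht := tcons_cr (S := S) (hB.2.1.exch hd.1) x g y y'
  rcases hG.zero_or_nz B hB x g hg with h | hu
  · have : S.cr (exch B a g) x g y y' = S.cr B x a y y' := by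
      simp only [cr, hF.N_exch hd hx, hF.N_exch_self hd, h]
      obtain ⟨p1, p2, p3⟩ := hd
      refine tri_ext ?_ ?_ ?_ <;> simp <;> field_simp
    rw [this]
    exact hG.lam B hB _ _ _ hy _ hy'
  · rw [hF.N_exch hd hx, tri_sub_eq_mul' hu hw hd] at h1
    rw [hF.N_exch hd hx, tri_sub_eq_mul' hu hw' hd] at h2
    have n1 := h1.of_mul_right
    have n2 := h2.of_mul_right
    have : S.cr (exch B a g) x g y y' =
        (1 - S.cr B x a y g) * (1 - S.cr B x a y' g)⁻¹ := by
      simp only [cr, hF.N_exch hd hx, hF.N_exch_self hd]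
      rw [tri_sub_eq_mul' hu hw hd, tri_sub_eq_mul' hu hw' hd]
      obtain ⟨p1, p2, p3⟩ := hd
      obtain ⟨q1, q2, q3⟩ := hu
      obtain ⟨r1, r2, r3⟩ := hw
      obtain ⟨s1, s2, s3⟩ := hw'
      generalize 1 - S.N B x y * S.N B a g / (S.N B x g * S.N B a y) = A at *
      generalize 1 - S.N B x y' * S.N B a g / (S.N B x g * S.N B a y') = A' at *
      refine tri_ext ?_ ?_ ?_ <;> simp <;> field_simp
    rw [this] at ht ⊢
    exact ((hG.lam B hB _ _ _ hy _ hg).one_sub S.hf).mul S.hf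
      (((hG.lam B hB _ _ _ hy' _ hg).one_sub S.hf).inv S.hf) ht n1 n2.inv

theorem Good.pivot_lam_of_row (hx : x ≠ g) (hx' : x' ≠ g) (hy : y ∈ C) (hy' : y' ∈ C)
    (h1 : Nz (S.N (exch B a g) x y)) (h2 : Nz (S.N (exch B a g) x y'))
    (h3 : Nz (S.N (exch B a g) x' y)) (h4 : Nz (S.N (exch B a g) x' y'))
    (hw : Nz (S.N B a y)) (hw' : Nz (S.N B a y')) :
    Lam S.f (S.cr (exch B a g) x x' y y') := by
  have hF := hG.fr hB
  have ht := tcons_cr (S := S) (hB.2.1.exch hd.1) x x' y y'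
  have g1 : Nz (S.N (exch B a g) g y) := by rw [hF.N_exch_self hd]; exact hw.div hd
  have g2 : Nz (S.N (exch B a g) g y') := by rw [hF.N_exch_self hd]; exact hw'.div hd
  rw [cr_rows_mul g1 g2, cr_swap_rows _ x' g] at ht ⊢
  exact (hG.pivot_lam_row hB hg hd hx hy hy' h1 h2 hw hw').mul S.hf
    ((hG.pivot_lam_row hB hg hd hx' hy hy' h3 h4 hw hw').inv S.hf) ht
    (cr_nz h1 h2 g1 g2) (cr_nz h3 h4 g1 g2).inv

theorem Good.pivot_lam_of_col (hx : x ≠ g) (hx' : x' ≠ g) (hy : y ∈ C) (hy' : y' ∈ C)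
    (h1 : Nz (S.N (exch B a g) x y)) (h2 : Nz (S.N (exch B a g) x y'))
    (h3 : Nz (S.N (exch B a g) x' y)) (h4 : Nz (S.N (exch B a g) x' y'))
    (hu : Nz (S.N B x g)) (hu' : Nz (S.N B x' g)) (hxa : x ≠ a) (hxa' : x' ≠ a) :
    Lam S.f (S.cr (exch B a g) x x' y y') := by
  have hF := hG.fr hB
  have ha : a ∈ B := mem_of_nz hd
  have haC : a ∈ C := hG.subset (hB.1 ha)
  have ht := tcons_cr (S := S) (hB.2.1.exch hd.1) x x' y y'
  have key : ∀ z, z ≠ g → z ≠ a → Nz (S.N B z g) → Nz (S.N (exch B a g) z a) := by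
    intro z hz hza hu
    rw [hF.N_exch hd hz, hF.N_ne ha hza, hF.N_self ha, mul_one, zero_sub]
    exact (hu.div hd).neg
  have a1 := key x hx hxa hu
  have a2 := key x' hx' hxa' hu'
  have col : ∀ z ∈ C, Nz (S.N (exch B a g) x z) → Nz (S.N (exch B a g) x' z) →
      Lam S.f (S.cr (exch B a g) x x' z a) := by
    intro z hz hz1 hz2
    rcases hG.zero_or_nz B hB a z hz with hw | hw
    · have : S.cr (exch B a g) x x' z a = S.cr B x x' z g := by
        simp only [cr, hF.N_exch hd hx, hF.N_exch hd hx', hF.N_ne ha hxa, hF.N_ne ha hxa',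
          hF.N_self ha, hw]
        obtain ⟨p1, p2, p3⟩ := hd
        refine tri_ext ?_ ?_ ?_ <;> simp <;> field_simp
      rw [this]
      exact hG.lam B hB _ _ _ hz _ hg
    · exact hG.pivot_lam_of_row hB hg hd hx hx' hz haC hz1 a1 hz2 a2 hw
        (by rw [hF.N_self ha]; exact nz_one)
  rw [cr_cols_mul a1 a2, cr_swap_cols _ x x' y' a] at ht ⊢
  exact (col y hy h1 h3).mul S.hf ((col y' hy' h2 h4).inv S.hf) ht (cr_nz h1 a1 h3 a2)
    (cr_nz h2 a1 h4 a2).inv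

theorem Good.pivot_lam_of_cross (hx : x ≠ g) (hx' : x' ≠ g) (hy : y ∈ C) (hy' : y' ∈ C)
    (hV : y ∈ V ∨ y' ∈ V)
    (h1 : Nz (S.N (exch B a g) x y)) (h2 : Nz (S.N (exch B a g) x y'))
    (h3 : Nz (S.N (exch B a g) x' y)) (h4 : Nz (S.N (exch B a g) x' y'))
    (hw : S.N B a y = 0) (hw' : Nz (S.N B a y'))
    (hu : Nz (S.N B x g)) (hu' : S.N B x' g = 0) (hxx : x ≠ x') :
    Lam S.f (S.cr (exch B a g) x x' y y') := by
  have hF := hG.fr hB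
  have ha : a ∈ B := mem_of_nz hd
  have ht := tcons_cr (S := S) (hB.2.1.exch hd.1) x x' y y'
  have hxa' : x' ≠ a := by rintro rfl; exact hd.ne hu'
  have e1 : S.N (exch B a g) x y = S.N B x y := by
    rw [hF.N_exch hd hx, hw]; exact tri_ext (by simp) (by simp) (by simp)
  have e3 : S.N (exch B a g) x' y = S.N B x' y := by
    rw [hF.N_exch hd hx', hw]; exact tri_ext (by simp) (by simp) (by simp)
  have e4 : S.N (exch B a g) x' y' = S.N B x' y' := by
    rw [hF.N_exch hd hx', hu']; exact tri_ext (by simp) (by simp) (by simp)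
  have e2 := hF.N_exch hd hx y'
  rw [e1] at h1
  rw [e3] at h3
  rw [e4] at h4
  have hxB : x ∈ B := mem_of_nz hu
  have hx'B : x' ∈ B := mem_of_nz h3
  rcases hG.zero_or_nz B hB x y' hy' with hn | hn
  · rcases hV with hV | hV
    · have hB1 := hG.exch_mem hB hV h3
      have hxy : x ≠ y := by
        rintro rfl
        exact hF.notMem_of_nz hxx.symm h3 hxB
      have hay : a ≠ y := by rintro rfl; rw [hF.N_self ha] at hw; exact nz_one.ne hw
      have : S.cr (exch B a g) x x' y y' = S.cr (exch B x' y) x a y' g := by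
        simp only [cr, e1, e3, e4, e2, hF.N_exch h3 hxy, hF.N_exch h3 hay, hn, hw, hu']
        obtain ⟨p1, p2, p3⟩ := hd
        obtain ⟨q1, q2, q3⟩ := h3
        obtain ⟨r1, r2, r3⟩ := hw'
        obtain ⟨s1, s2, s3⟩ := hu
        refine tri_ext ?_ ?_ ?_ <;> simp <;> field_simp
      rw [this]
      exact hG.lam _ hB1 _ _ _ hy' _ hg
    · have hB1 := hG.exch_mem hB hV h4
      have hxy : x ≠ y' := by
        rintro rfl; rw [hF.N_self hxB] at hn; exact nz_one.ne hn
      have hay : a ≠ y' := by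
        rintro rfl
        exact hF.notMem_of_nz hxa' h4 ha
      have : S.cr (exch B a g) x x' y y' = S.cr (exch B x' y') x a y g := by
        simp only [cr, e1, e3, e4, e2, hF.N_exch h4 hxy, hF.N_exch h4 hay, hn, hw, hu']
        obtain ⟨p1, p2, p3⟩ := hd
        obtain ⟨q1, q2, q3⟩ := h3
        obtain ⟨r1, r2, r3⟩ := hw'
        obtain ⟨s1, s2, s3⟩ := hu
        obtain ⟨t1, t2, t3⟩ := h4
        refine tri_ext ?_ ?_ ?_ <;> simp <;> field_simp
      rw [this]
      exact hG.lam _ hB1 _ _ _ hy _ hg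
  · rw [e2, tri_sub_eq_mul hn hd] at h2
    have n2 := h2.of_mul_right
    have : S.cr (exch B a g) x x' y y' = S.cr B x x' y y' * (1 - S.cr B x a g y')⁻¹ := by
      simp only [cr, e1, e3, e4, e2]
      rw [tri_sub_eq_mul hn hd]
      obtain ⟨p1, p2, p3⟩ := hn
      generalize 1 - S.N B x g * S.N B a y' / (S.N B x y' * S.N B a g) = A at *
      obtain ⟨q1, q2, q3⟩ := h3
      obtain ⟨r1, r2, r3⟩ := n2
      refine tri_ext ?_ ?_ ?_ <;> simp <;> field_simp
    rw [this] at ht ⊢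
    exact (hG.lam B hB _ _ _ hy _ hy').mul S.hf
      (((hG.lam B hB _ _ _ hg _ hy').one_sub S.hf).inv S.hf) ht (cr_nz h1 hn h3 h4) n2.inv

theorem Good.pivot_lam (hV : ∀ y ∈ C, ∀ y' ∈ C, y ≠ g → y' ≠ g → y ≠ y' → y ∈ V ∨ y' ∈ V)
    (x x' : α) (hy : y ∈ C) (hy' : y' ∈ C) : Lam S.f (S.cr (exch B a g) x x' y y') := by
  have hF := hG.fr hB
  have hF' := hF.exch hd
  have hz := fun x y (hy : y ∈ C) => hG.pivot_zero_or_nz hB hg hd x hy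
  rcases hz x y hy with h1 | h1
  · rw [cr_eq_zero (Or.inl h1)]; exact lam_zero S.hf
  rcases hz x y' hy' with h2 | h2
  · rw [cr_eq_zero (Or.inr (Or.inl h2))]; exact lam_zero S.hf
  rcases hz x' y hy with h3 | h3
  · rw [cr_eq_zero (Or.inr (Or.inr (Or.inl h3)))]; exact lam_zero S.hf
  rcases hz x' y' hy' with h4 | h4
  · rw [cr_eq_zero (Or.inr (Or.inr (Or.inr h4)))]; exact lam_zero S.hf
  by_cases hxx : x = x'
  · subst hxx
    have : S.cr (exch B a g) x x y y' = 1 := by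
      rw [cr, mul_comm, (h2.mul h1).div_self]
    rw [this]; exact lam_one S.hf
  by_cases hyy : y = y'
  · subst hyy
    have : S.cr (exch B a g) x x' y y = 1 := by
      rw [cr, (h1.mul h3).div_self]
    rw [this]; exact lam_one S.hf
  have gB : g ∈ exch B a g := Or.inl rfl
  have key : ∀ z, Nz (S.N (exch B a g) x z) → Nz (S.N (exch B a g) x' z) → z ≠ g := by
    intro z k1 k2 hzg
    rw [hzg] at k1 k2
    by_cases hx : x = g
    · subst hx
      exact hF'.notMem_of_nz (Ne.symm hxx) k2 gB
    · exact hF'.notMem_of_nz hx k1 gB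
  have hyg := key y h1 h3
  have hyg' := key y' h2 h4
  have grow : ∀ z, Nz (S.N (exch B a g) g z) → Nz (S.N B a z) := by
    intro z h
    rw [hF.N_exch_self hd, div_eq_mul_inv] at h
    exact h.of_mul_left
  by_cases hx : x = g
  · subst hx
    rw [cr_swap_rows]
    exact (hG.pivot_lam_row hB hg hd (Ne.symm hxx) hy hy' h3 h4 (grow _ h1)
      (grow _ h2)).inv S.hf
  by_cases hx' : x' = g
  · subst hx'
    exact hG.pivot_lam_row hB hg hd hxx hy hy' h1 h2 (grow _ h3) (grow _ h4)
  have hne : ∀ z y, z ≠ g → Nz (S.N (exch B a g) z y) → z ≠ a := by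
    intro z y hzg h hza
    rcases mem_of_nz h with h | h
    · exact hzg h
    · exact h.2 hza
  have hxa := hne x y hx h1
  have hxa' := hne x' y hx' h3
  have hVy := hV y hy y' hy' hyg hyg' hyy
  rcases hG.zero_or_nz B hB x g hg with hu | hu
  · rcases hG.zero_or_nz B hB x' g hg with hu' | hu'
    · have : S.cr (exch B a g) x x' y y' = S.cr B x x' y y' := by
        simp only [cr, hF.N_exch hd hx, hF.N_exch hd hx', hu, hu']
        refine tri_ext ?_ ?_ ?_ <;> simp
      rw [this]; exact hG.lam B hB _ _ _ hy _ hy'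
    rcases hG.zero_or_nz B hB a y hy with hw | hw
    · rcases hG.zero_or_nz B hB a y' hy' with hw' | hw'
      · have : S.cr (exch B a g) x x' y y' = S.cr B x x' y y' := by
          simp only [cr, hF.N_exch hd hx, hF.N_exch hd hx', hw, hw']
          refine tri_ext ?_ ?_ ?_ <;> simp
        rw [this]; exact hG.lam B hB _ _ _ hy _ hy'
      · rw [cr_swap_rows]
        exact (hG.pivot_lam_of_cross hB hg hd hx' hx hy hy' hVy h3 h4 h1 h2 hw hw' hu' hu
          (Ne.symm hxx)).inv S.hf
    · rcases hG.zero_or_nz B hB a y' hy' with hw' | hw'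
      · rw [cr_swap_rows, cr_swap_cols, inv_inv]
        exact hG.pivot_lam_of_cross hB hg hd hx' hx hy' hy hVy.symm h4 h3 h2 h1 hw' hw hu' hu
          (Ne.symm hxx)
      · exact hG.pivot_lam_of_row hB hg hd hx hx' hy hy' h1 h2 h3 h4 hw hw'
  · rcases hG.zero_or_nz B hB x' g hg with hu' | hu'
    · rcases hG.zero_or_nz B hB a y hy with hw | hw
      · rcases hG.zero_or_nz B hB a y' hy' with hw' | hw'
        · have : S.cr (exch B a g) x x' y y' = S.cr B x x' y y' := by
            simp only [cr, hF.N_exch hd hx, hF.N_exch hd hx', hw, hw']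
            refine tri_ext ?_ ?_ ?_ <;> simp
          rw [this]; exact hG.lam B hB _ _ _ hy _ hy'
        · exact hG.pivot_lam_of_cross hB hg hd hx hx' hy hy' hVy h1 h2 h3 h4 hw hw' hu hu' hxx
      · rcases hG.zero_or_nz B hB a y' hy' with hw' | hw'
        · rw [cr_swap_cols]
          exact (hG.pivot_lam_of_cross hB hg hd hx hx' hy' hy hVy.symm h2 h1 h4 h3 hw' hw hu
            hu' hxx).inv S.hf
        · exact hG.pivot_lam_of_row hB hg hd hx hx' hy hy' h1 h2 h3 h4 hw hw'
    · exact hG.pivot_lam_of_col hB hg hd hx hx' hy hy' h1 h2 h3 h4 hu hu' hxa hxa'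

end Pivot

/-- A column may be allowed into the frames once it is lifted, if at most one further column
is present. -/
theorem Good.transfer {V C : Set α} {g h : α} (hG : S.Good V C) (h1 : insert g V ⊆ C)
    (h2 : C ⊆ insert g (insert h V)) : S.Good (insert g V) C := by
  have hgC : g ∈ C := h1 (mem_insert _ _)
  have hVV : ∀ y ∈ C, ∀ y' ∈ C, y ≠ g → y' ≠ g → y ≠ y' → y ∈ V ∨ y' ∈ V := by
    intro y hy y' hy' hyg hyg' hne
    rcases h2 hy with h | h | h
    · exact absurd h hyg
    · rcases h2 hy' with h' | h' | h'
      · exact absurd h' hyg'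
      · exact absurd (h.trans h'.symm) hne
      · exact Or.inr h'
    · exact Or.inl h
  have hsplit : ∀ B ∈ S.Bs (insert g V), B ∈ S.Bs V ∨
      ∃ B0 ∈ S.Bs V, ∃ a, Nz (S.N B0 a g) ∧ B = exch B0 a g := by
    intro B hB
    by_cases hgV : g ∈ V
    · left; rwa [insert_eq_of_mem hgV] at hB
    by_cases hgB : g ∈ B
    · right
      obtain ⟨a, ha, haB, hB0, hag, he⟩ := exists_pivot_back hB
        (hG.X_subset.trans (subset_insert _ _)) hgB (fun h => hgV (hG.X_subset h))
      have hB0V : exch B g a ∈ S.Bs V := by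
        refine ⟨?_, hB0.2⟩
        rintro x (rfl | ⟨hx, hxg⟩)
        · exact hG.X_subset ha
        · exact (hB.1 hx).resolve_left hxg
      exact ⟨_, hB0V, a, hG.nz_of hB0V hgC hag, he.symm⟩
    · left
      exact ⟨fun x hx => (hB.1 hx).resolve_left (fun e => hgB (e ▸ hx)), hB.2⟩
  refine ⟨hG.X_subset.trans (subset_insert _ _), h1, ?_, ?_, ?_⟩
  · intro B hB
    rcases hsplit B hB with h | ⟨B0, hB0, a, hd, rfl⟩
    · exact hG.frame B h
    · exact ((hG.fr hB0).exch hd).2.2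
  · intro B hB x y hy
    rcases hsplit B hB with h | ⟨B0, hB0, a, hd, rfl⟩
    · exact hG.zero_or_nz B h x y hy
    · exact hG.pivot_zero_or_nz hB0 hgC hd x hy
  · intro B hB x x' y hy y' hy'
    rcases hsplit B hB with h | ⟨B0, hB0, a, hd, rfl⟩
    · exact hG.lam B h x x' y hy y' hy'
    · exact hG.pivot_lam hB0 hgC hd hVV x x' hy hy'

end Sys

end

section

namespace Sys

variable {F G K α V₁ V₂ V₃ : Type*} [Field F] [Field G] [Field K] [AddCommGroup V₁]
    [Module F V₁] [AddCommGroup V₂] [Module G V₂] [AddCommGroup V₃] [Module K V₃]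
    {S : Sys F G K α V₁ V₂ V₃}

section FrPivot

variable {B : Set α} {p q x y : α}

theorem Fr.N_exch_of_row (h : S.Fr B) (h0 : Nz (S.N B p q)) (hx : x ≠ q)
    (hxq : S.N B x q = 0) (y : α) : S.N (Paper.exch B p q) x y = S.N B x y := by
  rw [h.N_exch h0 hx, hxq]
  exact tri_ext (by simp) (by simp) (by simp)

theorem Fr.N_exch_of_col (h : S.Fr B) (h0 : Nz (S.N B p q)) (hx : x ≠ q)
    (hpy : S.N B p y = 0) : S.N (Paper.exch B p q) x y = S.N B x y := by
  rw [h.N_exch h0 hx, hpy]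
  exact tri_ext (by simp) (by simp) (by simp)

theorem Fr.N_exch_of_zero (h : S.Fr B) (h0 : Nz (S.N B p q)) (hx : x ≠ q)
    (hxy : S.N B x y = 0) :
    S.N (Paper.exch B p q) x y = -(S.N B x q * S.N B p y / S.N B p q) := by
  rw [h.N_exch h0 hx, hxy, zero_sub]

theorem Fr.notMem_of_two_nz (h : S.Fr B) {x' : α} (hxx : x ≠ x') (h1 : Nz (S.N B x y))
    (h2 : Nz (S.N B x' y)) : y ∉ B := by
  by_cases hxy : x = y
  · subst hxy
    exact h.notMem_of_nz hxx.symm h2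
  · exact h.notMem_of_nz hxy h1

theorem ne_of_nz_of_notMem (h1 : Nz (S.N B x y)) (hq : q ∉ B) : x ≠ q := by
  rintro rfl
  exact hq (mem_of_nz h1)

theorem cr_same_row (h1 : Nz (S.N B x y)) (h2 : Nz (S.N B x q)) : S.cr B x x y q = 1 := by
  rw [cr, mul_comm, (h2.mul h1).div_self]

end FrPivot

variable (S) in
/-- The rows `a` and `b` are joined by a path of length `n` in the fundamental graph of `B`,
restricted to the columns in `W`. -/
def Con (W : Set α) : ℕ → Set α → α → α → Prop
  | 0, _, a, b => a = b
  | n + 1, B, a, b => ∃ c, ∃ y ∈ W, Nz (S.N B a y) ∧ Nz (S.N B c y) ∧ Con W n B c b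

variable {W : Set α} {e f : α}

theorem Con.tail {C B : Set α} (hG : S.Good W C) (hB : B ∈ S.Bs W) {p q : α} (hq : q ∈ W)
    (hqB : q ∉ B) (h0 : Nz (S.N B p q)) {n : ℕ} {c b : α} (h : S.Con W n B c b) :
    S.Con W n (exch B p q) c b ∨ ∃ v, ∃ m ≤ n, Nz (S.N B v q) ∧ S.Con W m B v b := by
  have hF := hG.fr hB
  have hz := fun x => hG.zero_or_nz B hB x q (hG.subset hq)
  induction n generalizing c with
  | zero => exact Or.inl h
  | succ n ih =>
    have h' := h
    obtain ⟨c', y, hy, h1, h2, h3⟩ := h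
    rcases hz c with hc | hc
    · rcases hz c' with hc' | hc'
      · rcases ih h3 with h4 | ⟨v, m, hm, h4, h5⟩
        · left
          refine ⟨c', y, hy, ?_, ?_, h4⟩
          · rwa [hF.N_exch_of_row h0 (ne_of_nz_of_notMem h1 hqB) hc]
          · rwa [hF.N_exch_of_row h0 (ne_of_nz_of_notMem h2 hqB) hc']
        · exact Or.inr ⟨v, m, hm.trans (Nat.le_succ n), h4, h5⟩
      · exact Or.inr ⟨c', n, Nat.le_succ n, hc', h3⟩
    · exact Or.inr ⟨c, n + 1, le_rfl, hc, h'⟩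

section Pair

variable (hE : S.Good W (insert e W)) (hF : S.Good W (insert f W))
  {B : Set α} (hB : B ∈ S.Bs W) {a b x y y1 y2 : α}

include hE hF hB

theorem Good.pair_lam_one (hy : y ∈ W) (hay : Nz (S.N B a y)) (hby : Nz (S.N B b y))
    (hae : Nz (S.N B a e)) (haf : Nz (S.N B a f)) (hbe : Nz (S.N B b e))
    (hbf : Nz (S.N B b f)) : Lam S.f (S.cr B a b e f) := by
  have ht := hE.tcons hB a b e f
  rw [cr_cols_mul hay hby] at ht ⊢
  exact (hE.lam B hB _ _ _ (mem_insert _ _) _ (mem_insert_of_mem _ hy)).mul S.hf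
    (hF.lam B hB _ _ _ (mem_insert_of_mem _ hy) _ (mem_insert _ _)) ht
    (cr_nz hae hay hbe hby) (cr_nz hay haf hby hbf)

theorem Good.pair_lam_two_of_nz (hy1 : y1 ∈ W) (hy2 : y2 ∈ W) (h1 : Nz (S.N B a y1))
    (h2 : Nz (S.N B x y1)) (h3 : Nz (S.N B x y2)) (h4 : Nz (S.N B b y2))
    (ha2 : S.N B a y2 = 0) (hb1 : S.N B b y1 = 0)
    (hae : Nz (S.N B a e)) (haf : Nz (S.N B a f)) (hbe : Nz (S.N B b e))
    (hbf : Nz (S.N B b f)) (hxf : S.N B x f = 0)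
    (hae' : Nz (S.N (exch B x y1) a e)) :
    Lam S.f (S.cr B a b e f) := by
  have hR := hE.fr hB
  have hax : a ≠ x := by rintro rfl; exact h3.ne ha2
  have hy1B := hR.notMem_of_two_nz hax h1 h2
  have hay := ne_of_nz_of_notMem hae hy1B
  have hby := ne_of_nz_of_notMem hbe hy1B
  have hB' := hE.exch_mem hB hy1 h2
  have e1 := hR.N_exch_of_col h2 hay hxf
  have e2 := hR.N_exch_of_row h2 hby hb1
  have e3 := hR.N_exch_of_zero h2 hay ha2
  have l1 := hE.pair_lam_one hF hB' hy2 (a := a) (b := b)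
    (by rw [e3]; exact ((h1.mul h3).div h2).neg)
    (by rw [e2]; exact h4) hae' (by rw [e1]; exact haf) (by rw [e2]; exact hbe)
    (by rw [e2]; exact hbf)
  have ht := hE.tcons hB a b e f
  have hae'' := hae'
  rw [hR.N_exch h2 hay, tri_sub_eq_mul hae h2] at hae'
  have n1 : Nz (1 - S.cr B a x y1 e) := hae'.of_mul_right
  have : S.cr B a b e f = S.cr (exch B x y1) a b e f * (1 - S.cr B a x y1 e)⁻¹ := by
    have : S.N (exch B x y1) a e = S.N B a e * (1 - S.cr B a x y1 e) := by
      rw [hR.N_exch h2 hay, tri_sub_eq_mul hae h2, cr]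
    rw [cr, cr, e1, e2, e2, this]
    generalize 1 - S.cr B a x y1 e = A at *
    obtain ⟨p1, p2, p3⟩ := n1
    obtain ⟨q1, q2, q3⟩ := haf
    obtain ⟨r1, r2, r3⟩ := hbe
    refine tri_ext ?_ ?_ ?_ <;> simp <;> field_simp
  rw [this] at ht ⊢
  exact l1.mul S.hf (((hE.lam B hB _ _ _ (mem_insert_of_mem _ hy1) _
    (mem_insert _ _)).one_sub S.hf).inv S.hf) ht
    (cr_nz hae'' (by rw [e1]; exact haf) (by rw [e2]; exact hbe)
      (by rw [e2]; exact hbf)) n1.inv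

theorem Good.pair_lam_two_of_zero (hy1 : y1 ∈ W) (hy2 : y2 ∈ W) (h1 : Nz (S.N B a y1))
    (h2 : Nz (S.N B x y1)) (h3 : Nz (S.N B x y2)) (h4 : Nz (S.N B b y2))
    (ha2 : S.N B a y2 = 0) (hb1 : S.N B b y1 = 0)
    (hae : Nz (S.N B a e)) (haf : Nz (S.N B a f)) (hbe : Nz (S.N B b e))
    (hbf : Nz (S.N B b f)) (hxe : Nz (S.N B x e)) (hxf : S.N B x f = 0) :
    Lam S.f (S.cr B a b e f) := by
  have hR := hE.fr hB
  have hax : a ≠ x := by rintro rfl; exact h3.ne ha2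
  have hbx : b ≠ x := by rintro rfl; exact h2.ne hb1
  have hy1B := hR.notMem_of_two_nz hax h1 h2
  have hy2B := hR.notMem_of_two_nz hbx h4 h3
  have hay := ne_of_nz_of_notMem hae hy1B
  have hby := ne_of_nz_of_notMem hbe hy1B
  have hby2 := ne_of_nz_of_notMem hbe hy2B
  have hB' := hE.exch_mem hB hy1 h2
  have hB'' := hE.exch_mem hB hy2 h3
  rcases hE.zero_or_nz _ hB' a e (mem_insert _ _) with ha0 | ha0
  · rcases hE.zero_or_nz _ hB'' b e (mem_insert _ _) with hb0 | hb0
    · exfalso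
      rw [hR.N_exch h2 hay, sub_eq_zero] at ha0
      rw [hR.N_exch h3 hby2, sub_eq_zero] at hb0
      have ht := hE.tcons hB a b e f
      refine ht.not_neg S.hf (cr_nz hae haf hbe hbf) ?_
      have ht' := hE.tcons hB' a b y2 f
      have : -S.cr B a b e f = S.cr (exch B x y1) a b y2 f := by
        have e1 := hR.N_exch_of_col h2 hay hxf
        have e2 := hR.N_exch_of_row h2 hby hb1
        have e3 := hR.N_exch_of_zero h2 hay ha2
        simp only [cr]
        rw [e1, e2, e2, e3, ha0, hb0]
        obtain ⟨p1, p2, p3⟩ := h2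
        obtain ⟨q1, q2, q3⟩ := h3
        obtain ⟨r1, r2, r3⟩ := h4
        obtain ⟨s1, s2, s3⟩ := haf
        obtain ⟨t1, t2, t3⟩ := hxe
        refine tri_ext ?_ ?_ ?_ <;> simp <;> field_simp
      rwa [this]
    · rw [cr_swap_rows]
      exact (hE.pair_lam_two_of_nz hF hB hy2 hy1 h4 h3 h2 h1 hb1 ha2 hbe hbf hae haf hxf
        hb0).inv S.hf
  · exact hE.pair_lam_two_of_nz hF hB hy1 hy2 h1 h2 h3 h4 ha2 hb1 hae haf hbe hbf hxf ha0

theorem Good.pair_lam_two (hy1 : y1 ∈ W) (hy2 : y2 ∈ W) (h1 : Nz (S.N B a y1))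
    (h2 : Nz (S.N B x y1)) (h3 : Nz (S.N B x y2)) (h4 : Nz (S.N B b y2))
    (hae : Nz (S.N B a e)) (haf : Nz (S.N B a f)) (hbe : Nz (S.N B b e))
    (hbf : Nz (S.N B b f)) : Lam S.f (S.cr B a b e f) := by
  have hR := hE.fr hB
  rcases hE.zero_or_nz _ hB a y2 (hE.subset hy2) with ha2 | ha2
  swap
  · exact hE.pair_lam_one hF hB hy2 ha2 h4 hae haf hbe hbf
  rcases hE.zero_or_nz _ hB b y1 (hE.subset hy1) with hb1 | hb1
  swap
  · exact hE.pair_lam_one hF hB hy1 h1 hb1 hae haf hbe hbf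
  have ht := hE.tcons hB a b e f
  rcases hE.zero_or_nz _ hB x e (mem_insert _ _) with hxe | hxe
  · rcases hF.zero_or_nz _ hB x f (mem_insert _ _) with hxf | hxf
    · have hax : a ≠ x := by rintro rfl; exact h3.ne ha2
      have hy1B := hR.notMem_of_two_nz hax h1 h2
      have hay := ne_of_nz_of_notMem hae hy1B
      have hby := ne_of_nz_of_notMem hbe hy1B
      have hB' := hE.exch_mem hB hy1 h2
      have e0 := hR.N_exch_of_col h2 hay hxe
      have e1 := hR.N_exch_of_col h2 hay hxf
      have e2 := hR.N_exch_of_row h2 hby hb1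
      have e3 := hR.N_exch_of_zero h2 hay ha2
      have := hE.pair_lam_one hF hB' hy2 (a := a) (b := b)
        (by rw [e3]; exact ((h1.mul h3).div h2).neg)
        (by rw [e2]; exact h4) (by rw [e0]; exact hae) (by rw [e1]; exact haf)
        (by rw [e2]; exact hbe) (by rw [e2]; exact hbf)
      simpa only [cr, e0, e1, e2] using this
    · rw [cr_swap_cols]
      exact (hF.pair_lam_two_of_zero hE hB hy1 hy2 h1 h2 h3 h4 ha2 hb1 haf hae hbf hbe hxf
        hxe).inv S.hf
  · rcases hF.zero_or_nz _ hB x f (mem_insert _ _) with hxf | hxf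
    · exact hE.pair_lam_two_of_zero hF hB hy1 hy2 h1 h2 h3 h4 ha2 hb1 hae haf hbe hbf hxe hxf
    · rw [cr_rows_mul hxe hxf] at ht ⊢
      exact (hE.pair_lam_one hF hB hy1 h1 h2 hae haf hxe hxf).mul S.hf
        (hE.pair_lam_one hF hB hy2 h3 h4 hxe hxf hbe hbf) ht (cr_nz hae haf hxe hxf)
        (cr_nz hxe hxf hbe hbf)

/-- Rows joined by a path have the right cross ratio on the two new columns. -/
theorem Good.pair_lam {n : ℕ} (hab : S.Con W n B a b)
    (hae : Nz (S.N B a e)) (haf : Nz (S.N B a f)) (hbe : Nz (S.N B b e))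
    (hbf : Nz (S.N B b f)) : Lam S.f (S.cr B a b e f) := by
  induction n using Nat.strong_induction_on generalizing B with
  | _ n ih =>
  match n with
  | 0 =>
    obtain rfl : a = b := hab
    rw [cr_same_row hae haf]
    exact lam_one S.hf
  | 1 =>
    obtain ⟨c, y, hy, h1, h2, h3⟩ := hab
    obtain rfl : c = b := h3
    exact hE.pair_lam_one hF hB hy h1 h2 hae haf hbe hbf
  | 2 =>
    obtain ⟨x, y1, hy1, h1, h2, c, y2, hy2, h3, h4, h5⟩ := hab
    obtain rfl : c = b := h5
    exact hE.pair_lam_two hF hB hy1 hy2 h1 h2 h3 h4 hae haf hbe hbf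
  | n + 3 =>
    obtain ⟨x1, y1, hy1, h1, h2, x2, y2, hy2, h3, h4, x3, y3, hy3, h5, h6, h7⟩ := hab
    have hR := hE.fr hB
    have hz := fun x y (hy : y ∈ W) => hE.zero_or_nz B hB x y (hE.subset hy)
    have short : ∀ m < n + 3, S.Con W m B a b → Lam S.f (S.cr B a b e f) :=
      fun m hm hc => ih m hm hB hc hae haf hbe hbf
    rcases hz a y2 hy2 with ha2 | ha2
    swap
    · exact short (n + 2) (by omega) ⟨x2, y2, hy2, ha2, h4, x3, y3, hy3, h5, h6, h7⟩
    rcases hz x2 y1 hy1 with h21 | h21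
    swap
    · exact short (n + 2) (by omega) ⟨x2, y1, hy1, h1, h21, x3, y3, hy3, h5, h6, h7⟩
    rcases hz x1 y3 hy3 with h13 | h13
    swap
    · exact short (n + 2) (by omega) ⟨x1, y1, hy1, h1, h2, x3, y3, hy3, h13, h6, h7⟩
    rcases hz x3 y2 hy2 with h32 | h32
    swap
    · exact short (n + 2) (by omega) ⟨x1, y1, hy1, h1, h2, x3, y2, hy2, h3, h32, h7⟩
    rcases hz b y2 hy2 with hb2 | hb2
    swap
    · exact short 2 (by omega) ⟨x1, y1, hy1, h1, h2, b, y2, hy2, h3, hb2, rfl⟩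
    have h12 : x1 ≠ x2 := by rintro rfl; exact h2.ne h21
    have hy2B := hR.notMem_of_two_nz h12 h3 h4
    rcases h7.tail hE hB hy2 hy2B h4 with h8 | ⟨v, m, hm, h8, h9⟩
    swap
    · exact short (m + 2) (by omega) ⟨x1, y1, hy1, h1, h2, v, y2, hy2, h3, h8, h9⟩
    have hB' := hE.exch_mem hB hy2 h4
    have ea := hR.N_exch_of_row h4 (ne_of_nz_of_notMem hae hy2B) ha2
    have eb := hR.N_exch_of_row h4 (ne_of_nz_of_notMem hbe hy2B) hb2
    have e3 := hR.N_exch_of_row h4 (ne_of_nz_of_notMem h6 hy2B) h32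
    have hx1 := ne_of_nz_of_notMem h2 hy2B
    have e11 := hR.N_exch_of_col h4 hx1 h21
    have e13 := hR.N_exch_of_zero h4 hx1 h13
    have := ih (n + 2) (by omega) hB'
      ⟨x1, y1, hy1, by rwa [ea], by rwa [e11], x3, y3, hy3,
        by rw [e13]; exact ((h3.mul h5).div h4).neg, by rwa [e3], h8⟩
      (by rwa [ea]) (by rwa [ea]) (by rwa [eb]) (by rwa [eb])
    simpa only [cr, ea, eb] using this

end Pair

end Sys

end

section

namespace Sys

variable {F G K α V₁ V₂ V₃ : Type*} [Field F] [Field G] [Field K] [AddCommGroup V₁]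
    [Module F V₁] [AddCommGroup V₂] [Module G V₂] [AddCommGroup V₃] [Module K V₃]
    {S : Sys F G K α V₁ V₂ V₃}

open Relation

variable (S) in
/-- The edges of the fundamental graph of `B`, restricted to the columns in `W`. -/
def Edge (W B : Set α) (a x : α) : Prop := x ∈ W ∧ coord F S.φ B a x ≠ 0

variable (S) in
/-- Two elements are in the same component of the restriction to `W`. -/
def Comp (W : Set α) : α → α → Prop := EqvGen (S.Edge W S.X)

theorem Comp.symm {W : Set α} {x y : α} (h : S.Comp W x y) : S.Comp W y x := EqvGen.symm _ _ h

theorem Comp.trans {W : Set α} {x y z : α} (h : S.Comp W x y) (h' : S.Comp W y z) :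
    S.Comp W x z := EqvGen.trans _ _ _ h h'

theorem eqvGen_of_edge_exch {W B : Set α} (hB : IsFrame F S.φ B) {p q : α} (hq : q ∈ W)
    (h0 : coord F S.φ B p q ≠ 0) {x y : α} (h : S.Edge W (exch B p q) x y) :
    EqvGen (S.Edge W B) x y := by
  obtain ⟨hy, h⟩ := h
  have hpq : EqvGen (S.Edge W B) p q := EqvGen.rel _ _ ⟨hq, h0⟩
  by_cases hx : x = q
  · subst hx
    rw [hB.coord_exch_self h0] at h
    have hp : coord F S.φ B p y ≠ 0 := fun h' => h (by rw [h', zero_div])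
    exact (hpq.symm _ _).trans _ _ _ (EqvGen.rel _ _ ⟨hy, hp⟩)
  · rw [hB.coord_exch h0 hx] at h
    by_cases hxy : coord F S.φ B x y = 0
    · have h1 : coord F S.φ B x q ≠ 0 := fun h' => h (by rw [hxy, h']; simp)
      have h2 : coord F S.φ B p y ≠ 0 := fun h' => h (by rw [hxy, h']; simp)
      exact (EqvGen.rel _ _ ⟨hq, h1⟩ : EqvGen (S.Edge W B) x q).trans _ _ _
        ((hpq.symm _ _).trans _ _ _ (EqvGen.rel _ _ ⟨hy, h2⟩))
    · exact EqvGen.rel _ _ ⟨hy, hxy⟩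

theorem eqvGen_of_le {β : Type*} {r s : β → β → Prop} (h : ∀ x y, r x y → EqvGen s x y) {x y : β}
    (hxy : EqvGen r x y) : EqvGen s x y := by
  induction hxy with
  | rel x y h' => exact h x y h'
  | refl x => exact EqvGen.refl x
  | symm x y _ ih => exact EqvGen.symm _ _ ih
  | trans x y z _ _ ih ih' => exact EqvGen.trans _ _ _ ih ih'

theorem comp_of_edge {W B : Set α} (hX : S.X ⊆ W) (hB : B ∈ S.Bs W) {x y : α}
    (h : S.Edge W B x y) : S.Comp W x y := by
  revert x y
  refine Bs_induction (P := fun B => ∀ {x y}, S.Edge W B x y → S.Comp W x y) hX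
    (fun h => EqvGen.rel _ _ h) ?_ B hB
  intro B hB ih p q hq h0 x y h
  exact eqvGen_of_le (fun x y => ih) (eqvGen_of_edge_exch hB.2.1 hq h0 h)

theorem eqvGen_of_comp {W B : Set α} (hX : S.X ⊆ W) (hB : B ∈ S.Bs W) {x y : α}
    (h : S.Comp W x y) : EqvGen (S.Edge W B) x y := by
  refine Bs_induction (P := fun B => EqvGen (S.Edge W B) x y) hX h ?_ B hB
  intro B hB ih p q hq h0
  have hp : p ∈ B := mem_of_coord_ne h0
  by_cases hqB : q ∈ B
  · have hpq : p = q := by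
      by_contra hne
      exact h0 (hB.2.1.coord_ne hqB hne)
    subst hpq
    have : exch B p p = B := by simp [exch, insert_eq_of_mem hp]
    rwa [this]
  · refine eqvGen_of_le (fun x y hxy => ?_) ih
    have he := exch_exch hp hqB
    have hB' := hB.2.1.exch h0
    refine eqvGen_of_edge_exch hB' (hB.1 hp) (hB'.coord_ne_zero_of_exch (Or.inl rfl) ?_) ?_
    · rw [he]; exact hB.2.1
    · rwa [he]

theorem Con.trans {W B : Set α} {a b c : α} {m n : ℕ} (h : S.Con W m B a b)
    (h' : S.Con W n B b c) : ∃ l, S.Con W l B a c := by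
  induction m generalizing a with
  | zero => obtain rfl : a = b := h; exact ⟨n, h'⟩
  | succ m ih =>
    obtain ⟨d, y, hy, h1, h2, h3⟩ := h
    obtain ⟨l, hl⟩ := ih h3
    exact ⟨l + 1, d, y, hy, h1, h2, hl⟩

theorem Con.symm {W B : Set α} {a b : α} {m : ℕ} (h : S.Con W m B a b) :
    ∃ l, S.Con W l B b a := by
  induction m generalizing a with
  | zero => obtain rfl : a = b := h; exact ⟨0, rfl⟩
  | succ m ih =>
    obtain ⟨d, y, hy, h1, h2, h3⟩ := h
    obtain ⟨l, hl⟩ := ih h3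
    exact hl.trans (n := 1) ⟨a, y, hy, h2, h1, rfl⟩

theorem Good.edge_nz {W C B : Set α} (hG : S.Good W C) (hB : B ∈ S.Bs W) {x y : α}
    (h : S.Edge W B x y) : Nz (S.N B x y) := hG.nz_of hB (hG.subset h.1) h.2

theorem Good.exists_con {W C B : Set α} (hG : S.Good W C) (hB : B ∈ S.Bs W) {a b : α}
    (ha : a ∈ B) (hb : b ∈ B) (h : S.Comp W a b) : ∃ n, S.Con W n B a b := by
  have hR := hG.fr hB
  have key : ∀ x y, EqvGen (S.Edge W B) x y → x = y ∨ ∃ a b n, S.Edge W B a x ∧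
      S.Edge W B b y ∧ S.Con W n B a b := by
    intro x y h
    induction h with
    | rel x y h =>
      have hx : x ∈ B := mem_of_coord_ne h.2
      refine Or.inr ⟨x, x, 0, ⟨hB.1 hx, ?_⟩, h, rfl⟩
      rw [hR.1.coord_self hx]; exact one_ne_zero
    | refl x => exact Or.inl rfl
    | symm x y _ ih =>
      rcases ih with rfl | ⟨a, b, n, h1, h2, h3⟩
      · exact Or.inl rfl
      · obtain ⟨l, hl⟩ := h3.symm
        exact Or.inr ⟨b, a, l, h2, h1, hl⟩
    | trans x y z _ _ ih ih' =>
      rcases ih with rfl | ⟨a, b, n, h1, h2, h3⟩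
      · exact ih'
      · rcases ih' with rfl | ⟨c, d, m, h4, h5, h6⟩
        · exact Or.inr ⟨a, b, n, h1, h2, h3⟩
        · have hbd : S.Con W (m + 1) B b d := ⟨c, y, h2.1, hG.edge_nz hB h2,
            hG.edge_nz hB h4, h6⟩
          obtain ⟨l, hl⟩ := h3.trans hbd
          exact Or.inr ⟨a, d, l, h1, h5, hl⟩
  have self : ∀ x z, z ∈ B → S.Edge W B x z → x = z := by
    intro x z hz h
    by_contra hne
    exact h.2 (hR.1.coord_ne hz hne)
  rcases key _ _ (eqvGen_of_comp hG.X_subset hB h) with rfl | ⟨a', b', n, h1, h2, h3⟩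
  · exact ⟨0, rfl⟩
  · obtain rfl := self _ _ ha h1
    obtain rfl := self _ _ hb h2
    exact ⟨n, h3⟩

theorem finite_support {W B B' : Set α} (hB : B ∈ S.Bs W) (hB' : B' ∈ S.Bs W) (a : α) :
    {p | p ∈ B ∧ coord F S.φ B' a p ≠ 0}.Finite := by
  refine ((hB.2.2.1.union hB'.2.2.2).insert a).subset ?_
  rintro p ⟨hp, h0⟩
  by_cases hpa : p = a
  · exact Or.inl hpa
  right
  have hpB' : p ∉ B' := fun h => h0 (hB'.2.1.coord_ne h (Ne.symm hpa))
  by_cases hpX : p ∈ S.X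
  · exact Or.inr ⟨hpX, hpB'⟩
  · exact Or.inl ⟨hp, hpX⟩

theorem support_exch {B B' : Set α} {a p q : α} (h : coord F S.φ B' a q = 0) :
    {x | x ∈ exch B p q ∧ coord F S.φ B' a x ≠ 0} =
      {x | x ∈ B ∧ coord F S.φ B' a x ≠ 0} \ {p} := by
  ext x
  simp only [exch, mem_ofPred_eq, mem_insert_iff, mem_sdiff, mem_singleton_iff]
  constructor
  · rintro ⟨rfl | hx, h'⟩
    · exact absurd h h'
    · exact ⟨⟨hx.1, h'⟩, hx.2⟩
  · rintro ⟨⟨hx, h'⟩, hp⟩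
    exact ⟨Or.inr ⟨hx, hp⟩, h'⟩

theorem ncard_support_exch {W B B' : Set α} (hB : B ∈ S.Bs W) (hB' : B' ∈ S.Bs W)
    {a p q : α} (hp : p ∈ B) (hap : coord F S.φ B' a p ≠ 0) (h : coord F S.φ B' a q = 0) :
    {x | x ∈ exch B p q ∧ coord F S.φ B' a x ≠ 0}.ncard <
      {x | x ∈ B ∧ coord F S.φ B' a x ≠ 0}.ncard := by
  rw [support_exch h]
  have hm : p ∈ {x | x ∈ B ∧ coord F S.φ B' a x ≠ 0} := ⟨hp, hap⟩
  exact ncard_sdiff_singleton_lt_of_mem hm (finite_support hB hB' a)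

/-- A row whose support on `B₁` is concentrated at `a₁` is proportional to the row `a₁`. -/
theorem Good.row_proportional {W C B B₁ : Set α} (hG : S.Good W C) (hB : B ∈ S.Bs W)
    (hB₁ : B₁ ∈ S.Bs W) {p a₁ : α} (hp : p ∈ B)
    (h : ∀ q ∈ B₁, q ≠ a₁ → S.N B p q = 0) :
    ∃ s, Nz s ∧ ∀ y, S.N B p y = s * S.N B₁ a₁ y := by
  have hR := hG.fr hB
  have hR₁ := hG.fr hB₁
  have key := fun y => hR₁.row_eq hR h y
  refine ⟨S.N B p a₁, ?_, key⟩
  by_contra hc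
  have h1 := hR.N_self hp
  rw [key p] at h1
  have : Nz (S.N B p a₁ * S.N B₁ a₁ p) := by rw [h1]; exact nz_one
  exact hc this.of_mul_left

theorem Good.transplant {W C : Set α} (hG : S.Good W C) {B₁ B₂ : Set α} (hB₁ : B₁ ∈ S.Bs W)
    (hB₂ : B₂ ∈ S.Bs W) {a₁ : α} (ha₁ : a₁ ∈ B₁) :
    ∃ B ∈ S.Bs W, ∃ d ∈ B, (∃ s, Nz s ∧ ∀ y, S.N B d y = s * S.N B₁ a₁ y) ∧
      ∀ x ∈ B₂, ¬ S.Comp W x a₁ → x ∈ B ∧ ∀ y, S.N B x y = S.N B₂ x y := by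
  obtain ⟨n, hn⟩ : ∃ n, {p | p ∈ B₂ ∧ coord F S.φ B₁ a₁ p ≠ 0}.ncard = n := ⟨_, rfl⟩
  induction n using Nat.strong_induction_on generalizing B₂ with
  | _ n ih =>
  have hR := hG.fr hB₂
  obtain ⟨p, hp, hap⟩ := hB₁.2.1.exists_coord_ne hB₂.2.1 ha₁
  by_cases hc : ∀ q ∈ B₁, q ≠ a₁ → S.N B₂ p q = 0
  · exact ⟨B₂, hB₂, p, hp, hG.row_proportional hB₂ hB₁ hp hc, fun x hx _ => ⟨hx, fun _ => rfl⟩⟩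
  push Not at hc
  obtain ⟨q, hq, hqa, hpq⟩ := hc
  have hqW := hB₁.1 hq
  have hpq := (hG.zero_or_nz B₂ hB₂ p q (hG.subset hqW)).resolve_left hpq
  have h0 : coord F S.φ B₁ a₁ q = 0 := hB₁.2.1.coord_ne hq (Ne.symm hqa)
  have hB' := hG.exch_mem hB₂ hqW hpq
  obtain ⟨B, hB, d, hd, h1, h2⟩ := ih _ (hn ▸ ncard_support_exch hB₂ hB₁ hp hap h0) hB' rfl
  refine ⟨B, hB, d, hd, h1, fun x hx hxa => ?_⟩
  have cap : S.Comp W a₁ p := comp_of_edge hG.X_subset hB₁ ⟨hB₂.1 hp, hap⟩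
  have cpq : S.Comp W p q := comp_of_edge hG.X_subset hB₂ ⟨hqW, hpq.1⟩
  have hxp : x ≠ p := by rintro rfl; exact hxa cap.symm
  have hpq' : p ≠ q := by rintro rfl; exact hap h0
  have hqB := hR.notMem_of_nz hpq' hpq
  have hxq : S.N B₂ x q = 0 := by
    refine (hG.zero_or_nz B₂ hB₂ x q (hG.subset hqW)).resolve_right fun h => hxa ?_
    have cxq : S.Comp W x q := comp_of_edge hG.X_subset hB₂ ⟨hqW, h.1⟩
    exact cxq.trans (cpq.symm.trans cap.symm)
  obtain ⟨h3, h4⟩ := h2 x (Or.inr ⟨hx, hxp⟩) hxa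
  refine ⟨h3, fun y => ?_⟩
  rw [h4, hR.N_exch_of_row hpq (fun h => hqB (h ▸ hx)) hxq]

variable (S) in
/-- The row `a` of `B` is nonzero in both columns `e` and `f`. -/
structure Act (W : Set α) (e f : α) (B : Set α) (a : α) : Prop where
  mem : B ∈ S.Bs W
  left : Nz (S.N B a e)
  right : Nz (S.N B a f)

variable (S) in
/-- The ratio of the entries in columns `e` and `f` of the row `a` of `B`. -/
noncomputable def tau (e f : α) (B : Set α) (a : α) : F × G × K := S.N B a e / S.N B a f

variable {W C : Set α} {e f : α} {B B₁ B' : Set α} {a a₁ a' : α}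

theorem Act.nz (h : S.Act W e f B a) : Nz (S.tau e f B a) := h.left.div h.right

theorem tau_div_tau (B : Set α) (a b : α) :
    S.tau e f B a / S.tau e f B b = S.cr B a b e f := by
  rw [tau, tau, cr, div_div_div_eq]

theorem tau_eq_of_proportional {s : F × G × K} (hs : Nz s)
    (h : ∀ y, S.N B a y = s * S.N B' a' y) : S.tau e f B a = S.tau e f B' a' := by
  rw [tau, tau, h, h]
  exact tri_ext (mul_div_mul_left _ _ hs.1) (mul_div_mul_left _ _ hs.2.1)
    (mul_div_mul_left _ _ hs.2.2)

theorem Act.tcons (hG : S.Good W C) (h : S.Act W e f B a) (h' : S.Act W e f B' a')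
    (hc : ¬ S.Comp W a' a) : TCons (S.tau e f B a / S.tau e f B' a') := by
  obtain ⟨B₂, hB₂, d, hd, ⟨s, hs, hds⟩, h2⟩ := hG.transplant h.mem h'.mem (mem_of_nz h.left)
  obtain ⟨h3, h4⟩ := h2 a' (mem_of_nz h'.left) hc
  have e1 : S.tau e f B' a' = S.tau e f B₂ a' := by rw [tau, tau, h4, h4]
  rw [← tau_eq_of_proportional hs hds, e1, tau_div_tau]
  exact tcons_cr hB₂.2.1 _ _ _ _

theorem tri_div_mul_div {F G K : Type*} [Field F] [Field G] [Field K] {a b c : F × G × K}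
    (hb : Nz b) : a / b * (b / c) = a / c :=
  tri_ext (div_mul_div_cancel₀ hb.1) (div_mul_div_cancel₀ hb.2.1)
    (div_mul_div_cancel₀ hb.2.2)

end Sys

end

section

namespace Sys

variable {F G K α V₁ V₂ V₃ : Type*} [Field F] [Field G] [Field K] [AddCommGroup V₁]
    [Module F V₁] [AddCommGroup V₂] [Module G V₂] [AddCommGroup V₃] [Module K V₃]
    {S : Sys F G K α V₁ V₂ V₃}

variable {W C : Set α} {e f : α} {B B₁ B' : Set α} {a a₁ a' : α}

theorem tau_exch (hR : S.Fr B) {p q : α} (hq : Nz (S.N B p q)) :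
    S.tau e f (exch B p q) q = S.tau e f B p := by
  refine tau_eq_of_proportional hq.inv fun y => ?_
  rw [hR.N_exch_self hq, div_eq_mul_inv, mul_comm]

theorem Act.pivot (hG : S.Good W C) (h : S.Act W e f B a) {q : α} (hqW : q ∈ W)
    (hq : Nz (S.N B a q)) : S.Act W e f (exch B a q) q := by
  have hR := hG.fr h.mem
  refine ⟨hG.exch_mem h.mem hqW hq, ?_, ?_⟩
  · rw [hR.N_exch_self hq]; exact h.left.div hq
  · rw [hR.N_exch_self hq]; exact h.right.div hq

theorem Act.pivot_of_zero (hG : S.Good W C) (h : S.Act W e f B a) {p q : α} (hqW : q ∈ W)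
    (hq : Nz (S.N B p q)) (haq : S.N B a q = 0) (hqB : q ∉ B) :
    S.Act W e f (exch B p q) a ∧
      S.tau e f (exch B p q) a = S.tau e f B a := by
  have hR := hG.fr h.mem
  have haq' : a ≠ q := ne_of_nz_of_notMem h.left hqB
  have hrow := hR.N_exch_of_row hq haq' haq
  refine ⟨⟨hG.exch_mem h.mem hqW hq, ?_, ?_⟩, ?_⟩
  · rw [hrow]; exact h.left
  · rw [hrow]; exact h.right
  · rw [tau, tau, hrow, hrow]

variable (S) in
/-- The row `a` of `B` is active, lies in the component of `a₁`, and its ratio, relative to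
the reference `t`, is lifted. -/
structure Lifted (W : Set α) (e f a₁ : α) (t : F × G × K) (B : Set α) (a : α) : Prop where
  act : S.Act W e f B a
  comp : S.Comp W a a₁
  lam : Lam S.f (S.tau e f B a / t)

theorem Lifted.link (hE : S.Good W (insert e W)) (hF : S.Good W (insert f W))
    (h' : S.Act W e f B' a') (hc : ¬ S.Comp W a' a₁)
    (h : S.Lifted W e f a₁ (S.tau e f B' a') B a) {p : α} (hp : S.Act W e f B p)
    (hpa : S.Comp W p a₁) : S.Lifted W e f a₁ (S.tau e f B' a') B p := by
  refine ⟨hp, hpa, ?_⟩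
  obtain ⟨n, hn⟩ := hE.exists_con hp.mem (mem_of_nz hp.left) (mem_of_nz h.act.left)
    (hpa.trans h.comp.symm)
  have h1 := hE.pair_lam hF hp.mem hn hp.left hp.right h.act.left h.act.right
  rw [← tau_div_tau] at h1
  have h2 := hp.tcons hE h' fun hh => hc (hh.trans hpa)
  rw [← tri_div_mul_div h.act.nz] at h2 ⊢
  exact h1.mul S.hf h.lam h2 (hp.nz.div h.act.nz) (h.act.nz.div h'.nz)

theorem Lifted.pivot (hE : S.Good W (insert e W))
    {t : F × G × K} (h : S.Lifted W e f a₁ t B a) {q : α} (hqW : q ∈ W)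
    (hq : Nz (S.N B a q)) : S.Lifted W e f a₁ t (exch B a q) q := by
  refine ⟨h.act.pivot hE hqW hq, ?_, ?_⟩
  · exact (comp_of_edge hE.X_subset h.act.mem ⟨hqW, hq.1⟩).symm.trans h.comp
  · rw [tau_exch (hE.fr h.act.mem) hq]; exact h.lam

/-- A quadrangle in which an active row meets two rows supported on opposite columns
contradicts the absence of nonzero consistent pairs with consistent negatives. -/
theorem Act.quadrangle (hE : S.Good W (insert e W)) (hF : S.Good W (insert f W))
    (h : S.Act W e f B a) (h' : S.Act W e f B' a') (hca : ¬ S.Comp W a' a) {q i j : α}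
    (hcj : ¬ S.Comp W a' j) (hqW : q ∈ W) (hqB : q ∉ B) (haq : Nz (S.N B a q))
    (hiq : Nz (S.N B i q)) (hjq : Nz (S.N B j q)) (hif : S.N B i f = 0)
    (hje : S.N B j e = 0) (hi : ¬ S.Act W e f (exch B a q) i)
    (hj : ¬ S.Act W e f (exch B a q) j) (hjf : Nz (S.N B j f)) : False := by
  have hR := hE.fr h.mem
  have hB₂ := hE.exch_mem h.mem hqW haq
  have hB₃ := hE.exch_mem h.mem hqW hiq
  have hiq' : i ≠ q := ne_of_nz_of_notMem hiq hqB
  have hjq' : j ≠ q := ne_of_nz_of_notMem hjq hqB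
  have h1 : S.N B i e = S.N B i q * S.N B a e / S.N B a q := by
    rcases hE.zero_or_nz _ hB₂ i e (mem_insert _ _) with h0 | h0
    · rwa [hR.N_exch haq hiq', sub_eq_zero] at h0
    · refine absurd ⟨hB₂, h0, ?_⟩ hi
      rw [hR.N_exch_of_zero haq hiq' hif]
      exact ((hiq.mul h.right).div haq).neg
  have h2 : S.N B j f = S.N B j q * S.N B a f / S.N B a q := by
    rcases hF.zero_or_nz _ hB₂ j f (mem_insert _ _) with h0 | h0
    · rwa [hR.N_exch haq hjq', sub_eq_zero] at h0
    · refine absurd ⟨hB₂, ?_, h0⟩ hj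
      rw [hR.N_exch_of_zero haq hjq' hje]
      exact ((hjq.mul h.left).div haq).neg
  have h3 : S.N (exch B i q) j e = -(S.N B j q * S.N B i e / S.N B i q) :=
    hR.N_exch_of_zero hiq hjq' hje
  have h4 : S.N (exch B i q) j f = S.N B j f := hR.N_exch_of_col hiq hjq' hif
  have hie : Nz (S.N B i e) := h1 ▸ (hiq.mul h.left).div haq
  have hact : S.Act W e f (exch B i q) j :=
    ⟨hB₃, h3 ▸ ((hjq.mul hie).div hiq).neg, h4 ▸ hjf⟩
  have h5 : S.tau e f (exch B i q) j = -S.tau e f B a := by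
    rw [tau, tau, h3, h4, h2, h1]
    obtain ⟨u1, u2, u3⟩ := haq
    obtain ⟨v1, v2, v3⟩ := hiq
    obtain ⟨w1, w2, w3⟩ := hjq
    obtain ⟨x1, x2, x3⟩ := h.right
    refine tri_ext ?_ ?_ ?_ <;> simp <;> field_simp
  have h6 := hact.tcons hE h' hcj
  rw [h5, neg_div] at h6
  exact (h.tcons hE h' hca).not_neg S.hf (h.nz.div h'.nz) h6

/-- An inactive row of an active frame, meeting a column `q`, which stays inactive after
pivoting the active row on `q`, has an entry in exactly one of the columns `e` and `f`. -/
theorem Act.left_iff (hE : S.Good W (insert e W)) (hF : S.Good W (insert f W))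
    (h : S.Act W e f B a) {q i : α} (hqW : q ∈ W) (hqB : q ∉ B) (haq : Nz (S.N B a q))
    (hiq : Nz (S.N B i q)) (hi : ¬ S.Act W e f B i)
    (hi' : ¬ S.Act W e f (exch B a q) i) :
    (S.N B i f = 0 ∧ Nz (S.N B i e)) ∨ (S.N B i e = 0 ∧ Nz (S.N B i f)) := by
  have hR := hE.fr h.mem
  have hiq' : i ≠ q := ne_of_nz_of_notMem hiq hqB
  rcases hE.zero_or_nz _ h.mem i e (mem_insert _ _) with he | he
  · rcases hF.zero_or_nz _ h.mem i f (mem_insert _ _) with hf | hf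
    · refine absurd ⟨hE.exch_mem h.mem hqW haq, ?_, ?_⟩ hi'
      · rw [hR.N_exch_of_zero haq hiq' he]
        exact ((hiq.mul h.left).div haq).neg
      · rw [hR.N_exch_of_zero haq hiq' hf]
        exact ((hiq.mul h.right).div haq).neg
    · exact Or.inr ⟨he, hf⟩
  · rcases hF.zero_or_nz _ h.mem i f (mem_insert _ _) with hf | hf
    · exact Or.inl ⟨hf, he⟩
    · exact absurd ⟨h.mem, he, hf⟩ hi

theorem Lifted.lam_of_mem (hE : S.Good W (insert e W))
    (h₁ : S.Act W e f B₁ a₁) {t : F × G × K} (h : S.Lifted W e f a₁ t B a)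
    (haD : coord F S.φ B₁ a₁ a ≠ 0)
    (ih : ∀ B₂ a₂, S.Lifted W e f a₁ t B₂ a₂ →
      {x | x ∈ B₂ ∧ coord F S.φ B₁ a₁ x ≠ 0}.ncard <
        {x | x ∈ B ∧ coord F S.φ B₁ a₁ x ≠ 0}.ncard →
      Lam S.f (S.tau e f B₁ a₁ / t)) : Lam S.f (S.tau e f B₁ a₁ / t) := by
  have haB := mem_of_nz h.act.left
  by_cases hc : ∀ q ∈ B₁, q ≠ a₁ → S.N B a q = 0
  · obtain ⟨s, hs, hrow⟩ := hE.row_proportional h.act.mem h₁.mem haB hc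
    rw [← tau_eq_of_proportional hs hrow]
    exact h.lam
  push Not at hc
  obtain ⟨q, hq, hqa, haq⟩ := hc
  have hqW := h₁.mem.1 hq
  have haq := (hE.zero_or_nz B h.act.mem a q (hE.subset hqW)).resolve_left haq
  refine ih _ _ (h.pivot hE hqW haq) ?_
  exact ncard_support_exch h.act.mem h₁.mem haB haD (h₁.mem.2.1.coord_ne hq (Ne.symm hqa))

/-- If the rows touched by each column of `B₁` other than `a₁` are supported on one of the
columns `e` and `f`, then `a₁` is not active. -/
theorem Act.not_separated (h₁ : S.Act W e f B₁ a₁) (hB : IsFrame F S.φ B)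
    (hD : ∀ p ∈ B, coord F S.φ B₁ a₁ p ≠ 0 → coord F S.φ B p e ≠ 0 →
      coord F S.φ B p f = 0)
    (hq : ∀ q ∈ B₁, q ≠ a₁ → (∀ p ∈ B, coord F S.φ B₁ a₁ p ≠ 0 → coord F S.φ B p q ≠ 0 →
      coord F S.φ B p f = 0) ∨ (∀ p ∈ B, coord F S.φ B₁ a₁ p ≠ 0 → coord F S.φ B p q ≠ 0 →
      coord F S.φ B p f ≠ 0)) : False := by
  classical
  obtain ⟨h, hh⟩ := h₁.mem.2.1.exists_row a₁
  obtain ⟨r, hr⟩ := hB.exists_functional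
    (fun x => if coord F S.φ B x f = 0 then coord F S.φ B₁ a₁ x else 0)
  have hre : r (S.φ e) = h (S.φ e) := by
    refine hB.eval_congr fun x hx hxe => ?_
    rw [hr x hx, hh]
    by_cases hx0 : coord F S.φ B₁ a₁ x = 0
    · simp [hx0]
    · simp [hD x hx hx0 hxe]
  have hrf : r (S.φ f) = 0 := by
    refine hB.eval_congr (r' := 0) fun x hx hxf => ?_
    simp [hr x hx, hxf]
  have hrq : ∀ q ∈ B₁, q ≠ a₁ → r (S.φ q) = 0 := by
    intro q hqB hqa
    rcases hq q hqB hqa with hc | hc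
    · have : h (S.φ q) = 0 := by rw [hh]; exact h₁.mem.2.1.coord_ne hqB (Ne.symm hqa)
      rw [← this]
      refine hB.eval_congr fun x hx hxq => ?_
      rw [hr x hx, hh]
      by_cases hx0 : coord F S.φ B₁ a₁ x = 0
      · simp [hx0]
      · simp [hc x hx hx0 hxq]
    · refine hB.eval_congr (r' := 0) fun x hx hxq => ?_
      rw [hr x hx]
      by_cases hx0 : coord F S.φ B₁ a₁ x = 0
      · simp [hx0]
      · simp [hc x hx hx0 hxq]
  have hrh : r = r (S.φ a₁) • h := by
    refine h₁.mem.2.1.ext fun x hx => ?_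
    rw [LinearMap.smul_apply, smul_eq_mul, hh]
    by_cases hxa : x = a₁
    · rw [hxa, h₁.mem.2.1.coord_self (mem_of_nz h₁.left), mul_one]
    · rw [hrq x hx hxa, h₁.mem.2.1.coord_ne hx (Ne.symm hxa), mul_zero]
  have h2 := hrf
  rw [hrh, LinearMap.smul_apply, smul_eq_mul, hh] at h2
  have h3 := (mul_eq_zero.1 h2).resolve_right h₁.right.1
  rw [hrh, h3, zero_smul, LinearMap.zero_apply, hh] at hre
  exact h₁.left.1 hre.symm

/-- Lifting of the ratio propagates through a component. -/
theorem Lifted.propagate (hE : S.Good W (insert e W)) (hF : S.Good W (insert f W))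
    (h₁ : S.Act W e f B₁ a₁) (h' : S.Act W e f B' a') (hc : ¬ S.Comp W a' a₁)
    (h : S.Lifted W e f a₁ (S.tau e f B' a') B a) :
    Lam S.f (S.tau e f B₁ a₁ / S.tau e f B' a') := by
  obtain ⟨n, hn⟩ : ∃ n, {x | x ∈ B ∧ coord F S.φ B₁ a₁ x ≠ 0}.ncard = n := ⟨_, rfl⟩
  induction n using Nat.strong_induction_on generalizing B a with
  | _ n ih =>
  subst hn
  have hB := h.act.mem
  have hR := hE.fr hB
  have haB := mem_of_nz h.act.left
  have hcD : ∀ {p}, p ∈ W → coord F S.φ B₁ a₁ p ≠ 0 → S.Comp W p a₁ := fun hp hpD =>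
    (comp_of_edge hE.X_subset h₁.mem ⟨hp, hpD⟩).symm
  have h0 : ∀ {q}, q ∈ B₁ → q ≠ a₁ → coord F S.φ B₁ a₁ q = 0 := fun hq hqa =>
    h₁.mem.2.1.coord_ne hq (Ne.symm hqa)
  have hqB : ∀ {p q}, coord F S.φ B₁ a₁ p ≠ 0 → q ∈ B₁ → q ≠ a₁ → Nz (S.N B p q) →
      q ∉ B := by
    intro p q hpD hq hqa hpq
    refine hR.notMem_of_nz ?_ hpq
    rintro rfl
    exact hpD (h0 hq hqa)
  have hnz : ∀ {p q}, q ∈ B₁ → coord F S.φ B p q ≠ 0 → Nz (S.N B p q) := fun hq hpq =>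
    hE.nz_of hB (hE.subset (h₁.mem.1 hq)) hpq
  by_cases haD : coord F S.φ B₁ a₁ a ≠ 0
  · refine h.lam_of_mem hE h₁ haD fun B₂ a₂ h₂ hlt => ?_
    exact ih _ hlt h₂ rfl
  by_cases hc2 : ∃ p ∈ B, coord F S.φ B₁ a₁ p ≠ 0 ∧ S.Act W e f B p
  · obtain ⟨p, hp, hpD, hpA⟩ := hc2
    refine (h.link hE hF h' hc hpA (hcD (hB.1 hp) hpD)).lam_of_mem hE h₁ hpD
      fun B₂ a₂ h₂ hlt => ?_
    exact ih _ hlt h₂ rfl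
  have hDA : ∀ p ∈ B, coord F S.φ B₁ a₁ p ≠ 0 → ¬ S.Act W e f B p := fun p hp hpD hA =>
    hc2 ⟨p, hp, hpD, hA⟩
  by_cases hc3 : ∃ p ∈ B, ∃ q ∈ B₁, q ≠ a₁ ∧ coord F S.φ B₁ a₁ p ≠ 0 ∧
      Nz (S.N B p q) ∧ S.N B a q = 0
  · obtain ⟨p, hp, q, hq, hqa, hpD, hpq, haq⟩ := hc3
    obtain ⟨h2, h3⟩ := h.act.pivot_of_zero hE (h₁.mem.1 hq) hpq haq (hqB hpD hq hqa hpq)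
    exact ih _ (ncard_support_exch hB h₁.mem hp hpD (h0 hq hqa))
      ⟨h2, h.comp, by rw [h3]; exact h.lam⟩ rfl
  have hDq : ∀ {p q}, p ∈ B → q ∈ B₁ → q ≠ a₁ → coord F S.φ B₁ a₁ p ≠ 0 →
      Nz (S.N B p q) → Nz (S.N B a q) := fun hp hq hqa hpD hpq =>
    (hE.zero_or_nz B hB _ _ (hE.subset (h₁.mem.1 hq))).resolve_left fun haq =>
      hc3 ⟨_, hp, _, hq, hqa, hpD, hpq, haq⟩
  by_cases hc4 : ∃ p ∈ B, ∃ q ∈ B₁, q ≠ a₁ ∧ coord F S.φ B₁ a₁ p ≠ 0 ∧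
      Nz (S.N B a q) ∧ S.Act W e f (exch B a q) p
  · obtain ⟨p, hp, q, hq, hqa, hpD, haq, hpA⟩ := hc4
    refine ((h.pivot hE (h₁.mem.1 hq) haq).link hE hF h' hc hpA
      (hcD (hB.1 hp) hpD)).lam_of_mem hE h₁ hpD fun B₂ a₂ h₂ hlt => ?_
    rw [support_exch (h0 hq hqa)] at hlt
    rw [sdiff_singleton_eq_self fun hh => haD hh.2] at hlt
    exact ih _ hlt h₂ rfl
  have hDA' : ∀ {p q}, p ∈ B → q ∈ B₁ → q ≠ a₁ → coord F S.φ B₁ a₁ p ≠ 0 →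
      Nz (S.N B a q) → ¬ S.Act W e f (exch B a q) p := fun hp hq hqa hpD haq hA =>
    hc4 ⟨_, hp, _, hq, hqa, hpD, haq, hA⟩
  have hsplit : ∀ {p q}, p ∈ B → q ∈ B₁ → q ≠ a₁ → coord F S.φ B₁ a₁ p ≠ 0 →
      Nz (S.N B p q) → (S.N B p f = 0 ∧ Nz (S.N B p e)) ∨ (S.N B p e = 0 ∧ Nz (S.N B p f)) :=
    fun hp hq hqa hpD hpq =>
      have haq := hDq hp hq hqa hpD hpq
      h.act.left_iff hE hF (h₁.mem.1 hq) (hqB hpD hq hqa hpq) haq hpq (hDA _ hp hpD)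
        (hDA' hp hq hqa hpD haq)
  refine (h₁.not_separated hB.2.1 (fun p hp hpD hpe => ?_) fun q hq hqa => ?_).elim
  · by_contra hpf
    exact hDA p hp hpD ⟨hB, hE.nz_of hB (mem_insert _ _) hpe, hF.nz_of hB (mem_insert _ _) hpf⟩
  · by_contra! hcon
    obtain ⟨⟨j, hj, hjD, hjq, hjf⟩, i, hi, hiD, hiq, hif⟩ := hcon
    have hjq := hnz hq hjq
    have hiq := hnz hq hiq
    have haq := hDq hi hq hqa hiD hiq
    have hjf := hF.nz_of hB (mem_insert _ _) hjf
    have hje := ((hsplit hj hq hqa hjD hjq).resolve_left fun hh => hjf.ne hh.1).1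
    have hif' := ((hsplit hi hq hqa hiD hiq).resolve_right fun hh => hh.2.1 hif).1
    exact h.act.quadrangle hE hF h' (fun hh => hc (hh.trans h.comp))
      (fun hh => hc (hh.trans (hcD (hB.1 hj) hjD))) (h₁.mem.1 hq) (hqB hiD hq hqa hiq) haq
      hiq hjq hif' hje (hDA' hi hq hqa hiD haq) (hDA' hj hq hqa hjD haq) hjf

end Sys

end

section

namespace Sys

variable {F G K α V₁ V₂ V₃ : Type*} [Field F] [Field G] [Field K] [AddCommGroup V₁]
    [Module F V₁] [AddCommGroup V₂] [Module G V₂] [AddCommGroup V₃] [Module K V₃]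
    {S : Sys F G K α V₁ V₂ V₃}

open Relation

variable {W C : Set α} {e f : α} {B B₀ B' : Set α} {a a₀ a' : α}

/-- Two one-column extensions are compatible if the ratios of active rows in distinct
components are lifted. -/
theorem Good.pair (hE : S.Good W (insert e W)) (hF : S.Good W (insert f W))
    (hs : ∀ B a B' a', S.Act W e f B a → S.Act W e f B' a' → ¬ S.Comp W a a' →
      Lam S.f (S.tau e f B a / S.tau e f B' a')) : S.Good W (insert e (insert f W)) := by
  have hef : ∀ B ∈ S.Bs W, ∀ x x', Lam S.f (S.cr B x x' e f) := by
    intro B hB x x'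
    rcases hE.zero_or_nz B hB x e (mem_insert _ _) with h1 | h1
    · rw [cr_eq_zero (Or.inl h1)]; exact lam_zero S.hf
    rcases hF.zero_or_nz B hB x f (mem_insert _ _) with h2 | h2
    · rw [cr_eq_zero (Or.inr (Or.inl h2))]; exact lam_zero S.hf
    rcases hE.zero_or_nz B hB x' e (mem_insert _ _) with h3 | h3
    · rw [cr_eq_zero (Or.inr (Or.inr (Or.inl h3)))]; exact lam_zero S.hf
    rcases hF.zero_or_nz B hB x' f (mem_insert _ _) with h4 | h4
    · rw [cr_eq_zero (Or.inr (Or.inr (Or.inr h4)))]; exact lam_zero S.hf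
    by_cases hc : S.Comp W x x'
    · obtain ⟨n, hn⟩ := hE.exists_con hB (mem_of_nz h1) (mem_of_nz h3) hc
      exact hE.pair_lam hF hB hn h1 h2 h3 h4
    · rw [← tau_div_tau]
      exact hs _ _ _ _ ⟨hB, h1, h2⟩ ⟨hB, h3, h4⟩ hc
  refine ⟨hE.X_subset, (subset_insert _ _).trans (subset_insert _ _), hE.frame, ?_, ?_⟩
  · rintro B hB x y (rfl | hy)
    · exact hE.zero_or_nz B hB x y (mem_insert _ _)
    · exact hF.zero_or_nz B hB x y hy
  · rintro B hB x x' y (rfl | hy) y' (rfl | hy')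
    · exact hE.lam B hB _ _ _ (mem_insert _ _) _ (mem_insert _ _)
    · rcases hy' with rfl | hy'
      · exact hef B hB _ _
      · exact hE.lam B hB _ _ _ (mem_insert _ _) _ (mem_insert_of_mem _ hy')
    · rcases hy with rfl | hy
      · rw [cr_swap_cols]
        exact (hef B hB _ _).inv S.hf
      · exact hE.lam B hB _ _ _ (mem_insert_of_mem _ hy) _ (mem_insert _ _)
    · exact hF.lam B hB _ _ _ hy _ hy'

/-- It suffices to compare active rows with a fixed one. -/
theorem lam_of_reference (hE : S.Good W (insert e W)) (hF : S.Good W (insert f W))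
    (h₀ : S.Act W e f B₀ a₀)
    (hs : ∀ B a, S.Act W e f B a → ¬ S.Comp W a a₀ →
      Lam S.f (S.tau e f B a / S.tau e f B₀ a₀))
    (h : S.Act W e f B a) (h' : S.Act W e f B' a') (hc : ¬ S.Comp W a a') :
    Lam S.f (S.tau e f B a / S.tau e f B' a') := by
  by_cases ha : S.Comp W a a₀
  · have ha' : ¬ S.Comp W a' a₀ := fun hh => hc (ha.trans hh.symm)
    have h1 := (hs _ _ h' ha').inv S.hf
    rw [inv_div] at h1
    exact Lifted.propagate hE hF h h' (fun hh => hc hh.symm) ⟨h₀, ha.symm, h1⟩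
  · have h1 := hs _ _ h ha
    by_cases ha' : S.Comp W a' a₀
    · have h2 := h1.inv S.hf
      rw [inv_div] at h2
      have h3 := Lifted.propagate hE hF h' h hc ⟨h₀, ha'.symm, h2⟩
      have h4 := h3.inv S.hf
      rwa [inv_div] at h4
    · have h2 := (hs _ _ h' ha').inv S.hf
      have h3 := h.tcons hE h' fun hh => hc hh.symm
      rw [inv_div] at h2
      rw [← tri_div_mul_div h₀.nz] at h3 ⊢
      exact h1.mul S.hf h2 h3 (h.nz.div h₀.nz) (h₀.nz.div h'.nz)

variable (S) in
/-- Replace the third configuration. -/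
def withPsi (ψ' : α → V₃) : Sys F G K α V₁ V₂ V₃ := { S with ψ := ψ' }

theorem withPsi_N {ψ' : α → V₃} {x y : α} (he : EqOn S.ψ ψ' B) (hy : S.ψ y = ψ' y) :
    (S.withPsi ψ').N B x y = S.N B x y := by
  simp only [N, withPsi]
  rw [coord_congr he hy]

theorem Good.withPsi {V : Set α} {ψ' : α → V₃} (h : S.Good V C) (he : EqOn S.ψ ψ' C) :
    (S.withPsi ψ').Good V C := by
  have hN : ∀ B ∈ S.Bs V, ∀ x, ∀ y ∈ C, (S.withPsi ψ').N B x y = S.N B x y :=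
    fun B hB x y hy => withPsi_N (he.mono (hB.1.trans h.subset)) (he hy)
  refine ⟨h.X_subset, h.subset, ?_, ?_, ?_⟩
  · intro B hB
    exact (h.frame B hB).congr (he.mono (hB.1.trans h.subset))
  · intro B hB x y hy
    rw [hN B hB x y hy]
    exact h.zero_or_nz B hB x y hy
  · intro B hB x x' y hy y' hy'
    have : (S.withPsi ψ').cr B x x' y y' = S.cr B x x' y y' := by
      simp only [cr]
      rw [hN B hB _ _ hy, hN B hB _ _ hy', hN B hB _ _ hy, hN B hB _ _ hy']
    rw [this]
    exact h.lam B hB x x' y hy y' hy'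

variable (S) in
/-- Scale the column `e` by the weights `u`. -/
theorem exists_scale [DecidableEq α] (hE : S.Good W (insert e W)) (heW : e ∉ W) (u : α → K)
    (hu : ∀ x y, S.Comp W x y → u x = u y) : ∃ v, ∀ B ∈ S.Bs W, ∀ x,
      (S.withPsi (Function.update S.ψ e v)).N B x e = (1, 1, u x) * S.N B x e := by
  have hX := hE.frame _ (X_mem_Bs hE.X_subset)
  obtain ⟨D, hD⟩ : ∃ D : V₃ →ₗ[K] V₃, ∀ x ∈ S.X, D (S.ψ x) = u x • S.ψ x := by
    refine ⟨hX.basis.constr K (fun x => u x • S.ψ x), fun x hx => ?_⟩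
    have := hX.basis.constr_basis K (fun x => u x • S.ψ x) ⟨x, hx⟩
    rwa [hX.basis_apply] at this
  have hDW : ∀ b ∈ W, D (S.ψ b) = u b • S.ψ b := by
    intro b hb
    have : D (S.ψ b) = (u b • (LinearMap.id : V₃ →ₗ[K] V₃)) (S.ψ b) := by
      refine hX.eval_congr fun x hx hxb => ?_
      have h1 : S.N S.X x b ≠ 0 := fun hh => hxb (congrArg (fun t => t.2.2) hh)
      have h2 := (hE.zero_or_nz _ (X_mem_Bs hE.X_subset) x b (hE.subset hb)).resolve_left h1
      rw [hD x hx, hu x b (EqvGen.rel _ _ ⟨hb, h2.1⟩)]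
      rfl
    exact this
  refine ⟨D (S.ψ e), fun B hB x => ?_⟩
  have hBψ := hE.frame B hB
  have heB : EqOn S.ψ (Function.update S.ψ e (D (S.ψ e))) B := fun y hy => by
    rw [Function.update_of_ne]; rintro rfl; exact heW (hB.1 hy)
  have key : coord K (Function.update S.ψ e (D (S.ψ e))) B x e =
      u x * coord K S.ψ B x e := by
    by_cases hx : x ∈ B
    · obtain ⟨r, hr⟩ := hBψ.exists_row x
      obtain ⟨r', hr'⟩ := (hBψ.congr heB).exists_row x
      have h1 : r = r' := hBψ.ext fun b hb => by
        rw [heB hb, hr', ← heB hb, hr, coord_congr heB (heB hb)]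
      have h2 : r.comp D = u x • r := hBψ.ext fun b hb => by
        rw [LinearMap.comp_apply, hDW b (hB.1 hb), map_smul, LinearMap.smul_apply, hr]
        by_cases hbx : x = b
        · rw [hbx]
        · rw [hBψ.coord_ne hb hbx]; simp
      have h3 := LinearMap.congr_fun h2 (S.ψ e)
      rw [LinearMap.comp_apply, LinearMap.smul_apply, smul_eq_mul, hr, h1] at h3
      rw [← hr', Function.update_self, h3]
    · rw [coord_of_notMem hx, coord_of_notMem hx, mul_zero]
  refine tri_ext ?_ ?_ key
  · simp [N, Sys.withPsi]
  · simp [N, Sys.withPsi]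

theorem Good.scale [DecidableEq α] (hE : S.Good W (insert e W)) (heW : e ∉ W) {u : α → K}
    (hu : ∀ x y, S.Comp W x y → u x = u y) (hu0 : ∀ x, u x ≠ 0) {v : V₃}
    (hv : ∀ B ∈ S.Bs W, ∀ x,
      (S.withPsi (Function.update S.ψ e v)).N B x e = (1, 1, u x) * S.N B x e) :
    (S.withPsi (Function.update S.ψ e v)).Good W (insert e W) := by
  have hne : ∀ y ∈ W, S.ψ y = Function.update S.ψ e v y := fun y hy => by
    rw [Function.update_of_ne]; rintro rfl; exact heW hy
  have hN : ∀ B ∈ S.Bs W, ∀ x, ∀ y ∈ W,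
      (S.withPsi (Function.update S.ψ e v)).N B x y = S.N B x y :=
    fun B hB x y hy => withPsi_N (fun b hb => hne b (hB.1 hb)) (hne y hy)
  have hU : ∀ x, Nz ((1, 1, u x) : F × G × K) := fun x => ⟨one_ne_zero, one_ne_zero, hu0 x⟩
  have hz : ∀ B ∈ S.Bs W, ∀ x, ∀ y ∈ insert e W,
      ((S.withPsi (Function.update S.ψ e v)).N B x y = 0 ∧ S.N B x y = 0) ∨
        Nz (S.N B x y) := by
    rintro B hB x y (rfl | hy)
    · rcases hE.zero_or_nz B hB x y (mem_insert _ _) with h | h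
      · left; rw [hv B hB, h]; simp
      · exact Or.inr h
    · rw [hN B hB x y hy]
      rcases hE.zero_or_nz B hB x y (mem_insert_of_mem _ hy) with h | h
      · exact Or.inl ⟨h, h⟩
      · exact Or.inr h
  refine ⟨hE.X_subset, hE.subset, ?_, ?_, ?_⟩
  · intro B hB
    exact (hE.frame B hB).congr fun b hb => hne b (hB.1 hb)
  · rintro B hB x y hy
    rcases hz B hB x y hy with h | h
    · exact Or.inl h.1
    · right
      rcases hy with rfl | hy
      · rw [hv B hB]; exact (hU x).mul h
      · rwa [hN B hB x y hy]
  · intro B hB x x' y hy y' hy'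
    rcases hz B hB x y hy with h1 | h1
    · rw [cr_eq_zero (Or.inl h1.1)]; exact lam_zero S.hf
    rcases hz B hB x y' hy' with h2 | h2
    · rw [cr_eq_zero (Or.inr (Or.inl h2.1))]; exact lam_zero S.hf
    rcases hz B hB x' y hy with h3 | h3
    · rw [cr_eq_zero (Or.inr (Or.inr (Or.inl h3.1)))]; exact lam_zero S.hf
    rcases hz B hB x' y' hy' with h4 | h4
    · rw [cr_eq_zero (Or.inr (Or.inr (Or.inr h4.1)))]; exact lam_zero S.hf
    have hlam := hE.lam B hB x x' y hy y' hy'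
    suffices h : (S.withPsi (Function.update S.ψ e v)).cr B x x' y y' = S.cr B x x' y y' by
      rw [h]; exact hlam
    have hxx : ∀ z ∈ W, Nz (S.N B x z) → Nz (S.N B x' z) → u x = u x' := fun z hz h h' =>
      hu _ _ ((comp_of_edge hE.X_subset hB ⟨hz, h.1⟩).trans
        (comp_of_edge hE.X_subset hB ⟨hz, h'.1⟩).symm)
    obtain ⟨p1, p2, p3⟩ := h1
    obtain ⟨q1, q2, q3⟩ := h2
    obtain ⟨r1, r2, r3⟩ := h3
    obtain ⟨s1, s2, s3⟩ := h4
    have i1 := hu0 x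
    have i2 := hu0 x'
    rcases hy with rfl | hy <;> rcases hy' with rfl | hy'
    · simp only [cr]
      rw [hv B hB, hv B hB]
      refine tri_ext ?_ ?_ ?_ <;> simp <;> field_simp
    · simp only [cr]
      rw [hv B hB, hv B hB, hN B hB _ _ hy', hN B hB _ _ hy', hxx y' hy' ⟨q1, q2, q3⟩ ⟨s1, s2, s3⟩]
      refine tri_ext ?_ ?_ ?_ <;> simp <;> field_simp
    · simp only [cr]
      rw [hv B hB, hv B hB, hN B hB _ _ hy, hN B hB _ _ hy, hxx y hy ⟨p1, p2, p3⟩ ⟨r1, r2, r3⟩]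
      refine tri_ext ?_ ?_ ?_ <;> simp <;> field_simp
    · simp only [cr]
      rw [hN B hB _ _ hy, hN B hB _ _ hy, hN B hB _ _ hy', hN B hB _ _ hy']

/-- Weights on the components making the active ratios lifted. -/
theorem exists_weights (hE : S.Good W (insert e W)) (h₀ : S.Act W e f B₀ a₀) :
    ∃ u : α → K, (∀ x y, S.Comp W x y → u x = u y) ∧ (∀ x, u x ≠ 0) ∧
      (∀ x, S.Comp W x a₀ → u x = 1) ∧
      ∀ B a, S.Act W e f B a → ¬ S.Comp W a a₀ → ∃ B' a', S.Act W e f B' a' ∧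
        S.Comp W a' a ∧ Lam S.f ((1, 1, u a') * (S.tau e f B' a' / S.tau e f B₀ a₀)) := by
  have key : ∀ c : Quot (S.Edge W S.X), ∃ w : K, w ≠ 0 ∧ (c = Quot.mk _ a₀ → w = 1) ∧
      ((∃ B a, S.Act W e f B a ∧ Quot.mk _ a = c) → c ≠ Quot.mk _ a₀ →
        ∃ B' a', S.Act W e f B' a' ∧ Quot.mk _ a' = c ∧
          Lam S.f ((1, 1, w) * (S.tau e f B' a' / S.tau e f B₀ a₀))) := by
    intro c
    by_cases hc : c = Quot.mk _ a₀
    · exact ⟨1, one_ne_zero, fun _ => rfl, fun _ h => absurd hc h⟩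
    by_cases h : ∃ B a, S.Act W e f B a ∧ Quot.mk _ a = c
    · obtain ⟨B, a, hA, rfl⟩ := h
      have hca : ¬ S.Comp W a₀ a := fun hh => hc (Quot.eqvGen_sound hh).symm
      have ht := hA.tcons hE h₀ hca
      have hnz := hA.nz.div h₀.nz
      generalize hs : S.tau e f B a / S.tau e f B₀ a₀ = s at ht hnz
      have h2 : S.f s.2.1 ≠ 0 := fun hh => hnz.2.1 (S.hf.eq_zero _ hh)
      refine ⟨S.f s.2.1 / s.2.2, div_ne_zero h2 hnz.2.2, fun h => absurd h hc,
        fun _ _ => ⟨B, a, hA, rfl, ?_⟩⟩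
      rw [hs]
      refine ⟨?_, ?_⟩
      · simpa [TCons] using ht
      · simp [hnz.2.2]
    · exact ⟨1, one_ne_zero, fun _ => rfl, fun h' => absurd h' h⟩
  choose w hw0 hw1 hw using key
  refine ⟨fun x => w (Quot.mk _ x), fun x y h => ?_, fun x => hw0 _, fun x h => ?_,
    fun B a hA hc => ?_⟩
  · exact congrArg w (Quot.eqvGen_sound h)
  · exact hw1 _ (Quot.eqvGen_sound h)
  · obtain ⟨B', a', h1, h2, h3⟩ := hw (Quot.mk _ a) ⟨B, a, hA, rfl⟩
      fun h => hc (Quot.eqvGen_exact h)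
    refine ⟨B', a', h1, Quot.eqvGen_exact h2, ?_⟩
    have : w (Quot.mk _ a') = w (Quot.mk _ a) := congrArg w h2
    simpa only [this] using h3

/-- Two one-column extensions can be made compatible by changing one of the columns. -/
theorem Good.exists_pair [DecidableEq α] (hE : S.Good W (insert e W)) (hF : S.Good W (insert f W))
    (heW : e ∉ W) (hef : e ≠ f) :
    ∃ v, (S.withPsi (Function.update S.ψ e v)).Good W (insert e (insert f W)) := by
  by_cases hact : ∃ B₀ a₀, S.Act W e f B₀ a₀
  · obtain ⟨B₀, a₀, h₀⟩ := hact
    obtain ⟨u, hu, hu0, hu1, hs⟩ := exists_weights hE h₀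
    obtain ⟨v, hv⟩ := S.exists_scale hE heW u hu
    refine ⟨v, ?_⟩
    set S' := S.withPsi (Function.update S.ψ e v) with hS'
    have hE' : S'.Good W (insert e W) := hE.scale heW hu hu0 hv
    have hne : ∀ y ∈ insert f W, S.ψ y = Function.update S.ψ e v y := fun y hy => by
      rw [Function.update_of_ne]
      rintro rfl
      exact hy.elim hef heW
    have hF' : S'.Good W (insert f W) := hF.withPsi hne
    have hNf : ∀ B ∈ S.Bs W, ∀ x, S'.N B x f = S.N B x f := fun B hB x =>
      withPsi_N (fun b hb => hne b (mem_insert_of_mem _ (hB.1 hb))) (hne f (mem_insert _ _))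
    have hU : ∀ x, Nz ((1, 1, u x) : F × G × K) := fun x => ⟨one_ne_zero, one_ne_zero, hu0 x⟩
    have hA : ∀ B a, S.Act W e f B a → S'.Act W e f B a := fun B a h =>
      ⟨h.mem, by rw [hv B h.mem]; exact (hU a).mul h.left, by rw [hNf B h.mem]; exact h.right⟩
    have hA' : ∀ B a, S'.Act W e f B a → S.Act W e f B a := fun B a h =>
      ⟨h.mem, Nz.of_mul_right (by rw [← hv B h.mem]; exact h.left),
        by rw [← hNf B h.mem]; exact h.right⟩
    have htau : ∀ B a, S.Act W e f B a → S'.tau e f B a = (1, 1, u a) * S.tau e f B a := by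
      intro B a h
      rw [tau, tau, hv B h.mem, hNf B h.mem, mul_div_assoc]
    have htau₀ : S'.tau e f B₀ a₀ = S.tau e f B₀ a₀ := by
      rw [htau _ _ h₀, hu1 a₀ (EqvGen.refl _)]
      exact one_mul _
    refine hE'.pair hF' fun B a B' a' h h' hc =>
      lam_of_reference hE' hF' (hA _ _ h₀) (fun B a h hc => ?_) h h' hc
    obtain ⟨B', a', h1, h2, h3⟩ := hs B a (hA' _ _ h) hc
    refine Lifted.propagate hE' hF' h (hA _ _ h₀) (fun hh => hc (Comp.symm hh))
      ⟨hA _ _ h1, h2, ?_⟩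
    rw [htau₀, htau _ _ h1, mul_div_assoc]
    exact h3
  · refine ⟨S.ψ e, ?_⟩
    rw [Function.update_eq_self]
    exact hE.pair hF fun B a _ _ h => absurd ⟨B, a, h⟩ hact

end Sys

end

section

theorem IsFrame.finite_coord {k V α : Type*} [Field k] [AddCommGroup V] [Module k V]
    {φ : α → V} {B : Set α} (h : IsFrame k φ B) (y : α) : {x | coord k φ B x y ≠ 0}.Finite := by
  refine ((h.basis.repr (φ y)).support.finite_toSet.image Subtype.val).subset ?_
  intro x hx
  have hxB : x ∈ B := mem_of_coord_ne hx
  refine ⟨⟨x, hxB⟩, ?_, rfl⟩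
  simpa [coord, h, hxB] using hx

namespace Sys

variable {F G K α V₁ V₂ V₃ : Type*} [Field F] [Field G] [Field K] [AddCommGroup V₁]
    [Module F V₁] [AddCommGroup V₂] [Module G V₂] [AddCommGroup V₃] [Module K V₃]
    {S : Sys F G K α V₁ V₂ V₃}

open Relation

variable {W C Y Z : Set α} {e f : α}

theorem Good.of_frame (hX : IsFrame K S.ψ S.X) (hC : S.X ⊆ C)
    (hCX : ∀ y ∈ C, ∀ y' ∈ C, y = y' ∨ y ∈ S.X ∨ y' ∈ S.X)
    (hz : ∀ x, ∀ y ∈ C, S.N S.X x y = 0 ∨ Nz (S.N S.X x y)) : S.Good S.X C := by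
  have hB : ∀ B ∈ S.Bs S.X, B = S.X := fun B hB => hB.2.1.eq_of_subset S.hX hB.1
  have hR : S.Fr S.X := ⟨S.hX, (S.frame_iff _).1 S.hX, hX⟩
  have heq : ∀ y ∈ S.X, ∀ x, Nz (S.N S.X x y) → x = y := fun y hy x hxy => by
    by_contra hne
    exact hxy.ne (hR.N_ne hy hne)
  refine ⟨subset_rfl, hC, fun B h => hB B h ▸ hX, fun B h => hB B h ▸ hz, ?_⟩
  intro B h x x' y hy y' hy'
  rw [hB B h]
  rcases hz x y hy with h1 | h1
  · rw [cr_eq_zero (Or.inl h1)]; exact lam_zero S.hf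
  rcases hz x y' hy' with h2 | h2
  · rw [cr_eq_zero (Or.inr (Or.inl h2))]; exact lam_zero S.hf
  rcases hz x' y hy with h3 | h3
  · rw [cr_eq_zero (Or.inr (Or.inr (Or.inl h3)))]; exact lam_zero S.hf
  rcases hz x' y' hy' with h4 | h4
  · rw [cr_eq_zero (Or.inr (Or.inr (Or.inr h4)))]; exact lam_zero S.hf
  have hone : S.cr S.X x x' y y' = 1 := by
    have hcase : y = y' ∨ x = x' := by
      rcases hCX y hy y' hy' with h | h | h
      · exact Or.inl h
      · exact Or.inr ((heq y h x h1).trans (heq y h x' h3).symm)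
      · exact Or.inr ((heq y' h x h2).trans (heq y' h x' h4).symm)
    rcases hcase with rfl | rfl
    · exact (h1.mul h4).div_self
    · rw [cr, mul_comm (S.N S.X x y')]
      exact (h1.mul h2).div_self
  rw [hone]
  exact lam_one S.hf

theorem Good.base (hX : IsFrame K S.ψ S.X) : S.Good S.X S.X := by
  have hR : S.Fr S.X := ⟨S.hX, (S.frame_iff _).1 S.hX, hX⟩
  refine Good.of_frame hX subset_rfl (fun y hy _ _ => Or.inr (Or.inl hy)) fun x y hy => ?_
  by_cases hxy : x = y
  · subst hxy; rw [hR.N_self hy]; exact Or.inr nz_one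
  · exact Or.inl (hR.N_ne hy hxy)

omit [AddCommGroup V₃] in
theorem eqOn_update [DecidableEq α] {ψ : α → V₃} (he : e ∉ Y) (v : V₃) :
    EqOn ψ (Function.update ψ e v) Y := fun y hy => by
  rw [Function.update_of_ne]
  rintro rfl
  exact he hy

theorem Good.base_insert [DecidableEq α] (hX : IsFrame K S.ψ S.X) (he : e ∉ S.X) :
    ∃ v, (S.withPsi (Function.update S.ψ e v)).Good S.X (insert e S.X) := by
  have hfin := S.hX.finite_coord e
  refine ⟨∑ x ∈ hfin.toFinset, S.ψ x, ?_⟩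
  set v := ∑ x ∈ hfin.toFinset, S.ψ x with hv
  have hE := eqOn_update (ψ := S.ψ) he v
  have hX' : IsFrame K (S.withPsi (Function.update S.ψ e v)).ψ S.X := hX.congr hE
  refine Good.of_frame (S := S.withPsi (Function.update S.ψ e v)) hX' (subset_insert _ _) ?_ ?_
  · rintro y (rfl | hy) y' (rfl | hy')
    · exact Or.inl rfl
    · exact Or.inr (Or.inr hy')
    · exact Or.inr (Or.inl hy)
    · exact Or.inr (Or.inl hy)
  · rintro x y (rfl | hy)
    · have hc : coord K (Function.update S.ψ y v) S.X x y =
          ∑ z ∈ hfin.toFinset, coord K S.ψ S.X x z := by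
        obtain ⟨r, hr⟩ := hX.exists_row x
        obtain ⟨r', hr'⟩ := hX'.exists_row x
        have h1 : r = r' := hX.ext fun b hb => by
          rw [hE hb]
          refine Eq.trans ?_ (hr' b).symm
          rw [← hE hb, hr]
          exact coord_congr hE (hE hb) x
        refine (hr' y).symm.trans ?_
        rw [← h1]
        simp [Sys.withPsi, hv, hr]
      by_cases hxy : coord F S.φ S.X x y = 0
      · left
        refine tri_ext hxy ((coord_eq_zero_iff S.hX x y).1 hxy) ?_
        refine hc.trans (Finset.sum_eq_zero fun z hz => ?_)
        have hz' : coord F S.φ S.X z y ≠ 0 := by simpa using hz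
        refine hX.coord_ne (mem_of_coord_ne hz') ?_
        rintro rfl
        exact hz' hxy
      · right
        refine ⟨hxy, fun h => hxy ((coord_eq_zero_iff S.hX x y).2 h), ?_⟩
        have h1 : ∑ z ∈ hfin.toFinset, coord K S.ψ S.X x z = 1 := by
          rw [Finset.sum_eq_single x]
          · exact hX.coord_self (mem_of_coord_ne hxy)
          · intro z hz hzx
            have hz' : coord F S.φ S.X z y ≠ 0 := by simpa using hz
            exact hX.coord_ne (mem_of_coord_ne hz') (Ne.symm hzx)
          · intro h
            exact absurd (by simpa using hxy) h
        exact (hc.trans h1).trans_ne one_ne_zero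
    · exact (Good.base (S := S.withPsi (Function.update S.ψ e v)) hX').zero_or_nz S.X
        (X_mem_Bs subset_rfl) x y hy

theorem Good.exists_finite_ext [DecidableEq α] (h : S.Good Y Y) (he : e ∉ Y) (hZ : Z.Finite)
    (hZY : Z ⊆ Y) : ∃ v, (S.withPsi (Function.update S.ψ e v)).Good (S.X ∪ Z)
      (insert e (S.X ∪ Z)) := by
  induction Z, hZ using Set.Finite.induction_on with
  | empty =>
    rw [union_empty]
    exact Good.base_insert (h.frame _ (X_mem_Bs h.X_subset)) fun hh => he (h.X_subset hh)
  | @insert f Z _ _ ih =>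
    obtain ⟨v, hv⟩ := ih fun z hz => hZY (Or.inr hz)
    have hfY : f ∈ Y := hZY (Or.inl rfl)
    have hWY : S.X ∪ Z ⊆ Y := union_subset h.X_subset fun z hz => hZY (Or.inr hz)
    have hfW : insert f (S.X ∪ Z) ⊆ Y := insert_subset hfY hWY
    have hF := (h.mono subset_union_left hWY hfW (subset_insert _ _)).withPsi
      (eqOn_update (fun hh => he (hfW hh)) v)
    obtain ⟨v', hv'⟩ := hv.exists_pair hF (fun hh => he (hWY hh))
      (fun hef => he (hef ▸ hfY))
    refine ⟨v', ?_⟩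
    have : (S.withPsi (Function.update S.ψ e v)).withPsi
        (Function.update (S.withPsi (Function.update S.ψ e v)).ψ e v') =
        S.withPsi (Function.update S.ψ e v') := by
      simp [Sys.withPsi]
    rw [this] at hv'
    rw [union_insert]
    exact hv'.transfer (subset_insert _ _) (insert_comm _ _ _).subset

theorem Comp.mono {W' : Set α} (hW : W ⊆ W') {x y : α} (h : S.Comp W x y) : S.Comp W' x y :=
  eqvGen_of_le (fun _ _ h => EqvGen.rel _ _ ⟨hW h.1, h.2⟩) h

theorem Act.exists_comp {B : Set α} {a : α} (hG : S.Good W C) (h : S.Act W e f B a) :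
    ∃ r, coord F S.φ S.X r e ≠ 0 ∧ S.Comp W a r := by
  obtain ⟨l, hl⟩ := h.mem.2.1.exists_row a
  by_contra! hc
  have : l (S.φ e) = (0 : V₁ →ₗ[F] F) (S.φ e) := by
    refine S.hX.eval_congr fun x hx hxe => ?_
    rw [hl, LinearMap.zero_apply]
    by_contra h0
    exact hc x hxe (comp_of_edge hG.X_subset h.mem ⟨hG.X_subset hx, h0⟩)
  rw [hl, LinearMap.zero_apply] at this
  exact h.left.1 this

/-- Finitely many columns already determine the components meeting the support of `e`. -/
theorem exists_finite_comp (Y : Set α) (e : α) : ∃ Z₀ : Set α, Z₀.Finite ∧ Z₀ ⊆ Y ∧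
    ∀ r r', coord F S.φ S.X r e ≠ 0 → coord F S.φ S.X r' e ≠ 0 → ∀ Z : Set α, Z.Finite →
      Z ⊆ Y → S.Comp (S.X ∪ Z) r r' → S.Comp (S.X ∪ Z₀) r r' := by
  have key : ∀ p : α × α, ∃ Z₀ : Set α, Z₀.Finite ∧ Z₀ ⊆ Y ∧ ∀ Z : Set α, Z.Finite →
      Z ⊆ Y → S.Comp (S.X ∪ Z) p.1 p.2 → S.Comp (S.X ∪ Z₀) p.1 p.2 := by
    intro p
    by_cases h : ∃ Z : Set α, Z.Finite ∧ Z ⊆ Y ∧ S.Comp (S.X ∪ Z) p.1 p.2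
    · obtain ⟨Z, h1, h2, h3⟩ := h
      exact ⟨Z, h1, h2, fun _ _ _ _ => h3⟩
    · exact ⟨∅, finite_empty, empty_subset _, fun Z h1 h2 h3 => absurd ⟨Z, h1, h2, h3⟩ h⟩
  choose Z₀ h1 h2 h3 using key
  have hfin := S.hX.finite_coord e
  refine ⟨⋃ p ∈ {x | coord F S.φ S.X x e ≠ 0} ×ˢ {x | coord F S.φ S.X x e ≠ 0}, Z₀ p,
    (hfin.prod hfin).biUnion fun p _ => h1 p, iUnion₂_subset fun p _ => h2 p, ?_⟩
  intro r r' hr hr' Z hZ hZY hc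
  refine (h3 (r, r') Z hZ hZY hc).mono (union_subset_union_right _ ?_)
  exact subset_biUnion_of_mem (u := Z₀) (show (r, r') ∈ _ from ⟨hr, hr'⟩)

/-- A lifted configuration extends by one element. -/
theorem Good.exists_ext [DecidableEq α] (h : S.Good Y Y) (he : e ∉ Y) :
    ∃ v, (S.withPsi (Function.update S.ψ e v)).Good (insert e Y) (insert e Y) := by
  obtain ⟨Z₀, hZ₀, hZ₀Y, hcomp⟩ := exists_finite_comp (S := S) Y e
  obtain ⟨v, hv⟩ := h.exists_finite_ext he hZ₀ hZ₀Y
  refine ⟨v, ?_⟩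
  set S' := S.withPsi (Function.update S.ψ e v) with hS'
  have hY : S'.Good Y Y := h.withPsi (eqOn_update he v)
  have hfin : ∀ Z : Set α, Z.Finite → Z ⊆ Y →
      S'.Good (S.X ∪ (Z₀ ∪ Z)) (insert e (S.X ∪ (Z₀ ∪ Z))) := by
    intro Z hZ hZY
    induction Z, hZ using Set.Finite.induction_on with
    | empty => rwa [union_empty]
    | @insert f Z _ hZ ih =>
      have hE := ih fun z hz => hZY (Or.inr hz)
      have hfY : f ∈ Y := hZY (Or.inl rfl)
      have hZZ : Z₀ ∪ Z ⊆ Y := union_subset hZ₀Y fun z hz => hZY (Or.inr hz)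
      have hWY : S.X ∪ (Z₀ ∪ Z) ⊆ Y := union_subset h.X_subset hZZ
      have hfW : insert f (S.X ∪ (Z₀ ∪ Z)) ⊆ Y := insert_subset hfY hWY
      have hF : S'.Good (S.X ∪ (Z₀ ∪ Z)) (insert f (S.X ∪ (Z₀ ∪ Z))) :=
        hY.mono subset_union_left hWY hfW (subset_insert _ _)
      have hfeq : insert f (S.X ∪ (Z₀ ∪ Z)) = S.X ∪ insert f (Z₀ ∪ Z) := union_insert.symm
      have hpair := hE.pair hF fun B a B' a' hA hA' hc => by
        obtain ⟨r, hr, har⟩ := hA.exists_comp hE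
        obtain ⟨r', hr', har'⟩ := hA'.exists_comp hE
        have hX' : S'.X ⊆ insert f (S.X ∪ (Z₀ ∪ Z)) :=
          hE.X_subset.trans (subset_insert _ _)
        have hsub := Bs_mono (S := S') (subset_insert f (S.X ∪ (Z₀ ∪ Z)))
        have haf := comp_of_edge hX' (hsub hA.mem) ⟨mem_insert _ _, hA.right.1⟩
        have haf' := comp_of_edge hX' (hsub hA'.mem) ⟨mem_insert _ _, hA'.right.1⟩
        have hrr : S'.Comp (S.X ∪ insert f (Z₀ ∪ Z)) r r' := by
          rw [← hfeq]
          exact (har.mono (subset_insert _ _)).symm.trans (haf.trans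
            (haf'.symm.trans (har'.mono (subset_insert _ _))))
        have hfinZ : (insert f (Z₀ ∪ Z)).Finite := (hZ₀.union hZ).insert f
        have hrr' : S'.Comp (S.X ∪ Z₀) r r' :=
          hcomp r r' hr hr' _ hfinZ (insert_subset hfY hZZ) hrr
        have hrr'' : S'.Comp (S.X ∪ (Z₀ ∪ Z)) r r' :=
          hrr'.mono (union_subset_union_right _ subset_union_left)
        exact absurd (har.trans (hrr''.trans har'.symm)) hc
      rw [union_insert, union_insert]
      exact hpair.transfer (subset_insert _ _) (insert_comm _ _ _).subset
  have hBs : ∀ B ∈ S.Bs Y, ∀ Z : Set α, B ∈ S.Bs (S.X ∪ (Z₀ ∪ (B \ S.X ∪ Z))) := by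
    intro B hB Z
    refine ⟨fun x hx => ?_, hB.2⟩
    by_cases hxX : x ∈ S.X
    · exact Or.inl hxX
    · exact Or.inr (Or.inr (Or.inl ⟨hx, hxX⟩))
  have hYe : S'.Good Y (insert e Y) := by
    refine ⟨h.X_subset, subset_insert _ _, hY.frame, ?_, ?_⟩
    · rintro B hB x y (rfl | hy)
      · exact (hfin (B \ S.X ∪ ∅) (by rw [union_empty]; exact hB.2.2.1)
          (by simpa using sdiff_subset.trans hB.1)).zero_or_nz B (hBs B hB ∅) x y
          (mem_insert _ _)
      · exact hY.zero_or_nz B hB x y hy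
    · intro B hB x x' y hy y' hy'
      refine (hfin (B \ S.X ∪ ({y, y'} ∩ Y)) (hB.2.2.1.union ((toFinite _).inter_of_left _))
        (union_subset (sdiff_subset.trans hB.1) inter_subset_right)).lam B (hBs B hB _)
        x x' y ?_ y' ?_
      · rcases hy with rfl | hy
        · exact mem_insert _ _
        · exact Or.inr (Or.inr (Or.inr (Or.inr ⟨Or.inl rfl, hy⟩)))
      · rcases hy' with rfl | hy'
        · exact mem_insert _ _
        · exact Or.inr (Or.inr (Or.inr (Or.inr ⟨Or.inr rfl, hy'⟩)))
  exact hYe.transfer (g := e) (h := e) subset_rfl (by simp)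

end Sys

end

section

namespace Sys

variable {F G K α V₁ V₂ V₃ : Type*} [Field F] [Field G] [Field K] [AddCommGroup V₁]
    [Module F V₁] [AddCommGroup V₂] [Module G V₂] [AddCommGroup V₃] [Module K V₃]
    {S : Sys F G K α V₁ V₂ V₃}

theorem good_sUnion {D : Set (Set α)} (hne : D.Nonempty) (hD : IsChain (· ⊆ ·) D)
    (h : ∀ Y ∈ D, S.Good Y Y) : S.Good (⋃₀ D) (⋃₀ D) := by
  have key : ∀ Z : Set α, Z.Finite → Z ⊆ ⋃₀ D → ∃ Y ∈ D, Z ⊆ Y := fun Z hZ hZD =>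
    hD.directedOn.exists_mem_subset_of_finite_of_subset_sUnion hne hZ hZD
  have key' : ∀ B ∈ S.Bs (⋃₀ D), ∀ y ∈ ⋃₀ D, ∀ y' ∈ ⋃₀ D,
      ∃ Y ∈ D, B ∈ S.Bs Y ∧ y ∈ Y ∧ y' ∈ Y := by
    intro B hB y hy y' hy'
    obtain ⟨Y, hY, hZ⟩ := key (insert y (insert y' (B \ S.X))) ((hB.2.2.1.insert _).insert _)
      (insert_subset hy (insert_subset hy' (sdiff_subset.trans hB.1)))
    refine ⟨Y, hY, ⟨fun b hb => ?_, hB.2⟩, hZ (by simp), hZ (by simp)⟩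
    by_cases hbX : b ∈ S.X
    · exact (h Y hY).X_subset hbX
    · exact hZ (Or.inr (Or.inr ⟨hb, hbX⟩))
  obtain ⟨Y₀, hY₀⟩ := hne
  refine ⟨fun x hx => ⟨Y₀, hY₀, (h Y₀ hY₀).X_subset hx⟩, subset_rfl, ?_, ?_, ?_⟩
  · intro B hB
    by_cases hU : (⋃₀ D).Nonempty
    · obtain ⟨y, hy⟩ := hU
      obtain ⟨Y, hY, hB', -⟩ := key' B hB y hy y hy
      exact (h Y hY).frame B hB'
    · rw [not_nonempty_iff_eq_empty] at hU
      refine (h Y₀ hY₀).frame B ⟨?_, hB.2⟩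
      exact hB.1.trans (hU ▸ empty_subset _)
  · intro B hB x y hy
    obtain ⟨Y, hY, hB', hy', -⟩ := key' B hB y hy y hy
    exact (h Y hY).zero_or_nz B hB' x y hy'
  · intro B hB x x' y hy y' hy'
    obtain ⟨Y, hY, hB', h1, h2⟩ := key' B hB y hy y' hy'
    exact (h Y hY).lam B hB' x x' y h1 y' h2

/-- The third configuration can be changed outside `X` so that it lifts the first two
everywhere. -/
theorem exists_good_univ (hX : IsFrame K S.ψ S.X) :
    ∃ ψ', (S.withPsi ψ').Good univ univ := by
  classical
  let P := {p : Set α × (α → V₃) // (S.withPsi p.2).Good p.1 p.1}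
  let r : P → P → Prop := fun p q => p.1.1 ⊆ q.1.1 ∧ EqOn p.1.2 q.1.2 p.1.1
  have htrans : ∀ {a b c : P}, r a b → r b c → r a c := fun {a b c} hab hbc =>
    ⟨hab.1.trans hbc.1, hab.2.trans (hbc.2.mono hab.1)⟩
  have hub : ∀ c : Set P, IsChain r c → ∃ ub, ∀ a ∈ c, r a ub := by
    intro c hc
    rcases c.eq_empty_or_nonempty with rfl | hne
    · exact ⟨⟨(S.X, S.ψ), Good.base hX⟩, by simp⟩
    let D : Set (Set α) := (fun p : P => p.1.1) '' c
    have hD : IsChain (· ⊆ ·) D := by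
      rintro _ ⟨p, hp, rfl⟩ _ ⟨q, hq, rfl⟩ hpq
      rcases hc hp hq (fun h => hpq (h ▸ rfl)) with h | h
      · exact Or.inl h.1
      · exact Or.inr h.1
    let Ψ : α → V₃ := fun y => if h : ∃ p ∈ c, y ∈ p.1.1 then h.choose.1.2 y else 0
    have hΨ : ∀ p ∈ c, EqOn p.1.2 Ψ p.1.1 := by
      intro p hp y hy
      have h : ∃ p ∈ c, y ∈ p.1.1 := ⟨p, hp, hy⟩
      simp only [Ψ, dif_pos h]
      obtain ⟨h1, h2⟩ := h.choose_spec
      by_cases hpq : p = h.choose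
      · rw [← hpq]
      rcases hc hp h1 hpq with h' | h'
      · exact h'.2 hy
      · exact (h'.2 h2).symm
    refine ⟨⟨(⋃₀ D, Ψ), ?_⟩, fun p hp => ⟨subset_sUnion_of_mem ⟨p, hp, rfl⟩, hΨ p hp⟩⟩
    refine good_sUnion (hne.image _) hD ?_
    rintro _ ⟨p, hp, rfl⟩
    exact p.2.withPsi (hΨ p hp)
  obtain ⟨m, hm⟩ := exists_maximal_of_chains_bounded hub htrans
  have hY : m.1.1 = univ := by
    refine eq_univ_of_forall fun e => ?_
    by_contra he
    obtain ⟨v, hv⟩ := m.2.exists_ext he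
    exact he ((hm ⟨(_, _), hv⟩ ⟨subset_insert _ _, eqOn_update he v⟩).1 (mem_insert _ _))
  refine ⟨m.1.2, ?_⟩
  have := m.2
  rwa [hY] at this

end Sys

theorem IsFrame.not_linearIndepOn {k V α : Type*} [Field k] [AddCommGroup V] [Module k V]
    {φ : α → V} {B I : Set α} {y : α} (h : IsFrame k φ B) (hy : y ∈ I) (hyB : y ∉ B)
    (h0 : ∀ x ∈ B, x ∉ I → coord k φ B x y = 0) : ¬ LinearIndepOn k φ I := by
  intro hI
  refine hI.notMem_span hy ?_
  rw [← Submodule.Quotient.mk_eq_zero, ← Submodule.mkQ_apply,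
    ← LinearMap.zero_apply (σ₁₂ := RingHom.id k) (φ y)]
  refine h.eval_congr fun x hx hxy => ?_
  have hxI : x ∈ I := by
    by_contra hxI
    exact hxy (h0 x hx hxI)
  rw [LinearMap.zero_apply, Submodule.mkQ_apply, Submodule.Quotient.mk_eq_zero]
  exact Submodule.subset_span ⟨x, ⟨hxI, fun hh => hyB (hh ▸ hx)⟩, rfl⟩

namespace Sys

variable {F G K α V₁ V₂ V₃ : Type*} [Field F] [Field G] [Field K] [AddCommGroup V₁]
    [Module F V₁] [AddCommGroup V₂] [Module G V₂] [AddCommGroup V₃] [Module K V₃]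
    {S : Sys F G K α V₁ V₂ V₃}

theorem Good.linearIndepOn_iff_of_finite (h : S.Good univ univ) {I : Set α} (hI : I.Finite) :
    LinearIndepOn F S.φ I ↔ LinearIndepOn K S.ψ I := by
  obtain ⟨B, hB, hmax⟩ : ∃ B ∈ S.Bs univ, ∀ B' ∈ S.Bs univ,
      (B' ∩ I).ncard ≤ (B ∩ I).ncard := by
    have hfin : ((fun B => (B ∩ I).ncard) '' S.Bs univ).Finite := by
      refine (Set.finite_Iic I.ncard).subset ?_
      rintro _ ⟨B, -, rfl⟩
      exact ncard_le_ncard inter_subset_right hI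
    obtain ⟨_, ⟨B, hB, rfl⟩, hmax⟩ := hfin.exists_maximalFor id _
      ⟨_, S.X, X_mem_Bs (subset_univ _), rfl⟩
    exact ⟨B, hB, fun B' hB' => not_lt.1 fun hlt => hlt.not_ge (hmax ⟨B', hB', rfl⟩ hlt.le)⟩
  have h0 : ∀ y ∈ I, y ∉ B → ∀ x ∈ B, x ∉ I → coord F S.φ B x y = 0 := by
    intro y hy hyB x hx hxI
    by_contra hxy
    refine (hmax _ (exch_mem_Bs hB (mem_univ y) hxy)).not_gt ?_
    refine ncard_lt_ncard ⟨?_, ?_⟩ (hI.subset inter_subset_right)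
    · rintro z ⟨hz, hzI⟩
      exact ⟨Or.inr ⟨hz, fun hzx => hxI (hzx ▸ hzI)⟩, hzI⟩
    · exact fun hsub => hyB (hsub ⟨Or.inl rfl, hy⟩).1
  have hF := hB.2.1
  have hK := h.frame B hB
  by_cases hIB : I ⊆ B
  · exact ⟨fun _ => hK.indep.mono hIB, fun _ => hF.indep.mono hIB⟩
  · obtain ⟨y, hy, hyB⟩ := not_subset.1 hIB
    refine iff_of_false (hF.not_linearIndepOn hy hyB (h0 y hy hyB))
      (hK.not_linearIndepOn hy hyB fun x hx hxI => ?_)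
    rcases h.zero_or_nz B hB x y (mem_univ y) with hz | hz
    · exact congrArg (fun t => t.2.2) hz
    · exact absurd (h0 y hy hyB x hx hxI) hz.1

theorem Good.linearIndepOn_iff (h : S.Good univ univ) (I : Set α) :
    LinearIndepOn F S.φ I ↔ LinearIndepOn K S.ψ I :=
  ⟨fun hI => linearIndepOn_of_finite I fun _ ht hfin =>
      (h.linearIndepOn_iff_of_finite hfin).1 (hI.mono ht),
    fun hI => linearIndepOn_of_finite I fun _ ht hfin =>
      (h.linearIndepOn_iff_of_finite hfin).2 (hI.mono ht)⟩

end Sys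

end

section

section Representations

theorem linearIndepOn_congr_equiv {α k K V : Type*} [Field k] [Field K] [AddCommGroup V]
    [Module k V] [Module K V] (e : k ≃+* K) (he : ∀ (c : k) (x : V), e c • x = c • x)
    (φ : α → V) (I : Set α) : LinearIndepOn k φ I ↔ LinearIndepOn K φ I := by
  constructor
  · intro h
    refine LinearIndependent.map_of_injective_injective h e.symm.toRingHom (AddMonoidHom.id V)
      (fun r hr => by simpa using hr) (fun m hm => hm) fun r m => ?_
    have := he (e.symm r) m
    simpa using this.symm
  · intro h
    exact LinearIndependent.map_of_injective_injective h e.toRingHom (AddMonoidHom.id V)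
      (fun r hr => by simpa using hr) (fun m hm => hm) fun r m => he r m

theorem exists_linearIndepOn_iff_of_ringEquiv {α : Type u} {k : Type v} {K V : Type*} [Field k]
    [Field K] [AddCommGroup V] [Module K V] (e : k ≃+* K) (φ : α → V) :
    ∃ (W : Type (max u v)) (_ : AddCommGroup W) (_ : Module k W) (φ' : α → W),
      ∀ I, LinearIndepOn k φ' I ↔ LinearIndepOn K φ I := by
  let _ : Module k V := Module.compHom V (e : k →+* K)
  let l : (α →₀ k) →ₗ[k] V := Finsupp.linearCombination k φ
  let j : ((α →₀ k) ⧸ LinearMap.ker l) →ₗ[k] V := (LinearMap.ker l).liftQ l le_rfl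
  have hj : Function.Injective j := LinearMap.ker_eq_bot.1 (Submodule.ker_liftQ_eq_bot _ _ _ le_rfl)
  refine ⟨(α →₀ k) ⧸ LinearMap.ker l, inferInstance, inferInstance,
    fun x => Submodule.Quotient.mk (Finsupp.single x 1), fun I => ?_⟩
  rw [← linearIndepOn_congr_equiv e (fun _ _ => rfl), ← j.linearIndepOn_iff_of_injOn hj.injOn]
  have : j ∘ (fun x => Submodule.Quotient.mk (Finsupp.single x 1)) = φ := by
    ext x
    simp [j, l, Submodule.liftQ_apply]
  rw [this]

theorem Representable.of_ringEquiv {α : Type u} {M : Matroid α} {k : Type v} {K : Type w}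
    [Field k] [Field K] (e : k ≃+* K) (h : Representable M K) : Representable M k := by
  obtain ⟨V, _, _, φ, hφ⟩ := h
  obtain ⟨W, _, _, φ', hφ'⟩ := exists_linearIndepOn_iff_of_ringEquiv e φ
  exact ⟨W, inferInstance, inferInstance, φ', fun I hI => (hφ I hI).trans (hφ' I).symm⟩

theorem Representable.exists_indep_iff {α : Type u} {M : Matroid α} {k : Type v} [Field k]
    (h : Representable M k) : ∃ (V : Type (max u v)) (_ : AddCommGroup V) (_ : Module k V)
      (φ : α → V), ∀ I, M.Indep I ↔ LinearIndepOn k φ I := by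
  classical
  obtain ⟨V, _, _, φ, hφ⟩ := h
  refine ⟨V, inferInstance, inferInstance, fun x => if x ∈ M.E then φ x else 0, fun I => ?_⟩
  by_cases hI : I ⊆ M.E
  · rw [hφ I hI]
    exact linearIndepOn_congr fun x hx => (if_pos (hI hx)).symm
  · obtain ⟨x, hx, hxE⟩ := not_subset.1 hI
    exact iff_of_false (fun h => hI h.subset_ground)
      fun h => h.ne_zero hx (if_neg hxE)

theorem isFrame_iff {α k V : Type*} [Field k] [AddCommGroup V] [Module k V] {φ : α → V}
    (hφ : ⊤ ≤ Submodule.span k (range φ)) (B : Set α) :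
    IsFrame k φ B ↔ LinearIndepOn k φ B ∧ ∀ y, LinearIndepOn k φ (insert y B) → y ∈ B := by
  constructor
  · intro h
    exact ⟨h.indep, fun y => h.indep.mem_span_iff.1 (h.span trivial)⟩
  · rintro ⟨h1, h2⟩
    refine ⟨h1, hφ.trans (Submodule.span_le.2 ?_)⟩
    rintro _ ⟨y, rfl⟩
    exact h1.mem_span_iff.2 (h2 y)

theorem exists_isFrame {α k V : Type*} [Field k] [AddCommGroup V] [Module k V] {φ : α → V}
    (hφ : ⊤ ≤ Submodule.span k (range φ)) : ∃ B, IsFrame k φ B := by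
  obtain ⟨B, -, -, h1, h2⟩ := exists_linearIndepOn_extension (K := k) (v := φ)
    (linearIndepOn_empty k φ) (subset_univ _)
  refine ⟨B, h2, hφ.trans (Submodule.span_le.2 ?_)⟩
  rwa [← image_univ]

theorem exists_spanning {α k V : Type*} [Field k] [AddCommGroup V] [Module k V] (φ : α → V) :
    ∃ φ' : α → Submodule.span k (range φ), ⊤ ≤ Submodule.span k (range φ') ∧
      ∀ I, LinearIndepOn k φ' I ↔ LinearIndepOn k φ I := by
  refine ⟨fun x => ⟨φ x, Submodule.subset_span ⟨x, rfl⟩⟩, ?_, fun I => ?_⟩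
  · refine (Submodule.span_span_coe_preimage (R := k) (s := range φ)).ge.trans
      (Submodule.span_mono ?_)
    rintro ⟨_, _⟩ ⟨x, rfl⟩
    exact ⟨x, rfl⟩
  · rw [← (Submodule.span k (range φ)).subtype.linearIndepOn_iff_of_injOn
      Subtype.val_injective.injOn]
    rfl

theorem exists_linearIndepOn_iff {α F G K V₁ V₂ : Type*} [Field F] [Field G] [Field K]
    [AddCommGroup V₁] [Module F V₁] [AddCommGroup V₂] [Module G V₂] {f : G → K}
    (hf : IsLift F f) (φ : α → V₁) (χ : α → V₂)
    (h : ∀ I, LinearIndepOn F φ I ↔ LinearIndepOn G χ I) :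
    ∃ (X : Set α) (ψ : α → X →₀ K), ∀ I, LinearIndepOn F φ I ↔ LinearIndepOn K ψ I := by
  classical
  obtain ⟨φ', hφ, hφ'⟩ := exists_spanning (k := F) φ
  obtain ⟨χ', hχ, hχ'⟩ := exists_spanning (k := G) χ
  obtain ⟨X, hX⟩ := exists_isFrame hφ
  let ψ : α → X →₀ K := fun x => if hx : x ∈ X then Finsupp.single ⟨x, hx⟩ 1 else 0
  have hψ : (fun x : X => ψ x) = Finsupp.basisSingleOne (R := K) := by
    ext1 x
    simp [ψ]
  have hψX : IsFrame K ψ X := by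
    constructor
    · rw [LinearIndepOn, hψ]
      exact Finsupp.basisSingleOne.linearIndependent
    · rw [image_eq_range, hψ]
      exact Finsupp.basisSingleOne.span_eq.ge
  let S : Sys F G K α _ _ _ :=
    { φ := φ', χ := χ', ψ := ψ, X := X, f := f, hf := hf, hX := hX
      frame_iff := fun B => by simp only [isFrame_iff hφ, isFrame_iff hχ, hφ', hχ', h] }
  obtain ⟨ψ', hψ'⟩ := Sys.exists_good_univ (S := S) hψX
  exact ⟨X, ψ', fun I => (hφ' I).symm.trans (hψ'.linearIndepOn_iff I)⟩

theorem Representable.of_isLift {α : Type u} {M : Matroid α} {F : Type v} {G : Type w}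
    {K : Type*} [Field F] [Field G] [Field K] {f : G → K} (hf : IsLift F f)
    (hF : Representable M F) (hG : Representable M G) : Representable M K := by
  obtain ⟨V₁, _, _, φ, hφ⟩ := hF.exists_indep_iff
  obtain ⟨V₂, _, _, χ, hχ⟩ := hG.exists_indep_iff
  obtain ⟨X, ψ, hψ⟩ := exists_linearIndepOn_iff hf φ χ fun I => (hφ I).symm.trans (hχ I)
  exact ⟨X →₀ K, inferInstance, inferInstance, ψ, fun I _ => (hφ I).trans (hψ I)⟩

theorem three_le_mk_uLift {k : Type w} [Finite k] (h : 3 ≤ Nat.card k) :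
    3 ≤ Cardinal.mk (ULift.{v} k) := by
  have h' : ((3 : ℕ) : Cardinal) ≤ Cardinal.mk k := by
    rw [← Nat.cast_card]
    exact_mod_cast h
  simpa using h'

end Representations

end

end Paper

/-- A matroid `M` is representable over both `𝔽₃` and `𝔽₈` if and only if
`M` is representable over every field with at least three elements. -/
theorem representable_F3_and_F8_iff_representable_over_fields_with_three_elements
    {α : Type u} (M : Matroid α) :
    (Paper.Representable M (ZMod 3) ∧ Paper.Representable M (GaloisField 2 3)) ↔
      ∀ (K : Type v) [Field K], 3 ≤ Cardinal.mk K → Paper.Representable M K := by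
  constructor
  · rintro ⟨h3, h8⟩ K _ hK
    obtain ⟨a, ha0, ha1⟩ := Cardinal.exists_ne_ne_of_three_le hK 0 1
    obtain ⟨f, hf⟩ := Paper.exists_isLift (F := ZMod 3) (G := GaloisField 2 3) (by decide)
      (by decide) (CharTwo.two_eq_zero) (GaloisField.card 2 3 (by decide)) ha0 ha1
    exact Paper.Representable.of_isLift hf h3 h8
  · intro h
    have h8 : Nat.card (GaloisField 2 3) = 8 := GaloisField.card 2 3 (by decide)
    have : Finite (GaloisField 2 3) := Nat.finite_of_card_ne_zero (by omega)
    exact ⟨Paper.Representable.of_ringEquiv ULift.ringEquiv.symm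
        (h (ULift (ZMod 3)) (Paper.three_le_mk_uLift (by simp))),
      Paper.Representable.of_ringEquiv ULift.ringEquiv.symm
        (h (ULift (GaloisField 2 3)) (Paper.three_le_mk_uLift (by omega)))⟩
end
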